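/- Let Σ be a rational pointed fan in ℝ^d such that K[Σ] is Cohen–Macaulay, assume X = |Γ_Σ| is a manifold with non-empty boundary ∂X, and let Σ' ⊆ Σ be the subfan with ∂X = |Γ_{Σ'}|. If Σ' is an Euler fan and K[Σ'] is Cohen–Macaulay, then for every cone C ∈ Σ one has H̃^{dim Σ − 1}(𝒞^•_{str_Σ(C)}) = 0 if C ∈ Σ' and ≅ K if C ∉ Σ'. -/

import Mathlib

open scoped BigOperators Classical

noncomputable section

/-- The coercion of an integer point to a real point. -/
def Z2R {d : ℕ} (a : Fin d → ℤ) : Fin d → ℝ := fun i => (a i : ℝ)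

/-- The conical hull of a finite set of vectors. -/
def conicalHull {d : ℕ} (S : Finset (Fin d → ℝ)) : Set (Fin d → ℝ) :=
  {x | ∃ c : (Fin d → ℝ) → ℝ, (∀ v, 0 ≤ c v) ∧ x = ∑ v ∈ S, c v • v}

/-- A rational (polyhedral) cone: the conical hull of finitely many rational vectors. -/
def IsRatCone {d : ℕ} (C : Set (Fin d → ℝ)) : Prop :=
  ∃ S : Finset (Fin d → ℝ), (∀ v ∈ S, ∀ i, ∃ q : ℚ, v i = (q : ℝ)) ∧ C = conicalHull S

/-- A pointed cone contains no line. -/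
def IsPointedSet {d : ℕ} (C : Set (Fin d → ℝ)) : Prop :=
  ∀ x ∈ C, -x ∈ C → x = 0

/-- A rational pointed cone. -/
def IsRatPointedCone {d : ℕ} (C : Set (Fin d → ℝ)) : Prop :=
  IsRatCone C ∧ IsPointedSet C

/-- A convex cone (containing the origin). -/
def IsConvexCone {d : ℕ} (C : Set (Fin d → ℝ)) : Prop :=
  0 ∈ C ∧ (∀ x ∈ C, ∀ y ∈ C, x + y ∈ C) ∧ ∀ x ∈ C, ∀ t : ℝ, 0 ≤ t → t • x ∈ C

/-- `C'` is a face of the cone `C`. -/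
def IsFaceOf {d : ℕ} (C' C : Set (Fin d → ℝ)) : Prop :=
  IsConvexCone C' ∧ C' ⊆ C ∧ ∀ x ∈ C, ∀ y ∈ C, x + y ∈ C' → x ∈ C' ∧ y ∈ C'

/-- A rational pointed fan in `ℝ^d`. -/
structure Fan (d : ℕ) where
  cones : Set (Set (Fin d → ℝ))
  finite : cones.Finite
  pointed : ∀ C ∈ cones, IsRatPointedCone C
  faces_mem : ∀ C ∈ cones, ∀ C', IsFaceOf C' C → C' ∈ cones
  inter_face : ∀ C ∈ cones, ∀ C' ∈ cones, IsFaceOf (C ∩ C') C ∧ IsFaceOf (C ∩ C') C'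

/-- The dimension of a cone. -/
def coneDim {d : ℕ} (C : Set (Fin d → ℝ)) : ℕ :=
  Module.finrank ℝ (Submodule.span ℝ C)

/-- The dimension of a fan. -/
def Fan.dim {d : ℕ} (Φ : Fan d) : ℕ := sSup (coneDim '' Φ.cones)

/-- The set of lattice points in the support of a fan. -/
def Fan.supp {d : ℕ} (Φ : Fan d) : Set (Fin d → ℤ) :=
  {a | ∃ C ∈ Φ.cones, Z2R a ∈ C}

/-- The relative interior of a cone. -/
def relint {d : ℕ} (C : Set (Fin d → ℝ)) : Set (Fin d → ℝ) := intrinsicInterior ℝ C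

section ToricFaceRing

variable (K : Type) [Field K] {d : ℕ} (Φ : Fan d)

/-- The ambient polynomial ring: the monoid algebra of the free commutative
monoid on the lattice points of the support of the fan. -/
abbrev Fan.polyRing := AddMonoidAlgebra K (↥Φ.supp →₀ ℕ)

/-- The monomial of the ambient polynomial ring corresponding to a lattice point. -/
def Fan.X (m : ↥Φ.supp) : Φ.polyRing K :=
  AddMonoidAlgebra.single (Finsupp.single m 1) (1 : K)

/-- Auxiliary monomial: zero if the point is not in the support. -/
def Fan.Xaux (a : Fin d → ℤ) : Φ.polyRing K :=
  if h : a ∈ Φ.supp then Φ.X K ⟨a, h⟩ else 0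

/-- The defining relations of the toric face ring. -/
def Fan.relIdeal : Ideal (Φ.polyRing K) :=
  Ideal.span
    ({z | ∃ a b : ↥Φ.supp, (∃ C ∈ Φ.cones, Z2R a.1 ∈ C ∧ Z2R b.1 ∈ C) ∧
        z = Φ.X K a * Φ.X K b - Φ.Xaux K (a.1 + b.1)} ∪
     {z | ∃ a b : ↥Φ.supp, (¬ ∃ C ∈ Φ.cones, Z2R a.1 ∈ C ∧ Z2R b.1 ∈ C) ∧
        z = Φ.X K a * Φ.X K b} ∪
     {z | ∃ a : ↥Φ.supp, a.1 = 0 ∧ z = Φ.X K a - 1})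

/-- The toric face ring `K[Φ]` of a rational pointed fan `Φ`. -/
def ToricFaceRing := Φ.polyRing K ⧸ Φ.relIdeal K

instance : CommRing (ToricFaceRing K Φ) := Ideal.Quotient.commRing _
instance : Algebra K (ToricFaceRing K Φ) := Ideal.Quotient.algebra K

/-- The monomial `x^a` of the toric face ring. -/
def xpow (a : Fin d → ℤ) : ToricFaceRing K Φ :=
  Ideal.Quotient.mk (Φ.relIdeal K) (Φ.Xaux K a)

/-- A `ℤ^d`-graded (monomial) ideal of the toric face ring. -/
def IsMonomialIdeal (I : Ideal (ToricFaceRing K Φ)) : Prop :=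
  ∃ S : Set (Fin d → ℤ), I = Ideal.span (xpow K Φ '' S)

/-- The graded prime ideal `𝔭_C` associated to a cone. -/
def conePrime (C : Set (Fin d → ℝ)) : Ideal (ToricFaceRing K Φ) :=
  Ideal.span (xpow K Φ '' {a | Z2R a ∉ C})

/-- The graded radical ideal `𝔮_{Σ'}` associated to a collection of cones. -/
def subfanIdeal (T : Set (Set (Fin d → ℝ))) : Ideal (ToricFaceRing K Φ) :=
  Ideal.span (xpow K Φ '' {a | Z2R a ∉ ⋃₀ T})

/-- The graded maximal ideal of the toric face ring. -/
def gradedMaxIdeal : Ideal (ToricFaceRing K Φ) :=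
  Ideal.span (xpow K Φ '' {a | a ≠ 0})

end ToricFaceRing
/-- Auxiliary fuelled definition of a regular sequence contained in an ideal. -/
def RegSeqAux : ℕ → (R : Type) → [inst : CommRing R] → Ideal R → List R → Prop
  | 0, _, _, _, l => l = []
  | n + 1, R, _, I, l =>
      ∃ (x : R) (xs : List R), l = x :: xs ∧ x ∈ I ∧ x ∈ nonZeroDivisors R ∧
        RegSeqAux n (R ⧸ Ideal.span {x}) (Ideal.map (Ideal.Quotient.mk (Ideal.span {x})) I)
          (xs.map (Ideal.Quotient.mk (Ideal.span {x})))

/-- `l` is a regular sequence of `R` contained in the ideal `I`. -/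
def IsRegSeqIn (R : Type) [CommRing R] (I : Ideal R) (l : List R) : Prop :=
  RegSeqAux l.length R I l

/-- A (graded or local) ring is Cohen--Macaulay with respect to the (maximal) ideal `I` if
there is a regular sequence inside `I` whose length equals the Krull dimension. -/
def IsCMRingWrt (R : Type) [CommRing R] (I : Ideal R) : Prop :=
  ∃ l : List R, IsRegSeqIn R I l ∧ (l.length : WithBot (WithTop ℕ)) = ringKrullDim R

/-- Gorenstein with respect to the (maximal) ideal `I`: Cohen--Macaulay, and the quotient by
some maximal regular sequence has irreducible zero ideal. -/
def IsGorensteinRingWrt (R : Type) [CommRing R] (I : Ideal R) : Prop :=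
  IsCMRingWrt R I ∧
    ∃ l : List R, IsRegSeqIn R I l ∧ (l.length : WithBot (WithTop ℕ)) = ringKrullDim R ∧
      ∀ A B : Ideal (R ⧸ Ideal.span {x | x ∈ l}), A ⊓ B = ⊥ → A = ⊥ ∨ B = ⊥
/-- An incidence function on a fan. -/
structure IncidenceFunction {d : ℕ} (Φ : Fan d) where
  eps : Set (Fin d → ℝ) → Set (Fin d → ℝ) → ℤ
  supp : ∀ C' C, eps C' C ≠ 0 →
    C' ∈ Φ.cones ∧ C ∈ Φ.cones ∧ C' ⊆ C ∧ C' ≠ C ∧ coneDim C' + 1 = coneDim C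
  pm : ∀ C' C, C' ∈ Φ.cones → C ∈ Φ.cones → C' ⊆ C → C' ≠ C →
    coneDim C' + 1 = coneDim C → eps C' C = 1 ∨ eps C' C = -1
  cocycle : ∀ C'' C, C'' ∈ Φ.cones → C ∈ Φ.cones → C'' ⊆ C →
    coneDim C'' + 2 = coneDim C → (∑ᶠ C', eps C'' C' * eps C' C) = 0
/-- The unit sphere in `ℝ^n`. -/
def unitSphere (n : ℕ) : Set (Fin n → ℝ) := {x | ∑ i, (x i) ^ 2 = 1}

/-- The standard `m`-dimensional closed ball. -/
def ballModel (m : ℕ) : Set (Fin m → ℝ) := {x | ∑ i, (x i) ^ 2 ≤ 1}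

/-- The standard `m`-dimensional sphere. -/
def sphereModel (m : ℕ) : Set (Fin (m + 1) → ℝ) := {x | ∑ i, (x i) ^ 2 = 1}

/-- The underlying space `|Γ_T|` of the cell complex cut out on the unit sphere by a
collection `T` of cones. -/
def GammaSet {d : ℕ} (T : Set (Set (Fin d → ℝ))) : Set (Fin d → ℝ) :=
  ⋃₀ T ∩ unitSphere d
/-- A facet of a fan: a maximal cone. -/
def IsFacet {d : ℕ} (Φ : Fan d) (C : Set (Fin d → ℝ)) : Prop :=
  C ∈ Φ.cones ∧ ∀ D ∈ Φ.cones, C ⊆ D → D = C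

/-- The number `ρ_Φ(C) = Σ_i (−1)^{i+1} f_i(star_Φ(C))`. -/
def fanRho {d : ℕ} (Φ : Fan d) (C : Set (Fin d → ℝ)) : ℤ :=
  ∑ i ∈ Finset.range (Fan.dim Φ + 1),
    (-1 : ℤ) ^ (i + 1) *
      (Nat.card {D : Set (Fin d → ℝ) // D ∈ Φ.cones ∧ C ⊆ D ∧ coneDim D = i} : ℤ)

/-- An Euler fan: pure, with `ρ_Φ(C) = (−1)^{dim Φ − 1}` for every cone `C`. -/
def IsEulerFan {d : ℕ} (Φ : Fan d) : Prop :=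
  (∀ C, IsFacet Φ C → coneDim C = Fan.dim Φ) ∧
    ∀ C ∈ Φ.cones, fanRho Φ C = (-1 : ℤ) ^ (Fan.dim Φ - 1)
/-- The degree-`i` term of the cochain complex `𝒞^•` of the star of `C` inside the
collection of cones `T`: the `K`-vector space spanned by the cones `D ∈ T` with `C ⊆ D`
and `dim D = i + 1`. -/
abbrev Cterm (K : Type) [Field K] {d : ℕ} (T : Set (Set (Fin d → ℝ)))
    (C : Set (Fin d → ℝ)) (i : ℤ) : Type :=
  {D : Set (Fin d → ℝ) // D ∈ T ∧ C ⊆ D ∧ (coneDim D : ℤ) = i + 1} → K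

/-- Cast between degree terms of the star cochain complex. -/
def CtermCast (K : Type) [Field K] {d : ℕ} (T : Set (Set (Fin d → ℝ)))
    (C : Set (Fin d → ℝ)) {i j : ℤ} (h : i = j) : Cterm K T C i ≃ₗ[K] Cterm K T C j := by
  subst h; exact LinearEquiv.refl K _

/-- The differential `𝒞^i → 𝒞^{i+1}` of the star cochain complex, induced by the
incidence function `eps`. -/
def Cdiff (K : Type) [Field K] {d : ℕ} (eps : Set (Fin d → ℝ) → Set (Fin d → ℝ) → ℤ)
    (T : Set (Set (Fin d → ℝ))) (C : Set (Fin d → ℝ)) (i : ℤ) :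
    Cterm K T C i →ₗ[K] Cterm K T C (i + 1) :=
  LinearMap.pi fun D' =>
    ∑ᶠ D : {D : Set (Fin d → ℝ) // D ∈ T ∧ C ⊆ D ∧ (coneDim D : ℤ) = i + 1},
      eps D.1 D'.1 • (LinearMap.proj D : Cterm K T C i →ₗ[K] K)

/-- The `i`-th (reduced) cohomology `H̃^i(𝒞^•)` of the star cochain complex. -/
def Hcoh (K : Type) [Field K] {d : ℕ} (eps : Set (Fin d → ℝ) → Set (Fin d → ℝ) → ℤ)
    (T : Set (Set (Fin d → ℝ))) (C : Set (Fin d → ℝ)) (i : ℤ) : Type :=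
  ↥(LinearMap.ker (Cdiff K eps T C i)) ⧸
    Submodule.comap (LinearMap.ker (Cdiff K eps T C i)).subtype
      ((LinearMap.range (Cdiff K eps T C (i - 1))).map
        (CtermCast K T C (show i - 1 + 1 = i by ring)).toLinearMap)

instance (K : Type) [Field K] {d : ℕ} (eps : Set (Fin d → ℝ) → Set (Fin d → ℝ) → ℤ)
    (T : Set (Set (Fin d → ℝ))) (C : Set (Fin d → ℝ)) (i : ℤ) :
    AddCommGroup (Hcoh K eps T C i) := by unfold Hcoh; infer_instance

instance (K : Type) [Field K] {d : ℕ} (eps : Set (Fin d → ℝ) → Set (Fin d → ℝ) → ℤ)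
    (T : Set (Set (Fin d → ℝ))) (C : Set (Fin d → ℝ)) (i : ℤ) :
    Module K (Hcoh K eps T C i) := by unfold Hcoh; infer_instance
/-- The standard closed half space in `ℝ^n`. -/
def halfSpaceSet (n : ℕ) : Set (Fin n → ℝ) := {x | ∀ h : 0 < n, 0 ≤ x ⟨0, h⟩}

/-- `X` is an `n`-dimensional topological manifold with boundary `B`: every point has an
open neighbourhood homeomorphic to an open subset of the half space, the boundary points
being exactly those mapped onto the bounding hyperplane. -/
def IsManifoldWithBoundary (n : ℕ) (X : Type) [TopologicalSpace X] (B : Set X) : Prop :=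
  ∀ p : X, ∃ (U : Set X) (V : Set ↥(halfSpaceSet n)), IsOpen U ∧ IsOpen V ∧ p ∈ U ∧
    ∃ φ : ↥U ≃ₜ ↥V, ∀ x : ↥U,
      ((x : X) ∈ B ↔ ∃ h : 0 < n, ((φ x : ↥(halfSpaceSet n)) : Fin n → ℝ) ⟨0, h⟩ = 0)
open scoped Topology

section

/-- If a parameter integral of polynomials of bounded degree is constant on an interval,
then it takes the same value at `1`. -/
lemma integral_eval_one_eq_of_const {α : Type*} [MeasurableSpace α] {μ : MeasureTheory.Measure α}
    (P : α → Polynomial ℝ) (N : ℕ) (hdeg : ∀ x, (P x).natDegree ≤ N)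
    (hfi : ∀ t, MeasureTheory.Integrable (fun x => (P x).eval t) μ) (c t₀ : ℝ) (ht₀ : 0 < t₀)
    (hc : ∀ t ∈ Set.Icc 0 t₀, ∫ x, (P x).eval t ∂μ = c) : ∫ x, (P x).eval 1 ∂μ = c := by
  let v : ℕ → ℝ := fun i => t₀ * (i / (N + 1))
  have hN : (0 : ℝ) < N + 1 := by positivity
  have hv : Set.InjOn v (Finset.range (N + 1)) := by
    intro i _ j _ h
    have h1 := mul_left_cancel₀ ht₀.ne' h
    rw [div_left_inj' hN.ne'] at h1
    exact_mod_cast h1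
  have key : ∀ x, (P x).eval 1 = ∑ i ∈ Finset.range (N + 1),
      (P x).eval (v i) * (Lagrange.basis (Finset.range (N + 1)) v i).eval 1 := by
    intro x
    have h := Lagrange.eq_interpolate (f := P x) hv (by
      rw [Finset.card_range]
      exact lt_of_le_of_lt Polynomial.degree_le_natDegree
        (by exact_mod_cast Nat.lt_succ_of_le (hdeg x)))
    conv_lhs => rw [h, Lagrange.interpolate_apply, Polynomial.eval_finsetSum]
    simp
  simp_rw [key]
  rw [MeasureTheory.integral_finsetSum _ (fun i _ => (hfi _).mul_const _)]
  simp_rw [MeasureTheory.integral_mul_const]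
  have h2 : ∀ i ∈ Finset.range (N + 1), (∫ x, (P x).eval (v i) ∂μ) *
      (Lagrange.basis (Finset.range (N + 1)) v i).eval 1
      = c * (Lagrange.basis (Finset.range (N + 1)) v i).eval 1 := by
    intro i hi
    rw [hc]
    have hi' : (i : ℝ) ≤ N + 1 := by
      have := Finset.mem_range.1 hi
      exact_mod_cast this.le
    refine ⟨by positivity, ?_⟩
    have : (i : ℝ) / (N + 1) ≤ 1 := by rw [div_le_one hN]; exact hi'
    show t₀ * (i / (N + 1)) ≤ t₀
    nlinarith
  rw [Finset.sum_congr rfl h2, ← Finset.mul_sum, ← Polynomial.eval_finsetSum,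
    Lagrange.sum_basis hv (by simp)]
  simp

/-- The derivative of a small perturbation of the identity has positive determinant. -/
lemma det_id_add_pos {E : Type*} [NormedAddCommGroup E] [NormedSpace ℝ E] [FiniteDimensional ℝ E]
    (T : E →L[ℝ] E) (hT : ‖T‖ < 1) : 0 < (ContinuousLinearMap.id ℝ E + T).det := by
  have hne : ∀ s ∈ Set.Icc (0 : ℝ) 1, (ContinuousLinearMap.id ℝ E + s • T).det ≠ 0 := by
    intro s hs h0
    obtain ⟨v, hv, hv0⟩ := (Submodule.ne_bot_iff _).1 (ne_of_gt (LinearMap.bot_lt_ker_of_det_eq_zero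
      (f := ((ContinuousLinearMap.id ℝ E + s • T : E →L[ℝ] E) : E →ₗ[ℝ] E)) h0))
    have hv1 : v + s • T v = 0 := by simpa using hv
    have hv2 : v = - (s • T v) := eq_neg_of_add_eq_zero_left hv1
    have h3 : ‖v‖ ≤ ‖T‖ * ‖v‖ := by
      calc ‖v‖ = ‖s • T v‖ := by conv_lhs => rw [hv2, norm_neg]
        _ = s * ‖T v‖ := by rw [norm_smul, Real.norm_of_nonneg hs.1]
        _ ≤ 1 * ‖T v‖ := by gcongr; exact hs.2
        _ ≤ _ := by rw [one_mul]; exact T.le_opNorm v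
    have : 0 < ‖v‖ := norm_pos_iff.2 hv0
    nlinarith
  have hcont : ContinuousOn (fun s : ℝ => (ContinuousLinearMap.id ℝ E + s • T).det) (Set.Icc 0 1) := by
    apply Continuous.continuousOn
    exact ContinuousLinearMap.continuous_det.comp (by fun_prop)
  by_contra hneg
  push Not at hneg
  have h0 : (0 : ℝ) ∈ Set.Icc ((ContinuousLinearMap.id ℝ E + (1 : ℝ) • T).det)
      ((ContinuousLinearMap.id ℝ E + (0 : ℝ) • T).det) := by
    refine ⟨by simpa using hneg, ?_⟩
    have : (ContinuousLinearMap.id ℝ E).det = 1 := by simp [ContinuousLinearMap.det]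
    simp [this]
  obtain ⟨s, hs, hs0⟩ := intermediate_value_Icc' zero_le_one hcont h0
  exact hne s hs hs0

variable {n : ℕ}

/-- Euclidean space of dimension `n`. -/
abbrev Euc (n : ℕ) := EuclideanSpace ℝ (Fin n)

/-- Change of variables for small compactly supported perturbations of the identity. -/
lemma integral_perturb_small (g : (Euc n) → Euc n) (hg : ContDiff ℝ 1 g) (R : ℝ)
    (hR : ∀ x, R ≤ ‖x‖ → g x = 0) (ω : (Euc n) → ℝ) :
    ∃ t₀ > (0 : ℝ), ∀ t ∈ Set.Icc 0 t₀,
      ∫ x in Metric.closedBall 0 R, ω (x + t • g x) *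
        (ContinuousLinearMap.id ℝ _ + t • fderiv ℝ g x).det = ∫ x in Metric.closedBall 0 R, ω x := by
  have hcs : HasCompactSupport g := by
    apply HasCompactSupport.intro (isCompact_closedBall (0 : Euc n) R)
    intro x hx
    apply hR
    simp only [Metric.mem_closedBall, dist_zero_right, not_le] at hx
    exact hx.le
  obtain ⟨L, hL⟩ := ContDiff.lipschitzWith_of_hasCompactSupport hcs hg (by norm_num)
  refine ⟨1 / (2 * (L + 1)), by positivity, ?_⟩
  rintro t ⟨ht0, ht1⟩
  have hLnn : (0 : ℝ) ≤ L := L.2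
  have htL : t * L ≤ 1 / 2 := by
    have h1 : t * (L + 1) ≤ 1 / 2 := by
      calc t * (L + 1) ≤ 1 / (2 * (L + 1)) * (L + 1) := by gcongr
        _ = 1 / 2 := by field_simp
    nlinarith
  have hdiff : ∀ x, HasFDerivAt (fun x => x + t • g x)
      (ContinuousLinearMap.id ℝ _ + t • fderiv ℝ g x) x := by
    intro x
    exact (hasFDerivAt_id x).add (((hg.differentiable (by norm_num)) x).hasFDerivAt.const_smul t)
  have happ : ApproximatesLinearOn (fun x => x + t • g x)
      ((ContinuousLinearEquiv.refl ℝ (Euc n) : (Euc n) ≃L[ℝ] Euc n) : (Euc n) →L[ℝ] Euc n) Set.univ (1/2 : NNReal) := by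
    intro x _ y _
    have h1 : x + t • g x - (y + t • g y) -
      ((ContinuousLinearEquiv.refl ℝ (Euc n) : (Euc n) ≃L[ℝ] Euc n) : (Euc n) →L[ℝ] Euc n) (x - y) = t • (g x - g y) := by
      simp [smul_sub]; abel
    rw [h1, norm_smul, Real.norm_of_nonneg ht0]
    have h2 := hL.dist_le_mul x y
    rw [dist_eq_norm, dist_eq_norm] at h2
    calc t * ‖g x - g y‖ ≤ t * (L * ‖x - y‖) := by gcongr
      _ = (t * L) * ‖x - y‖ := by ring
      _ ≤ 1 / 2 * ‖x - y‖ := by gcongr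
      _ = _ := by simp
  have hc : Subsingleton (Euc n) ∨ (1/2 : NNReal) <
      ‖((ContinuousLinearEquiv.refl ℝ (Euc n)).symm : (Euc n) →L[ℝ] Euc n)‖₊⁻¹ := by
    rcases subsingleton_or_nontrivial (Euc n) with h | h
    · exact Or.inl h
    · right
      have : ‖((ContinuousLinearEquiv.refl ℝ (Euc n)).symm : (Euc n) →L[ℝ] Euc n)‖₊ = 1 := by
        have := ContinuousLinearMap.nnnorm_id (𝕜 := ℝ) (E := Euc n)
        exact this
      rw [this, inv_one]
      rw [← NNReal.coe_lt_coe]; norm_num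
  have hinj : Function.Injective (fun x => x + t • g x) := (happ.toHomeomorph _ hc).injective
  have hsurj : Function.Surjective (fun x => x + t • g x) := (happ.toHomeomorph _ hc).surjective
  have hout : ∀ x, R ≤ ‖x‖ → x + t • g x = x := fun x hx => by simp [hR x hx]
  have himg : (fun x => x + t • g x) '' Metric.closedBall 0 R = Metric.closedBall 0 R := by
    apply Set.Subset.antisymm
    · rintro _ ⟨x, hx, rfl⟩
      by_contra hy
      simp only [Metric.mem_closedBall, dist_zero_right, not_le] at hx hy
      have h2 := hinj (hout _ hy.le)
      simp only at h2
      rw [h2] at hy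
      linarith
    · intro y hy
      obtain ⟨x, hx⟩ := hsurj y
      refine ⟨x, ?_, hx⟩
      by_contra hx'
      simp only [Metric.mem_closedBall, dist_zero_right, not_le] at hy hx'
      simp only [hout x hx'.le] at hx
      rw [hx] at hx'
      linarith
  have hcv := MeasureTheory.integral_image_eq_integral_abs_det_fderiv_smul MeasureTheory.volume
    (Metric.isClosed_closedBall (x := (0 : Euc n)) (ε := R)).measurableSet
    (fun x _ => (hdiff x).hasFDerivWithinAt) hinj.injOn ω
  rw [himg] at hcv
  rw [hcv]
  congr 1
  ext x
  rw [abs_of_pos, smul_eq_mul, mul_comm]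
  apply det_id_add_pos
  rw [norm_smul, Real.norm_of_nonneg ht0]
  have : ‖fderiv ℝ g x‖ ≤ L := norm_fderiv_le_of_lipschitz ℝ hL
  nlinarith

lemma exists_polynomial_weighted_det (c : ℝ) (k : ℕ) (x y : Euc n) (T : (Euc n) →L[ℝ] Euc n) :
    ∃ P : Polynomial ℝ, P.natDegree ≤ 2 * k + n ∧ ∀ t,
      P.eval t = (1 - c * ‖x + t • y‖ ^ 2) ^ k * (ContinuousLinearMap.id ℝ _ + t • T).det := by
  let b := (EuclideanSpace.basisFun (Fin n) ℝ).toBasis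
  let D : Matrix (Fin n) (Fin n) ℝ := LinearMap.toMatrix b b (T : (Euc n) →ₗ[ℝ] Euc n)
  let Q : Polynomial ℝ := 1 - Polynomial.C c * ∑ i, (Polynomial.C (x i) + Polynomial.C (y i) * Polynomial.X) ^ 2
  let W : Polynomial ℝ := (Matrix.det ((Polynomial.X : Polynomial ℝ) • D.map Polynomial.C + (1 : Matrix (Fin n) (Fin n) ℝ).map Polynomial.C))
  refine ⟨Q ^ k * W, ?_, ?_⟩
  · refine Polynomial.natDegree_mul_le.trans ?_
    have hW : W.natDegree ≤ n := by
      have := Polynomial.natDegree_det_X_add_C_le D 1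
      rwa [Fintype.card_fin] at this
    have hQ : Q.natDegree ≤ 2 := by
      refine (Polynomial.natDegree_sub_le _ _).trans ?_
      simp only [Polynomial.natDegree_one, zero_le, sup_of_le_right]
      refine (Polynomial.natDegree_C_mul_le _ _).trans ?_
      apply Polynomial.natDegree_sum_le_of_forall_le
      intro i _
      refine Polynomial.natDegree_pow_le.trans ?_
      have : (Polynomial.C (x i) + Polynomial.C (y i) * Polynomial.X).natDegree ≤ 1 := by
        compute_degree
      omega
    have := Polynomial.natDegree_pow_le_of_le k hQ
    calc _ ≤ k * 2 + n := add_le_add this hW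
      _ = _ := by ring
  · intro t
    rw [Polynomial.eval_mul, Polynomial.eval_pow]
    congr 1
    · congr 1
      simp only [Q, Polynomial.eval_sub, Polynomial.eval_one, Polynomial.eval_mul, Polynomial.eval_C,
        Polynomial.eval_finsetSum, Polynomial.eval_pow, Polynomial.eval_add, Polynomial.eval_X]
      rw [EuclideanSpace.norm_sq_eq]
      congr 2
      apply Finset.sum_congr rfl
      intro i _
      simp [mul_comm]
    · have h1 : (ContinuousLinearMap.id ℝ (Euc n) + t • T).det = (1 + t • D).det := by
        rw [ContinuousLinearMap.det, ← LinearMap.det_toMatrix b]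
        congr 1
        simp [D]
      rw [h1]
      simp only [W]
      have h2 := RingHom.map_det (Polynomial.evalRingHom t)
        ((Polynomial.X : Polynomial ℝ) • D.map Polynomial.C + (1 : Matrix (Fin n) (Fin n) ℝ).map Polynomial.C)
      rw [Polynomial.coe_evalRingHom] at h2
      rw [h2]
      congr 1
      ext i j
      simp [Matrix.one_apply]
      split_ifs <;> simp <;> ring

/-- The weighted integral of the Jacobian of a map only depends on its boundary values. -/
lemma integral_weighted_det (h : (Euc n) → Euc n) (hh : ContDiff ℝ 1 h) (R : ℝ)
    (hR : ∀ x, R ≤ ‖x‖ → h x = x) (c : ℝ) (k : ℕ) :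
    ∫ x in Metric.closedBall 0 R, (1 - c * ‖h x‖ ^ 2) ^ k * (fderiv ℝ h x).det
      = ∫ x in Metric.closedBall (0 : Euc n) R, (1 - c * ‖x‖ ^ 2) ^ k := by
  let g : (Euc n) → Euc n := fun x => h x - x
  have hg : ContDiff ℝ 1 g := hh.sub contDiff_id
  have hfd : ∀ x, fderiv ℝ h x = ContinuousLinearMap.id ℝ _ + fderiv ℝ g x := by
    intro x
    have : HasFDerivAt g (fderiv ℝ h x - ContinuousLinearMap.id ℝ _) x :=
      (hh.differentiable (by norm_num) x).hasFDerivAt.sub (hasFDerivAt_id x)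
    rw [this.fderiv]; abel
  obtain ⟨t₀, ht₀, H⟩ := integral_perturb_small g hg R (fun x hx => by simp [g, hR x hx])
    (fun x => (1 - c * ‖x‖ ^ 2) ^ k)
  choose P hP1 hP2 using fun x => exists_polynomial_weighted_det c k x (g x) (fderiv ℝ g x)
  have := integral_eval_one_eq_of_const (μ := MeasureTheory.volume.restrict (Metric.closedBall (0 : Euc n) R))
    P (2 * k + n) hP1 (by
      intro t
      simp_rw [hP2]
      apply ContinuousOn.integrableOn_compact (isCompact_closedBall _ _)
      apply Continuous.continuousOn
      apply Continuous.mul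
      · have := hg.continuous
        fun_prop
      · apply ContinuousLinearMap.continuous_det.comp
        have := hg.continuous_fderiv (by norm_num)
        fun_prop) _ t₀ ht₀ (by
      intro t ht
      simp_rw [hP2]
      exact H t ht)
  rw [← this]
  congr 1
  ext x
  rw [hP2, hfd]
  simp [g]

/-- A `C¹` self-map which is the identity near infinity has a point near the zero fibre with
positive Jacobian. -/
lemma exists_det_pos_of_eq_id (h : (Euc n) → Euc n) (hh : ContDiff ℝ 1 h) (R : ℝ)
    (hR : ∀ x, R ≤ ‖x‖ → h x = x) (δ : ℝ) (hδ : 0 < δ) :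
    ∃ x, ‖h x‖ < δ ∧ 0 < (fderiv ℝ h x).det := by
  by_contra hcon
  push Not at hcon
  obtain ⟨M₀, hM₀⟩ := ((isCompact_closedBall (0 : Euc n) (max R δ)).image hh.continuous).isBounded.exists_norm_le
  set R₁ := max R δ with hR₁
  have hR₁δ : δ ≤ R₁ := le_max_right _ _
  set M := max M₀ R₁ with hM
  have hMR : R₁ ≤ M := le_max_right _ _
  have hM0 : 0 < M := by linarith
  have hhM : ∀ x ∈ Metric.closedBall (0 : Euc n) R₁, ‖h x‖ ≤ M := fun x hx =>
    (hM₀ _ ⟨x, hx, rfl⟩).trans (le_max_left _ _)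
  have hdc : Continuous fun x => (fderiv ℝ h x).det :=
    ContinuousLinearMap.continuous_det.comp (hh.continuous_fderiv (by norm_num))
  obtain ⟨D, hD⟩ := ((isCompact_closedBall (0 : Euc n) R₁).image hdc).isBounded.exists_norm_le
  set q := 1 - 1 / M ^ 2 * δ ^ 2 with hq
  set p := 1 - 1 / M ^ 2 * (δ / 2) ^ 2 with hp
  have hcM : 1 / M ^ 2 * M ^ 2 = 1 := by field_simp
  have hc0 : 0 < 1 / M ^ 2 := by positivity
  have hq0 : 0 ≤ q := by
    have : 1 / M ^ 2 * δ ^ 2 ≤ 1 / M ^ 2 * M ^ 2 := by gcongr; linarith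
    linarith
  have hqp : q < p := by
    have : 1 / M ^ 2 * (δ / 2) ^ 2 < 1 / M ^ 2 * δ ^ 2 := by gcongr; linarith
    linarith
  have hp0 : 0 < p := by linarith
  set V := (MeasureTheory.volume (Metric.closedBall (0 : Euc n) R₁)).toReal with hV
  set v := (MeasureTheory.volume (Metric.closedBall (0 : Euc n) (δ / 2))).toReal with hv
  have hvpos : 0 < v := ENNReal.toReal_pos
    (Metric.measure_closedBall_pos _ _ (by linarith)).ne' MeasureTheory.measure_closedBall_lt_top.ne
  have hfin : ∀ r, MeasureTheory.volume (Metric.closedBall (0 : Euc n) r) ≠ ⊤ := fun r =>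
    MeasureTheory.measure_closedBall_lt_top.ne
  have hin : ∀ (f : (Euc n) → ℝ) (r : ℝ), Continuous f →
      MeasureTheory.IntegrableOn f (Metric.closedBall (0 : Euc n) r) := fun f r hf =>
    hf.continuousOn.integrableOn_compact (isCompact_closedBall _ _)
  have main : ∀ k : ℕ, v * p ^ k ≤ V * (D * q ^ k) := by
    intro k
    have hI := integral_weighted_det h hh R₁ (fun x hx => hR x ((le_max_left _ _).trans hx))
      (1 / M ^ 2) k
    have hw : ∀ y : Euc n, ‖y‖ ≤ M → 0 ≤ 1 - 1 / M ^ 2 * ‖y‖ ^ 2 := by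
      intro y hy
      have : 1 / M ^ 2 * ‖y‖ ^ 2 ≤ 1 / M ^ 2 * M ^ 2 := by gcongr
      linarith
    have hup : ∫ x in Metric.closedBall (0 : Euc n) R₁,
        (1 - 1 / M ^ 2 * ‖h x‖ ^ 2) ^ k * (fderiv ℝ h x).det ≤
        ∫ x in Metric.closedBall (0 : Euc n) R₁, D * q ^ k := by
      apply MeasureTheory.setIntegral_mono_on
      · apply hin
        have := hh.continuous
        fun_prop
      · exact hin _ _ continuous_const
      · exact measurableSet_closedBall
      · intro x hx
        have hDx : |(fderiv ℝ h x).det| ≤ D := hD _ ⟨x, hx, rfl⟩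
        have hD0 : 0 ≤ D := (abs_nonneg _).trans hDx
        have hwx := hw _ (hhM x hx)
        by_cases hx' : ‖h x‖ < δ
        · have : (1 - 1 / M ^ 2 * ‖h x‖ ^ 2) ^ k * (fderiv ℝ h x).det ≤ 0 :=
            mul_nonpos_of_nonneg_of_nonpos (by positivity) (hcon x hx')
          exact this.trans (by positivity)
        · have h1 : 1 - 1 / M ^ 2 * ‖h x‖ ^ 2 ≤ q := by
            have : 1 / M ^ 2 * δ ^ 2 ≤ 1 / M ^ 2 * ‖h x‖ ^ 2 := by
              push Not at hx'
              gcongr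
            linarith
          calc _ ≤ (1 - 1 / M ^ 2 * ‖h x‖ ^ 2) ^ k * D := by
                gcongr
                exact (le_abs_self _).trans hDx
            _ ≤ q ^ k * D := by gcongr
            _ = _ := mul_comm _ _
    have hlo : ∫ x in Metric.closedBall (0 : Euc n) (δ / 2), p ^ k ≤
        ∫ x in Metric.closedBall (0 : Euc n) R₁, (1 - 1 / M ^ 2 * ‖x‖ ^ 2) ^ k := by
      have h1 : ∫ x in Metric.closedBall (0 : Euc n) (δ / 2), p ^ k ≤
          ∫ x in Metric.closedBall (0 : Euc n) (δ / 2), (1 - 1 / M ^ 2 * ‖x‖ ^ 2) ^ k := by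
        apply MeasureTheory.setIntegral_mono_on
        · exact hin _ _ continuous_const
        · exact hin _ _ (by fun_prop)
        · exact measurableSet_closedBall
        · intro x hx
          rw [mem_closedBall_zero_iff] at hx
          have : 1 / M ^ 2 * ‖x‖ ^ 2 ≤ 1 / M ^ 2 * (δ / 2) ^ 2 := by gcongr
          apply pow_le_pow_left₀ hp0.le
          linarith
      refine h1.trans (MeasureTheory.setIntegral_mono_set (hin _ _ (by fun_prop)) ?_ ?_)
      · filter_upwards [MeasureTheory.ae_restrict_mem measurableSet_closedBall] with x hx
        rw [mem_closedBall_zero_iff] at hx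
        exact pow_nonneg (hw x (hx.trans hMR)) k
      · exact (Metric.closedBall_subset_closedBall (by linarith)).eventuallyLE
    rw [MeasureTheory.setIntegral_const, smul_eq_mul] at hup hlo
    have := hlo.trans (hI.symm.le.trans hup)
    simpa [MeasureTheory.measureReal_def] using this
  have hlim : Filter.Tendsto (fun k : ℕ => V * D * (q / p) ^ k) Filter.atTop (nhds (V * D * 0)) :=
    (tendsto_pow_atTop_nhds_zero_of_lt_one (by positivity) (by rwa [div_lt_one hp0])).const_mul _
  rw [mul_zero] at hlim
  obtain ⟨k, hk⟩ := (hlim.eventually (gt_mem_nhds hvpos)).exists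
  have h2 := main k
  have hpk : 0 < p ^ k := by positivity
  rw [div_pow, ← mul_div_assoc, div_lt_iff₀ hpk] at hk
  linarith

end

section

variable {n : ℕ}

/-- A continuous self-map of Euclidean space which is the identity near infinity, and is affine
with non-positive determinant near the origin, has a zero away from the origin. -/
lemma exists_zero_of_affine_center (h : Euc n → Euc n) (hh : Continuous h)
    (hR : ∀ x, 1 ≤ ‖x‖ → h x = x) (A : Euc n →L[ℝ] Euc n) (hA : A.det ≤ 0) (c : Euc n)
    (hc : ∀ x, ‖x‖ ≤ 1 / 2 → h x = c + A x) : ∃ x, 1 / 4 ≤ ‖x‖ ∧ h x = 0 := by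
  by_contra hcon
  push Not at hcon
  have hK : IsCompact (Metric.closedBall (0 : Euc n) 1 ∩ {x | 1 / 4 ≤ ‖x‖}) :=
    (isCompact_closedBall _ _).inter_right (isClosed_le continuous_const continuous_norm)
  obtain ⟨δ, hδ, hδK⟩ : ∃ δ > (0 : ℝ), ∀ x ∈ Metric.closedBall (0 : Euc n) 1 ∩ {x | 1 / 4 ≤ ‖x‖}, δ ≤ ‖h x‖ := by
    rcases (Metric.closedBall (0 : Euc n) 1 ∩ {x | 1 / 4 ≤ ‖x‖}).eq_empty_or_nonempty with he | hne
    · exact ⟨1, one_pos, by simp only [he]; simp⟩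
    · obtain ⟨x₀, hx₀, hmin⟩ := hK.exists_isMinOn hne hh.norm.continuousOn
      exact ⟨‖h x₀‖, norm_pos_iff.2 (hcon x₀ hx₀.2), fun x hx => hmin hx⟩
  set δ' := min δ 1 with hδ'
  have hδ'0 : 0 < δ' := lt_min hδ one_pos
  have hlow : ∀ x, 1 / 4 ≤ ‖x‖ → δ' ≤ ‖h x‖ := by
    intro x hx
    by_cases h1 : ‖x‖ ≤ 1
    · exact (min_le_left _ _).trans (hδK x ⟨by simpa using h1, hx⟩)
    · push Not at h1
      rw [hR x h1.le]
      exact (min_le_right _ _).trans h1.le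
  have hS : IsClosed (Metric.closedBall (0 : Euc n) (1 / 4) ∪ {x | 2 ≤ ‖x‖}) :=
    Metric.isClosed_closedBall.union (isClosed_le continuous_const continuous_norm)
  have hUo : IsOpen (Metric.ball (0 : Euc n) (1 / 2) ∪ {x | 1 < ‖x‖}) :=
    Metric.isOpen_ball.union (isOpen_lt continuous_const continuous_norm)
  have hU : (Metric.ball (0 : Euc n) (1 / 2) ∪ {x | 1 < ‖x‖}) ∈
      nhdsSet (Metric.closedBall (0 : Euc n) (1 / 4) ∪ {x | 2 ≤ ‖x‖}) := by
    rw [hUo.mem_nhdsSet]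
    apply Set.union_subset_union
    · exact Metric.closedBall_subset_ball (by norm_num)
    · intro x (hx : 2 ≤ ‖x‖)
      show 1 < ‖x‖
      linarith
  have hfU : ContDiffOn ℝ (1 : ℕ∞) h (Metric.ball (0 : Euc n) (1 / 2) ∪ {x | 1 < ‖x‖}) := by
    rintro x (hx | hx)
    · apply ContDiffAt.contDiffWithinAt
      have : h =ᶠ[nhds x] fun x => c + A x := by
        filter_upwards [Metric.isOpen_ball.mem_nhds hx] with y hy
        exact hc y (by simpa using (mem_ball_zero_iff.1 hy).le)
      refine ContDiffAt.congr_of_eventuallyEq ?_ this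
      fun_prop
    · apply ContDiffAt.contDiffWithinAt
      have : h =ᶠ[nhds x] fun x => x := by
        filter_upwards [(isOpen_lt continuous_const continuous_norm).mem_nhds hx] with y hy
        exact hR y (le_of_lt hy)
      exact contDiffAt_id.congr_of_eventuallyEq this
  obtain ⟨g, hg, hgd, hgS, -⟩ := hh.exists_contDiff_approx_and_eqOn 1
    (continuous_const (y := δ' / 2)) (fun _ => by linarith) hS hU hfU
  obtain ⟨x, hx, hdet⟩ := exists_det_pos_of_eq_id g hg 2 (fun x hx => by
    rw [hgS (Or.inr hx), hR x (by linarith)]) (δ' / 2) (by linarith)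
  have hx4 : ‖x‖ < 1 / 4 := by
    by_contra hx4
    push Not at hx4
    have h1 := hlow x hx4
    have h2 := hgd x
    rw [dist_eq_norm] at h2
    have h3 := norm_sub_norm_le (h x) (g x)
    rw [norm_sub_rev] at h3
    linarith
  have : g =ᶠ[nhds x] fun x => c + A x := by
    filter_upwards [Metric.isOpen_ball.mem_nhds (mem_ball_zero_iff.2 hx4)] with y hy
    have hy' := mem_ball_zero_iff.1 hy
    rw [hgS (Or.inl (by simpa using hy'.le)), hc y (by linarith)]
  rw [this.fderiv_eq] at hdet
  have h3 : fderiv ℝ (fun x => c + A x) x = A := by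
    rw [fderiv_const_add]
    exact A.fderiv
  rw [h3] at hdet
  linarith

/-- A map which is continuous and does not vanish on the unit sphere. -/
def NZ (f : Euc n → Euc n) : Prop :=
  ContinuousOn f (Metric.sphere 0 1) ∧ ∀ u ∈ Metric.sphere (0 : Euc n) 1, f u ≠ 0

/-- The continuous map from the unit sphere to punctured Euclidean space. -/
def NZ.toMap {f : Euc n → Euc n} (hf : NZ f) :
    C(Metric.sphere (0 : Euc n) 1, {x : Euc n // x ≠ 0}) :=
  ⟨fun u => ⟨f u, hf.2 u u.2⟩, (continuousOn_iff_continuous_domRestrict.1 hf.1).subtype_mk _⟩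

/-- Two maps are homotopic as maps from the unit sphere to punctured Euclidean space. -/
def Htp (f g : Euc n → Euc n) : Prop :=
  ∃ (hf : NZ f) (hg : NZ g), hf.toMap.Homotopic hg.toMap

lemma Htp.refl {f : Euc n → Euc n} (hf : NZ f) : Htp f f :=
  ⟨hf, hf, ContinuousMap.Homotopic.refl _⟩

lemma Htp.symm {f g : Euc n → Euc n} (h : Htp f g) : Htp g f := by
  obtain ⟨hf, hg, H⟩ := h
  exact ⟨hg, hf, H.symm⟩

lemma Htp.trans {f g k : Euc n → Euc n} (h : Htp f g) (h' : Htp g k) : Htp f k := by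
  obtain ⟨hf, hg, H⟩ := h
  obtain ⟨hg', hk, H'⟩ := h'
  exact ⟨hf, hk, H.trans H'⟩

lemma Htp.of {f g : Euc n → Euc n} (H : ℝ → Euc n → Euc n)
    (hc : ContinuousOn (fun p : ℝ × Euc n => H p.1 p.2) (Set.Icc 0 1 ×ˢ Metric.sphere 0 1))
    (h0 : ∀ t ∈ Set.Icc (0 : ℝ) 1, ∀ u ∈ Metric.sphere (0 : Euc n) 1, H t u ≠ 0)
    (hf : ∀ u ∈ Metric.sphere (0 : Euc n) 1, H 0 u = f u)
    (hg : ∀ u ∈ Metric.sphere (0 : Euc n) 1, H 1 u = g u) : Htp f g := by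
  have key : ∀ t ∈ Set.Icc (0 : ℝ) 1, ContinuousOn (H t) (Metric.sphere 0 1) := by
    intro t ht
    have := hc.comp (f := fun u : Euc n => (t, u)) (s := Metric.sphere 0 1) (by fun_prop)
      (fun u hu => ⟨ht, hu⟩)
    exact this
  have h00 : (0 : ℝ) ∈ Set.Icc (0 : ℝ) 1 := by simp
  have h11 : (1 : ℝ) ∈ Set.Icc (0 : ℝ) 1 := by simp
  have hf' : NZ f := ⟨(key 0 h00).congr fun u hu => (hf u hu).symm,
    fun u hu => by rw [← hf u hu]; exact h0 0 h00 u hu⟩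
  have hg' : NZ g := ⟨(key 1 h11).congr fun u hu => (hg u hu).symm,
    fun u hu => by rw [← hg u hu]; exact h0 1 h11 u hu⟩
  refine ⟨hf', hg', ⟨⟨⟨fun p => ⟨H p.1 p.2, h0 p.1 p.1.2 p.2 p.2.2⟩, ?_⟩, ?_, ?_⟩⟩⟩
  · apply Continuous.subtype_mk
    exact hc.comp_continuous
      (f := fun p : unitInterval × Metric.sphere (0 : Euc n) 1 => ((p.1 : ℝ), (p.2 : Euc n)))
      (by fun_prop) (fun p => ⟨p.1.2, p.2.2⟩)
  · intro u
    apply Subtype.ext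
    show H _ (u : Euc n) = f u
    simpa using hf u u.2
  · intro u
    apply Subtype.ext
    show H _ (u : Euc n) = g u
    simpa using hg u u.2

lemma Htp.exists {f g : Euc n → Euc n} (h : Htp f g) : ∃ H : ℝ → Euc n → Euc n,
    ContinuousOn (fun p : ℝ × Euc n => H p.1 p.2) (Set.Icc 0 1 ×ˢ Metric.sphere 0 1) ∧
    (∀ t ∈ Set.Icc (0 : ℝ) 1, ∀ u ∈ Metric.sphere (0 : Euc n) 1, H t u ≠ 0) ∧
    (∀ u ∈ Metric.sphere (0 : Euc n) 1, H 0 u = f u) ∧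
    (∀ u ∈ Metric.sphere (0 : Euc n) 1, H 1 u = g u) := by
  obtain ⟨hf, hg, ⟨F⟩⟩ := h
  refine ⟨fun t u => if h : t ∈ Set.Icc (0 : ℝ) 1 ∧ u ∈ Metric.sphere (0 : Euc n) 1 then
    (F (⟨t, h.1⟩, ⟨u, h.2⟩)).1 else 0, ?_, ?_, ?_, ?_⟩
  · rw [continuousOn_iff_continuous_domRestrict]
    have : Continuous fun p : (Set.Icc (0 : ℝ) 1 ×ˢ Metric.sphere (0 : Euc n) 1 : Set (ℝ × Euc n)) =>
        (F (⟨p.1.1, p.2.1⟩, ⟨p.1.2, p.2.2⟩)).1 := by fun_prop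
    convert this using 1
    ext1 p
    have : p.1.1 ∈ Set.Icc (0 : ℝ) 1 ∧ p.1.2 ∈ Metric.sphere (0 : Euc n) 1 := p.2
    simp only [Set.domRestrict_apply]
    rw [dif_pos this]
  · intro t ht u hu
    beta_reduce
    rw [dif_pos (show _ ∧ _ from ⟨ht, hu⟩)]
    exact (F _).2
  · intro u hu
    beta_reduce
    rw [dif_pos (show _ ∧ _ from ⟨by simp, hu⟩)]
    exact congrArg Subtype.val (F.apply_zero ⟨u, hu⟩)
  · intro u hu
    beta_reduce
    rw [dif_pos (show _ ∧ _ from ⟨by simp, hu⟩)]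
    exact congrArg Subtype.val (F.apply_one ⟨u, hu⟩)

/-- The inclusion of the sphere is not homotopic to the restriction of a
non-orientation-preserving affine map. -/
lemma not_htp_affine (A : Euc n →L[ℝ] Euc n) (hA : A.det ≤ 0) (c : Euc n)
    (hnz : ∀ x ≠ 0, c + A x ≠ 0) : ¬ Htp (fun u => u) (fun u => c + A u) := by
  intro hH
  obtain ⟨H, hHc, hH0, hHf, hHg⟩ := hH.exists
  set h : Euc n → Euc n := fun x => if ‖x‖ ≤ 1 / 2 then c + (2 : ℝ) • A x else
    if ‖x‖ ≤ 1 then H (2 - 2 * ‖x‖) (‖x‖⁻¹ • x) else x with hh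
  have e1 : ∀ x, ‖x‖ ≤ 1 / 2 → h x = c + ((2 : ℝ) • A) x := fun x hx => by
    simp only [hh, if_pos hx, smul_apply]
  have hsph : ∀ x : Euc n, x ≠ 0 → ‖x‖⁻¹ • x ∈ Metric.sphere (0 : Euc n) 1 := by
    intro x hx
    rw [mem_sphere_zero_iff_norm, norm_smul, norm_inv, norm_norm, inv_mul_cancel₀ (norm_ne_zero_iff.2 hx)]
  have hne : ∀ x : Euc n, 1 / 2 ≤ ‖x‖ → x ≠ 0 := fun x hx => norm_pos_iff.1 (by linarith)
  have e2 : ∀ x, 1 / 2 ≤ ‖x‖ → ‖x‖ ≤ 1 → h x = H (2 - 2 * ‖x‖) (‖x‖⁻¹ • x) := by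
    intro x hx hx1
    rcases hx.eq_or_lt with he | hlt
    · rw [e1 x he.ge, ← he]
      have := hHg (‖x‖⁻¹ • x) (hsph x (hne x hx))
      rw [← he] at this
      norm_num at this ⊢
      rw [this]
    · simp [hh, not_le.2 (show (2 : ℝ)⁻¹ < ‖x‖ by linarith), hx1]
  have e3 : ∀ x, 1 ≤ ‖x‖ → h x = x := by
    intro x hx
    rcases hx.eq_or_lt with he | hlt
    · rw [e2 x (by linarith) he.ge, ← he]
      have := hHf (‖x‖⁻¹ • x) (hsph x (hne x (by linarith)))
      rw [← he] at this
      norm_num at this ⊢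
      exact this
    · simp [hh, not_le.2 (show (2 : ℝ)⁻¹ < ‖x‖ by linarith), not_le.2 hlt]
  have hcont : Continuous h := by
    rw [← continuousOn_univ]
    have hun : (Set.univ : Set (Euc n)) = ({x | ‖x‖ ≤ 1 / 2} ∪ {x | 1 / 2 ≤ ‖x‖ ∧ ‖x‖ ≤ 1}) ∪ {x | 1 ≤ ‖x‖} := by
      ext x
      simp only [Set.mem_univ, Set.mem_union, Set.mem_ofPred_eq, true_iff]
      rcases le_total ‖x‖ (1 / 2) with h1 | h1 <;> rcases le_total ‖x‖ 1 with h2 | h2 <;> tauto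
    rw [hun]
    have c1 : IsClosed {x : Euc n | ‖x‖ ≤ 1 / 2} := isClosed_le continuous_norm continuous_const
    have c2 : IsClosed {x : Euc n | 1 / 2 ≤ ‖x‖ ∧ ‖x‖ ≤ 1} :=
      (isClosed_le continuous_const continuous_norm).inter (isClosed_le continuous_norm continuous_const)
    have c3 : IsClosed {x : Euc n | 1 ≤ ‖x‖} := isClosed_le continuous_const continuous_norm
    refine ContinuousOn.union_of_isClosed (ContinuousOn.union_of_isClosed ?_ ?_ c1 c2) ?_ (c1.union c2) c3
    · exact ContinuousOn.congr (f := fun x => c + ((2 : ℝ) • A) x) (by fun_prop) e1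
    · refine ContinuousOn.congr (f := fun x => H (2 - 2 * ‖x‖) (‖x‖⁻¹ • x)) ?_ (fun x hx => e2 x hx.1 hx.2)
      refine hHc.comp (f := fun x : Euc n => (2 - 2 * ‖x‖, ‖x‖⁻¹ • x)) ?_ ?_
      · apply ContinuousOn.prodMk (by fun_prop)
        refine ContinuousOn.smul (f := fun x : Euc n => ‖x‖⁻¹) (g := fun x => x) ?_ continuousOn_id
        apply ContinuousOn.inv₀ continuous_norm.continuousOn
        intro x hx
        exact norm_ne_zero_iff.2 (hne x hx.1)
      · intro x hx
        have h1 := hx.1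
        have h2 := hx.2
        exact ⟨⟨by linarith, by linarith⟩, hsph x (hne x hx.1)⟩
    · exact continuousOn_id.congr e3
  have hdet : ((2 : ℝ) • A).det ≤ 0 := by
    have : ((2 : ℝ) • A).det = 2 ^ n * A.det := by
      simp [ContinuousLinearMap.det]
    rw [this]
    exact mul_nonpos_of_nonneg_of_nonpos (by positivity) hA
  obtain ⟨x, hx, hx0⟩ := exists_zero_of_affine_center h hcont e3 _ hdet c e1
  rcases le_total ‖x‖ (1 / 2) with h1 | h1
  · rw [e1 x h1] at hx0
    refine hnz ((2 : ℝ) • x) ?_ (by simpa using hx0)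
    have : x ≠ 0 := norm_pos_iff.1 (by linarith)
    simpa using this
  · rcases le_total ‖x‖ 1 with h2 | h2
    · rw [e2 x h1 h2] at hx0
      exact hH0 _ ⟨by linarith, by linarith⟩ _ (hsph x (hne x h1)) hx0
    · rw [e3 x h2] at hx0
      exact hne x h1 hx0

lemma not_htp_const [NeZero n] (c : Euc n) (hc : c ≠ 0) : ¬ Htp (fun u => u) (fun _ : Euc n => c) := by
  have := not_htp_affine (0 : Euc n →L[ℝ] Euc n) (by simp [ContinuousLinearMap.det]) c (by simp [hc])
  simpa using this

/-- The reflection negating a coordinate. -/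
def reflc (i : Fin n) : Euc n →L[ℝ] Euc n :=
  ContinuousLinearMap.id ℝ _ - (2 : ℝ) • (EuclideanSpace.proj i).smulRight (EuclideanSpace.single i 1)

lemma reflc_apply (i : Fin n) (x : Euc n) : reflc i x = x - (2 * x i) • EuclideanSpace.single i 1 := by
  simp [reflc, mul_smul]

@[simp] lemma reflc_apply_self (i : Fin n) (x : Euc n) : reflc i x i = - x i := by
  simp [reflc_apply]; ring

@[simp] lemma reflc_reflc (i : Fin n) (x : Euc n) : reflc i (reflc i x) = x := by
  rw [reflc_apply i (reflc i x), reflc_apply_self, reflc_apply]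
  module

lemma det_reflc (i : Fin n) : (reflc i).det = -1 := by
  rw [ContinuousLinearMap.det, ← LinearMap.det_toMatrix (EuclideanSpace.basisFun (Fin n) ℝ).toBasis]
  have : LinearMap.toMatrix (EuclideanSpace.basisFun (Fin n) ℝ).toBasis (EuclideanSpace.basisFun (Fin n) ℝ).toBasis
      (reflc i : Euc n →ₗ[ℝ] Euc n) = Matrix.diagonal (fun j => if j = i then -1 else 1) := by
    ext a b
    rw [LinearMap.toMatrix_apply]
    simp [reflc_apply, Matrix.diagonal_apply]
    split_ifs <;> simp_all <;> norm_num
  rw [this, Matrix.det_diagonal]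
  simp

lemma not_htp_reflc (i : Fin n) : ¬ Htp (fun u : Euc n => u) (fun u => reflc i u) := by
  have := not_htp_affine (reflc i) (by rw [det_reflc]; norm_num) 0 (by
    intro x hx h
    apply hx
    rw [zero_add] at h
    rw [← reflc_reflc i x, h, map_zero])
  simpa using this

end

section

variable {n : ℕ}

/-- A continuous map on the unit ball moving boundary points by at most one has a zero. -/
lemma exists_zero_of_norm_sub_le [NeZero n] (h : Euc n → Euc n)
    (hh : ContinuousOn h (Metric.closedBall 0 1))
    (hb : ∀ u ∈ Metric.sphere (0 : Euc n) 1, ‖h u - u‖ ≤ 1) :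
    ∃ x ∈ Metric.closedBall (0 : Euc n) 1, h x = 0 := by
  by_contra hcon
  push Not at hcon
  have hs : ∀ u ∈ Metric.sphere (0 : Euc n) 1, u ∈ Metric.closedBall (0 : Euc n) 1 :=
    fun u hu => Metric.sphere_subset_closedBall hu
  have h1 : Htp (fun u => u) h := by
    refine Htp.of (fun t u => u + t • (h u - u)) ?_ ?_ (by simp) (by simp)
    · have : ContinuousOn (fun p : ℝ × Euc n => h p.2) (Set.Icc 0 1 ×ˢ Metric.sphere 0 1) :=
        hh.comp continuousOn_snd (fun p hp => hs _ hp.2)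
      exact continuousOn_snd.add (continuousOn_fst.smul (this.sub continuousOn_snd))
    · intro t ht u hu h0
      rcases ht.2.eq_or_lt with he | hlt
      · apply hcon u (hs u hu)
        simpa [he] using h0
      · have hu1 : ‖u‖ = 1 := mem_sphere_zero_iff_norm.1 hu
        have h2 : ‖u‖ = ‖t • (h u - u)‖ := by
          rw [← norm_neg u]
          congr 1
          exact neg_eq_of_add_eq_zero_right h0
        rw [norm_smul, Real.norm_of_nonneg ht.1, hu1] at h2
        nlinarith [hb u hu, ht.1]
  have h2 : Htp (fun _ : Euc n => h 0) h := by
    refine Htp.of (fun t u => h (t • u)) ?_ ?_ (by simp) (by simp)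
    · refine hh.comp (by fun_prop) ?_
      rintro ⟨t, u⟩ ⟨ht, hu⟩
      rw [mem_closedBall_zero_iff, norm_smul, Real.norm_of_nonneg ht.1, mem_sphere_zero_iff_norm.1 hu]
      simpa using ht.2
    · intro t ht u hu
      apply hcon
      rw [mem_closedBall_zero_iff, norm_smul, Real.norm_of_nonneg ht.1, mem_sphere_zero_iff_norm.1 hu]
      simpa using ht.2
  exact not_htp_const (h 0) (hcon 0 (by simp)) (h1.trans h2.symm)

lemma exists_contDiff_approx_ne_zero [NeZero n] (G : Euc n → Euc n) (hG : Continuous G)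
    (S₁ S₂ : Set (Euc n)) (hS₁ : IsCompact S₁) (hS₂ : MeasureTheory.volume S₂ = 0)
    (h0 : ∀ y ∈ S₁, G y ≠ 0) (η : ℝ) (hη : 0 < η) :
    ∃ P : Euc n → Euc n, Continuous P ∧ (∀ y, ‖P y - G y‖ ≤ η) ∧ ∀ y ∈ S₁ ∪ S₂, P y ≠ 0 := by
  obtain ⟨δ, hδ, hδ'⟩ : ∃ δ > (0 : ℝ), ∀ y ∈ S₁, δ ≤ ‖G y‖ := by
    rcases S₁.eq_empty_or_nonempty with he | hne
    · exact ⟨1, one_pos, by simp [he]⟩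
    · obtain ⟨x₀, hx₀, hmin⟩ := hS₁.exists_isMinOn hne hG.norm.continuousOn
      exact ⟨‖G x₀‖, norm_pos_iff.2 (h0 x₀ hx₀), fun x hx => hmin hx⟩
  set κ := min δ η / 3 with hκ
  have hm : 0 < min δ η := lt_min hδ hη
  have hκ0 : 0 < κ := by positivity
  obtain ⟨P, hP, hPG, -⟩ := hG.exists_contDiff_approx 1 (continuous_const (y := κ)) (fun _ => hκ0)
  have hnull : MeasureTheory.volume (P '' S₂) = 0 :=
    MeasureTheory.addHaar_image_eq_zero_of_differentiableOn_of_addHaar_eq_zero _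
      (fun x _ => (hP.differentiable (by norm_num) x).differentiableWithinAt) hS₂
  obtain ⟨w, hw, hwS⟩ : ∃ w ∈ Metric.ball (0 : Euc n) κ, w ∉ P '' S₂ := by
    by_contra hcon
    push Not at hcon
    have h1 : MeasureTheory.volume (Metric.ball (0 : Euc n) κ) ≤ 0 :=
      hnull ▸ MeasureTheory.measure_mono hcon
    exact (Metric.measure_ball_pos MeasureTheory.volume (0 : Euc n) hκ0).not_ge h1
  have hw' : ‖w‖ < κ := mem_ball_zero_iff.1 hw
  have hd : ∀ y, ‖P y - w - G y‖ < 2 * κ := by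
    intro y
    have h1 := hPG y
    rw [dist_eq_norm] at h1
    calc ‖P y - w - G y‖ = ‖(P y - G y) - w‖ := by congr 1; abel
      _ ≤ ‖P y - G y‖ + ‖w‖ := norm_sub_le _ _
      _ < 2 * κ := by linarith
  have hκδ : 3 * κ ≤ δ := by
    have := min_le_left δ η
    linarith
  have hκη : 3 * κ ≤ η := by
    have := min_le_right δ η
    linarith
  refine ⟨fun y => P y - w, by have := hP.continuous; fun_prop, fun y => (hd y).le.trans (by linarith), ?_⟩
  rintro y (hy | hy) hy0
  · have h1 := hd y
    have h2 := hδ' y hy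
    beta_reduce at hy0
    rw [hy0, zero_sub, norm_neg] at h1
    linarith
  · exact hwS ⟨y, hy, sub_eq_zero.1 hy0⟩

lemma image_closedBall_mem_nhds_aux [NeZero n] (f : Euc n → Euc n)
    (hf : ContinuousOn f (Metric.closedBall 0 1)) (hinj : Set.InjOn f (Metric.closedBall 0 1)) :
    f '' Metric.closedBall 0 1 ∈ nhds (f 0) := by
  set B := Metric.closedBall (0 : Euc n) 1 with hB
  have hBc : IsCompact B := isCompact_closedBall _ _
  have h0B : (0 : Euc n) ∈ B := by simp [hB]
  have hKc : IsCompact (f '' B) := hBc.image_of_continuousOn hf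
  -- the inverse map, extended continuously to the whole space
  obtain ⟨G, hG, hGf⟩ : ∃ G : Euc n → Euc n, Continuous G ∧ ∀ x ∈ B, G (f x) = x := by
    have : CompactSpace B := isCompact_iff_compactSpace.1 hBc
    let e : B ≃ f '' B := Equiv.Set.imageOfInjOn f B hinj
    have he : Continuous e := (continuousOn_iff_continuous_domRestrict.1 hf).subtype_mk _
    let e' : B ≃ₜ f '' B := he.homeoOfEquivCompactToT2
    let g : C(f '' B, Euc n) := ⟨fun y => (e'.symm y : Euc n), by fun_prop⟩
    obtain ⟨G, hG⟩ := ContinuousMap.exists_restrict_eq hKc.isClosed g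
    refine ⟨G, G.continuous, fun x hx => ?_⟩
    have := congrArg (fun k : C(f '' B, Euc n) => k ⟨f x, ⟨x, hx, rfl⟩⟩) hG
    have h2 : e'.symm ⟨f x, ⟨x, hx, rfl⟩⟩ = ⟨x, hx⟩ := by
      rw [Homeomorph.symm_apply_eq]
      rfl
    have h3 : G (f x) = (e'.symm ⟨f x, ⟨x, hx, rfl⟩⟩ : Euc n) := this
    rw [h3, h2]
  by_contra hnot
  obtain ⟨r, hr, hrG⟩ : ∃ r > 0, ∀ y ∈ Metric.ball (f 0) r, ‖G y‖ < 1 / 4 := by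
    have h1 := hG.norm.continuousAt (x := f 0)
    have h2 : ‖G (f 0)‖ < 1 / 4 := by rw [hGf 0 h0B]; simp
    obtain ⟨r, hr, h3⟩ := Metric.eventually_nhds_iff_ball.1 (h1.eventually (gt_mem_nhds h2))
    exact ⟨r, hr, h3⟩
  obtain ⟨c, hc, hcB⟩ : ∃ c ∈ Metric.ball (f 0) (r / 2), c ∉ f '' B := by
    by_contra hcon
    push Not at hcon
    exact hnot (Filter.mem_of_superset (Metric.ball_mem_nhds _ (by linarith)) hcon)
  set ρ := r / 2 with hρ
  have hρ0 : 0 < ρ := by linarith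
  have hcG : ∀ y, ‖y - c‖ ≤ ρ → ‖G y‖ < 1 / 4 := by
    intro y hy
    apply hrG
    rw [Metric.mem_ball] at hc ⊢
    calc dist y (f 0) ≤ dist y c + dist c (f 0) := dist_triangle _ _ _
      _ < ρ + ρ := by rw [dist_eq_norm y c]; linarith
      _ = r := by ring
  obtain ⟨P, hP, hPG, hP0⟩ := exists_contDiff_approx_ne_zero G hG (f '' B ∩ {y | ρ ≤ ‖y - c‖})
    (Metric.sphere c ρ) (hKc.inter_right (isClosed_le continuous_const (by fun_prop)))
    (MeasureTheory.Measure.addHaar_sphere_of_ne_zero _ _ hρ0.ne') (by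
      rintro _ ⟨⟨x, hx, rfl⟩, hxc⟩ h0
      rw [hGf x hx] at h0
      subst h0
      rw [Set.mem_ofPred_eq, norm_sub_rev, ← dist_eq_norm] at hxc
      exact absurd (Metric.mem_ball.1 hc) (not_lt.2 hxc)) (1 / 4) (by norm_num)
  -- push the image radially off the ball around `c`
  set Q : Euc n → Euc n := fun y => c + max (ρ / ‖y - c‖) 1 • (y - c) with hQ
  have hQ1 : ∀ y, ρ ≤ ‖y - c‖ → Q y = y := by
    intro y hy
    have : ρ / ‖y - c‖ ≤ 1 := by
      rw [div_le_one (hρ0.trans_le hy)]; exact hy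
    simp [hQ, max_eq_right this]
  have hQ2 : ∀ y, y ≠ c → ‖y - c‖ ≤ ρ → ‖Q y - c‖ = ρ := by
    intro y hyc hy
    have h1 : 0 < ‖y - c‖ := norm_pos_iff.2 (sub_ne_zero.2 hyc)
    have : 1 ≤ ρ / ‖y - c‖ := by rwa [le_div_iff₀ h1, one_mul]
    simp only [hQ, max_eq_left this, add_sub_cancel_left, norm_smul, norm_div, norm_norm]
    rw [Real.norm_of_nonneg hρ0.le]
    field_simp
  have hne : ∀ x ∈ B, f x ≠ c := fun x hx h => hcB ⟨x, hx, h⟩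
  obtain ⟨x, hx, hx0⟩ := exists_zero_of_norm_sub_le (fun x => P (Q (f x))) (by
      refine hP.comp_continuousOn ?_
      have : ContinuousOn (fun x => ρ / ‖f x - c‖) B :=
        continuousOn_const.div (by fun_prop) fun x hx => norm_ne_zero_iff.2 (sub_ne_zero.2 (hne x hx))
      simp only [hQ]
      fun_prop) (by
      intro u hu
      have huB : u ∈ B := Metric.sphere_subset_closedBall hu
      rcases le_total ρ ‖f u - c‖ with h1 | h1
      · beta_reduce
        rw [hQ1 _ h1]
        have := hPG (f u)
        rw [hGf u huB] at this
        linarith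
      · have h2 := hcG _ h1
        have h3 := hQ2 _ (hne u huB) h1
        have h4 := hcG _ h3.le
        rw [hGf u huB, mem_sphere_zero_iff_norm.1 hu] at h2
        norm_num at h2)
  rcases le_total ρ ‖f x - c‖ with h1 | h1
  · beta_reduce at hx0
    rw [hQ1 _ h1] at hx0
    exact hP0 _ (Or.inl ⟨⟨x, hx, rfl⟩, h1⟩) hx0
  · exact hP0 _ (Or.inr (by rw [mem_sphere_iff_norm]; exact hQ2 _ (hne x hx) h1)) hx0

/-- Invariance of domain. -/
theorem image_closedBall_mem_nhds (f : Euc n → Euc n) (x : Euc n) (r : ℝ) (hr : 0 < r)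
    (hf : ContinuousOn f (Metric.closedBall x r)) (hinj : Set.InjOn f (Metric.closedBall x r)) :
    f '' Metric.closedBall x r ∈ nhds (f x) := by
  rcases Nat.eq_zero_or_pos n with h0 | hpos
  · subst h0
    have : f '' Metric.closedBall x r = Set.univ := by
      apply Set.eq_univ_of_forall
      intro y
      exact ⟨x, by simp [hr.le], Subsingleton.elim _ _⟩
    rw [this]
    exact Filter.univ_mem
  · have : NeZero n := ⟨hpos.ne'⟩
    have hm : ∀ u ∈ Metric.closedBall (0 : Euc n) 1, x + r • u ∈ Metric.closedBall x r := by
      intro u hu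
      rw [mem_closedBall_iff_norm, add_sub_cancel_left, norm_smul, Real.norm_of_nonneg hr.le]
      have := mem_closedBall_zero_iff.1 hu
      nlinarith
    have := image_closedBall_mem_nhds_aux (fun u => f (x + r • u)) (hf.comp (by fun_prop) hm) (by
      intro u hu v hv huv
      have := hinj (hm u hu) (hm v hv) huv
      exact smul_right_injective _ hr.ne' (add_left_cancel this))
    simp only [smul_zero, add_zero] at this
    refine Filter.mem_of_superset this ?_
    rintro _ ⟨u, hu, rfl⟩
    exact ⟨_, hm u hu, rfl⟩

/-- Invariance of domain: an injective continuous map on an open set is open. -/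
theorem image_mem_nhds_of_injOn (f : Euc n → Euc n) (U : Set (Euc n)) (x : Euc n) (hU : U ∈ nhds x)
    (hf : ContinuousOn f U) (hinj : Set.InjOn f U) : f '' U ∈ nhds (f x) := by
  obtain ⟨r, hr, hrU⟩ := Metric.nhds_basis_closedBall.mem_iff.1 hU
  exact Filter.mem_of_superset (image_closedBall_mem_nhds f x r hr (hf.mono hrU) (hinj.mono hrU))
    (Set.image_mono hrU)

end

section

variable {n : ℕ}

/-- A continuous map of a ball which is the identity near `y`, takes the value `y` only at `y` and
maps the boundary sphere far away is surjective near the centre. -/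
lemma false_of_fold [NeZero n] (R : Euc n → Euc n) (c y q : Euc n) (ρ η : ℝ) (hρ : 0 < ρ)
    (hR : ContinuousOn R (Metric.closedBall c ρ))
    (hη : ∀ z ∈ Metric.sphere c ρ, η ≤ ‖R z - c‖)
    (hyρ : ‖y - c‖ < ρ) (hy : ‖y - c‖ < η) (hq : ‖q - c‖ < η)
    (hid : ∀ᶠ z in nhds y, R z = z) (hyu : ∀ z ∈ Metric.closedBall c ρ, R z = y → z = y)
    (hqi : ∀ z ∈ Metric.closedBall c ρ, R z ≠ q) : False := by
  obtain ⟨lam, hlam, hlamR⟩ := Metric.nhds_basis_closedBall.mem_iff.1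
    (Filter.inter_mem hid (Metric.isOpen_ball.mem_nhds (mem_ball_iff_norm.2 hyρ)))
  have hu1 : ∀ u ∈ Metric.sphere (0 : Euc n) 1, ‖u‖ = 1 := fun u hu => mem_sphere_zero_iff_norm.1 hu
  have hylam : ∀ u ∈ Metric.sphere (0 : Euc n) 1, y + lam • u ∈ Metric.closedBall y lam := by
    intro u hu
    rw [mem_closedBall_iff_norm, add_sub_cancel_left, norm_smul, hu1 u hu, Real.norm_of_nonneg hlam.le, mul_one]
  have hcs : ∀ t ∈ Set.Icc (0 : ℝ) 1, ∀ u ∈ Metric.sphere (0 : Euc n) 1, c + (t * ρ) • u ∈ Metric.closedBall c ρ := by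
    intro t ht u hu
    rw [mem_closedBall_iff_norm, add_sub_cancel_left, norm_smul, hu1 u hu, mul_one,
      Real.norm_of_nonneg (mul_nonneg ht.1 hρ.le)]
    nlinarith [ht.2]
  have hcsph : ∀ u ∈ Metric.sphere (0 : Euc n) 1, c + ρ • u ∈ Metric.sphere c ρ := by
    intro u hu
    rw [mem_sphere_iff_norm, add_sub_cancel_left, norm_smul, hu1 u hu, mul_one,
      Real.norm_of_nonneg hρ.le]
  have h1 : Htp (fun u => u) (fun u => R (y + lam • u) - y) := by
    refine Htp.of (fun t u => ((1 - t) + t * lam) • u) (by fun_prop) ?_ (by simp) ?_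
    · intro t ht u hu
      have : 0 < (1 - t) + t * lam := by
        rcases ht.2.eq_or_lt with h | h
        · rw [h]; linarith
        · nlinarith [ht.1]
      exact smul_ne_zero this.ne' (norm_pos_iff.1 (by rw [hu1 u hu]; exact one_pos))
    · intro u hu
      have h2 : R (y + lam • u) = y + lam • u := (hlamR (hylam u hu)).1
      rw [h2]
      simp
  have h2 : Htp (fun u => R (y + lam • u) - y) (fun u => R (c + ρ • u) - y) := by
    have hin : ∀ t ∈ Set.Icc (0 : ℝ) 1, ∀ u ∈ Metric.sphere (0 : Euc n) 1,
        (1 - t) • (y + lam • u) + t • (c + ρ • u) ∈ Metric.closedBall c ρ := by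
      intro t ht u hu
      refine convex_closedBall c ρ ?_ (Metric.sphere_subset_closedBall (hcsph u hu))
        (by linarith [ht.2]) ht.1 (by ring)
      exact Metric.ball_subset_closedBall (hlamR (hylam u hu)).2
    refine Htp.of (fun t u => R ((1 - t) • (y + lam • u) + t • (c + ρ • u)) - y) ?_ ?_ (by simp) (by simp)
    · refine ContinuousOn.sub (hR.comp (by fun_prop) ?_) continuousOn_const
      rintro ⟨t, u⟩ ⟨ht, hu⟩
      exact hin t ht u hu
    · intro t ht u hu h0
      have h3 := hyu _ (hin t ht u hu) (sub_eq_zero.1 h0)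
      have h4 : ((1 - t) * lam + t * ρ) • u = t • (y - c) := by
        have : ((1 - t) * lam + t * ρ) • u - t • (y - c) =
          (1 - t) • (y + lam • u) + t • (c + ρ • u) - y := by module
        rw [h3, sub_self] at this
        exact sub_eq_zero.1 this
      have h5 := congrArg norm h4
      have hnn : 0 ≤ (1 - t) * lam + t * ρ :=
        add_nonneg (mul_nonneg (by linarith [ht.2]) hlam.le) (mul_nonneg ht.1 hρ.le)
      rw [norm_smul, norm_smul, hu1 u hu, mul_one, Real.norm_of_nonneg hnn, Real.norm_of_nonneg ht.1] at h5
      rcases ht.1.eq_or_lt with h | h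
      · rw [← h] at h5; simp at h5; linarith
      · nlinarith [ht.2]
  have h3 : Htp (fun u => R (c + ρ • u) - q) (fun u => R (c + ρ • u) - y) := by
    refine Htp.of (fun t u => R (c + ρ • u) - ((1 - t) • q + t • y)) ?_ ?_ (by simp) (by simp)
    · refine ContinuousOn.sub (hR.comp (by fun_prop) ?_) (by fun_prop)
      rintro ⟨t, u⟩ ⟨ht, hu⟩
      exact Metric.sphere_subset_closedBall (hcsph u hu)
    · intro t ht u hu h0
      have h4 := hη _ (hcsph u hu)
      rw [sub_eq_zero.1 h0] at h4
      have h5 : (1 - t) • q + t • y ∈ Metric.ball c η :=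
        convex_ball c η (mem_ball_iff_norm.2 hq) (mem_ball_iff_norm.2 hy) (by linarith [ht.2]) ht.1 (by ring)
      rw [mem_ball_iff_norm] at h5
      linarith
  have h4 : Htp (fun _ => R c - q) (fun u => R (c + ρ • u) - q) := by
    refine Htp.of (fun t u => R (c + (t * ρ) • u) - q) ?_ ?_ (by simp) (by simp)
    · refine ContinuousOn.sub (hR.comp (by fun_prop) ?_) (by fun_prop)
      rintro ⟨t, u⟩ ⟨ht, hu⟩
      exact hcs t ht u hu
    · intro t ht u hu h0
      exact hqi _ (hcs t ht u hu) (sub_eq_zero.1 h0)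
  exact not_htp_const (R c - q) (sub_ne_zero.2 (hqi c (by simp [hρ.le])))
    (((h1.trans h2).trans h3.symm).trans h4.symm)

end

section

variable {n : ℕ}

/-- The small sphere around `x` with respect to `F`. -/
def sph (F : Euc n → Euc n) (x : Euc n) (ρ : ℝ) : Euc n → Euc n := fun u => F (x + ρ • u) - F x

lemma Htp.sph_comp {m m' : Euc n → Euc n} (h : Htp m m') (F : Euc n → Euc n) (x : Euc n) (r : ℝ)
    (hr : 0 < r) (hF : ContinuousOn F (Metric.closedBall x r))
    (hne : ∀ y ∈ Metric.closedBall x r, F y = F x → y = x) :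
    ∃ ρ₀ > 0, ∀ ρ, 0 < ρ → ρ ≤ ρ₀ → Htp (fun u => sph F x ρ (m u)) (fun u => sph F x ρ (m' u)) := by
  obtain ⟨H, hc, h0, hm, hm'⟩ := h.exists
  have hK : IsCompact (Set.Icc (0 : ℝ) 1 ×ˢ Metric.sphere (0 : Euc n) 1) :=
    isCompact_Icc.prod (isCompact_sphere _ _)
  obtain ⟨N, hN⟩ := (hK.image_of_continuousOn hc).isBounded.exists_norm_le
  have hN' : ∀ t ∈ Set.Icc (0 : ℝ) 1, ∀ u ∈ Metric.sphere (0 : Euc n) 1, ‖H t u‖ ≤ |N| + 1 :=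
    fun t ht u hu => ((hN _ ⟨(t, u), ⟨ht, hu⟩, rfl⟩).trans (le_abs_self N)).trans (by linarith)
  have hN0 : 0 < |N| + 1 := by positivity
  refine ⟨r / (|N| + 1), by positivity, fun ρ hρ hρ0 => ?_⟩
  rw [le_div_iff₀ hN0] at hρ0
  have hin : ∀ t ∈ Set.Icc (0 : ℝ) 1, ∀ u ∈ Metric.sphere (0 : Euc n) 1,
      x + ρ • H t u ∈ Metric.closedBall x r := by
    intro t ht u hu
    rw [mem_closedBall_iff_norm, add_sub_cancel_left, norm_smul, Real.norm_of_nonneg hρ.le]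
    exact (mul_le_mul_of_nonneg_left (hN' t ht u hu) hρ.le).trans hρ0
  refine Htp.of (fun t u => F (x + ρ • H t u) - F x) ?_ ?_ (fun u hu => by simp [hm u hu, sph])
    (fun u hu => by simp [hm' u hu, sph])
  · refine ContinuousOn.sub (hF.comp (continuousOn_const.add (hc.const_smul ρ)) ?_) continuousOn_const
    rintro ⟨t, u⟩ ⟨ht, hu⟩
    exact hin t ht u hu
  · intro t ht u hu hz
    have h1 := hne _ (hin t ht u hu) (sub_eq_zero.1 hz)
    have h2 : ρ • H t u = 0 := by simpa using h1
    exact h0 t ht u hu ((smul_eq_zero.1 h2).resolve_left hρ.ne')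

lemma Htp.comp_right {f g : Euc n → Euc n} (h : Htp f g) (m : Euc n → Euc n)
    (hm : ContinuousOn m (Metric.sphere 0 1))
    (hm1 : ∀ u ∈ Metric.sphere (0 : Euc n) 1, m u ∈ Metric.sphere (0 : Euc n) 1) :
    Htp (fun u => f (m u)) (fun u => g (m u)) := by
  obtain ⟨H, hc, h0, hf, hg⟩ := h.exists
  refine Htp.of (fun t u => H t (m u)) ?_ (fun t ht u hu => h0 t ht _ (hm1 u hu))
    (fun u hu => hf _ (hm1 u hu)) (fun u hu => hg _ (hm1 u hu))
  exact hc.comp (f := fun p : ℝ × Euc n => (p.1, m p.2))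
    (continuousOn_fst.prodMk (hm.comp continuousOn_snd fun p hp => hp.2)) (fun p hp => ⟨hp.1, hm1 _ hp.2⟩)

lemma norm_reflc (i : Fin n) (x : Euc n) : ‖reflc i x‖ = ‖x‖ := by
  rw [← sq_eq_sq₀ (norm_nonneg _) (norm_nonneg _), EuclideanSpace.norm_sq_eq, EuclideanSpace.norm_sq_eq]
  apply Finset.sum_congr rfl
  intro j _
  by_cases h : j = i
  · subst h; simp
  · simp [reflc_apply, h]

lemma reflc_mem_sphere (i : Fin n) {u : Euc n} (hu : u ∈ Metric.sphere (0 : Euc n) 1) :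
    reflc i u ∈ Metric.sphere (0 : Euc n) 1 := by
  rw [mem_sphere_zero_iff_norm] at *
  rw [norm_reflc, hu]

/-- The existence of an orientation character on homotopy classes. -/
lemma exists_orientation_character (i : Fin n) : ∃ s : (Euc n → Euc n) → ℤ,
    (∀ f, s f = 1 ∨ s f = -1) ∧ (∀ f g, Htp f g → s f = s g) ∧
    ∀ f, NZ f → ¬ Htp f (fun u => f (reflc i u)) → s (fun u => f (reflc i u)) = - s f := by
  let r : Setoid (Euc n → Euc n) :=
    { r := fun f g => f = g ∨ Htp f g
      iseqv := ⟨fun f => Or.inl rfl, fun {f g} h => h.imp Eq.symm Htp.symm, by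
        rintro f g k (rfl | h) (rfl | h')
        · exact Or.inl rfl
        · exact Or.inr h'
        · exact Or.inr h
        · exact Or.inr (h.trans h')⟩ }
  let τ : Quotient r → Quotient r := Quotient.map (fun f u => f (reflc i u)) (by
    rintro f g (rfl | h)
    · exact Or.inl rfl
    · exact Or.inr (h.comp_right _ (reflc i).continuous.continuousOn fun u hu => reflc_mem_sphere i hu))
  have hτ : ∀ q, τ (τ q) = q := by
    intro q
    induction q using Quotient.inductionOn with
    | _ f =>
      show Quotient.mk r _ = _
      simp
  let _ : LinearOrder (Quotient r) := linearOrderOfSTO WellOrderingRel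
  refine ⟨fun f => if Quotient.mk r f ≤ τ (Quotient.mk r f) then 1 else -1, ?_, ?_, ?_⟩
  · intro f
    beta_reduce
    split_ifs <;> simp
  · intro f g h
    have : Quotient.mk r f = Quotient.mk r g := Quotient.sound (Or.inr h)
    simp only [this]
  · intro f hf hnot
    have h1 : Quotient.mk r (fun u => f (reflc i u)) = τ (Quotient.mk r f) := rfl
    have h2 : τ (Quotient.mk r f) ≠ Quotient.mk r f := by
      intro h
      rcases Quotient.exact h with h3 | h3
      · apply hnot
        have h4 : (fun u => f (reflc i u)) = f := h3
        rw [h4]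
        exact Htp.refl hf
      · exact hnot h3.symm
    simp only [h1, hτ]
    rcases lt_or_gt_of_ne h2 with h | h
    · rw [if_pos h.le, if_neg (not_le.2 h)]; rfl
    · rw [if_neg (not_le.2 h), if_pos h.le]

/-- A continuous injective map on a compact set has a continuous left inverse. -/
lemma exists_continuous_leftInverse {B : Set (Euc n)} (hBc : IsCompact B) {f : Euc n → Euc n}
    (hf : ContinuousOn f B) (hinj : Set.InjOn f B) :
    ∃ G : Euc n → Euc n, Continuous G ∧ ∀ x ∈ B, G (f x) = x := by
  have hKc : IsCompact (f '' B) := hBc.image_of_continuousOn hf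
  have : CompactSpace B := isCompact_iff_compactSpace.1 hBc
  let e : B ≃ f '' B := Equiv.Set.imageOfInjOn f B hinj
  have he : Continuous e := (continuousOn_iff_continuous_domRestrict.1 hf).subtype_mk _
  let e' : B ≃ₜ f '' B := he.homeoOfEquivCompactToT2
  let g : C(f '' B, Euc n) := ⟨fun y => (e'.symm y : Euc n), by fun_prop⟩
  obtain ⟨G, hG⟩ := ContinuousMap.exists_restrict_eq hKc.isClosed g
  refine ⟨G, G.continuous, fun x hx => ?_⟩
  have := congrArg (fun k : C(f '' B, Euc n) => k ⟨f x, ⟨x, hx, rfl⟩⟩) hG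
  have h2 : e'.symm ⟨f x, ⟨x, hx, rfl⟩⟩ = ⟨x, hx⟩ := by
    rw [Homeomorph.symm_apply_eq]
    rfl
  have h3 : G (f x) = (e'.symm ⟨f x, ⟨x, hx, rfl⟩⟩ : Euc n) := this
  rw [h3, h2]

lemma htp_smul (m : Euc n → Euc n) (hm : NZ m) (ρ : ℝ) (hρ : 0 < ρ) : Htp m (fun u => ρ • m u) := by
  refine Htp.of (fun t u => ((1 - t) + t * ρ) • m u) ?_ ?_ (by simp) (by simp)
  · have : ContinuousOn (fun p : ℝ × Euc n => m p.2) (Set.Icc 0 1 ×ˢ Metric.sphere 0 1) :=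
      hm.1.comp continuousOn_snd fun p hp => hp.2
    exact ContinuousOn.smul (f := fun p : ℝ × Euc n => (1 - p.1) + p.1 * ρ) (by fun_prop) this
  · intro t ht u hu
    have : 0 < (1 - t) + t * ρ := by
      rcases ht.2.eq_or_lt with h | h
      · rw [h]; linarith
      · nlinarith [ht.1]
    exact smul_ne_zero this.ne' (hm.2 u hu)

lemma nz_id : NZ (fun u : Euc n => u) :=
  ⟨continuousOn_id, fun u hu h => by
    subst h
    simp at hu⟩

variable {F : Euc n → Euc n} {x : Euc n} {r : ℝ}

lemma add_smul_mem_closedBall {ρ : ℝ} (hρ : 0 < ρ) (hρr : ρ ≤ r) {u : Euc n}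
    (hu : u ∈ Metric.sphere (0 : Euc n) 1) : x + ρ • u ∈ Metric.closedBall x r := by
  rw [mem_closedBall_iff_norm, add_sub_cancel_left, norm_smul, Real.norm_of_nonneg hρ.le,
    mem_sphere_zero_iff_norm.1 hu]
  linarith

lemma htp_sph_sph (hF : ContinuousOn F (Metric.closedBall x r)) (hinj : Set.InjOn F (Metric.closedBall x r))
    {ρ ρ' : ℝ} (hρ : 0 < ρ) (hρr : ρ ≤ r) (hρ' : 0 < ρ') (hρr' : ρ' ≤ r) :
    Htp (sph F x ρ) (sph F x ρ') := by
  have hin : ∀ t ∈ Set.Icc (0 : ℝ) 1, 0 < (1 - t) * ρ + t * ρ' ∧ (1 - t) * ρ + t * ρ' ≤ r := by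
    intro t ht
    constructor
    · rcases ht.2.eq_or_lt with h | h
      · rw [h]; linarith
      · nlinarith [ht.1]
    · nlinarith [ht.1, ht.2]
  refine Htp.of (fun t u => F (x + ((1 - t) * ρ + t * ρ') • u) - F x) ?_ ?_ (by simp [sph]) (by simp [sph])
  · refine ContinuousOn.sub (hF.comp (by fun_prop) ?_) continuousOn_const
    rintro ⟨t, u⟩ ⟨ht, hu⟩
    exact add_smul_mem_closedBall (hin t ht).1 (hin t ht).2 hu
  · intro t ht u hu hz
    have h1 := hinj (add_smul_mem_closedBall (hin t ht).1 (hin t ht).2 hu)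
      (by simp; linarith) (sub_eq_zero.1 hz)
    have h2 : ((1 - t) * ρ + t * ρ') • u = 0 := by simpa using h1
    rcases smul_eq_zero.1 h2 with h3 | h3
    · exact (hin t ht).1.ne' h3
    · subst h3; simp at hu

/-- The small spheres of an injective continuous map are not homotopic to their reflections. -/
lemma not_htp_sph_reflc (i : Fin n) (hr : 0 < r) (hF : ContinuousOn F (Metric.closedBall x r))
    (hinj : Set.InjOn F (Metric.closedBall x r)) {ρ : ℝ} (hρ : 0 < ρ) (hρr : ρ ≤ r) :
    ¬ Htp (sph F x ρ) (fun u => sph F x ρ (reflc i u)) := by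
  obtain ⟨G, hG, hGF⟩ := exists_continuous_leftInverse (isCompact_closedBall x r) hF hinj
  have hxB : x ∈ Metric.closedBall x r := by simp [hr.le]
  obtain ⟨η, hη, hηF⟩ := Metric.nhds_basis_closedBall.mem_iff.1 (image_closedBall_mem_nhds F x r hr hF hinj)
  have hGne : ∀ y ∈ Metric.closedBall (F x) η, G y = G (F x) → y = F x := by
    intro y hy h
    obtain ⟨z, hz, rfl⟩ := hηF hy
    rw [hGF z hz, hGF x hxB] at h
    rw [h]
  have hcx : ContinuousAt F x := hF.continuousAt (Metric.closedBall_mem_nhds x hr)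
  obtain ⟨κ, hκ, hκF⟩ := Metric.nhds_basis_closedBall.mem_iff.1
    (hcx (Metric.closedBall_mem_nhds (F x) hη))
  set ρ' := min κ r with hρ'
  have hρ'0 : 0 < ρ' := lt_min hκ hr
  have hρ'r : ρ' ≤ r := min_le_right _ _
  intro hH
  have hA : Htp (sph F x ρ') (fun u => sph F x ρ' (reflc i u)) := by
    have h1 := htp_sph_sph hF hinj hρ'0 hρ'r hρ hρr
    have h2 := h1.comp_right _ (reflc i).continuous.continuousOn fun u hu => reflc_mem_sphere i hu
    exact (h1.trans hH).trans h2.symm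
  obtain ⟨c₀, hc₀, hc₀H⟩ := hA.sph_comp G (F x) η hη hG.continuousOn hGne
  set c := min c₀ 1 with hc
  have hc0 : 0 < c := lt_min hc₀ one_pos
  have hB := hc₀H c hc0 (min_le_left _ _)
  have hsmall : ∀ u ∈ Metric.sphere (0 : Euc n) 1, ‖sph F x ρ' u‖ ≤ η := by
    intro u hu
    rw [sph, ← mem_closedBall_iff_norm]
    exact hκF (add_smul_mem_closedBall hρ'0 (min_le_left _ _) hu)
  have hnz : NZ (sph F x ρ') := (htp_sph_sph hF hinj hρ'0 hρ'r hρ'0 hρ'r).choose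
  have hC : Htp (fun u => sph G (F x) 1 (sph F x ρ' u)) (fun u => sph G (F x) c (sph F x ρ' u)) := by
    have hsc : ∀ t ∈ Set.Icc (0 : ℝ) 1, 0 < (1 - t) + t * c ∧ (1 - t) + t * c ≤ 1 := by
      intro t ht
      have hc1 : c ≤ 1 := min_le_right _ _
      constructor
      · rcases ht.2.eq_or_lt with h | h
        · rw [h]; linarith
        · nlinarith [ht.1]
      · nlinarith [ht.1, ht.2]
    refine Htp.of (fun t u => sph G (F x) ((1 - t) + t * c) (sph F x ρ' u)) ?_ ?_ (by simp) (by simp)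
    · have : ContinuousOn (fun p : ℝ × Euc n => sph F x ρ' p.2) (Set.Icc 0 1 ×ˢ Metric.sphere 0 1) :=
        hnz.1.comp continuousOn_snd fun p hp => hp.2
      simp only [sph] at this ⊢
      refine ContinuousOn.sub (hG.comp_continuousOn (continuousOn_const.add (ContinuousOn.smul (f := fun p : ℝ × Euc n => (1 - p.1) + p.1 * c) (by fun_prop) this))) continuousOn_const
    · intro t ht u hu h0
      have h1 := hGne _ (by
        rw [mem_closedBall_iff_norm, add_sub_cancel_left, norm_smul, Real.norm_of_nonneg (hsc t ht).1.le]
        have := hsmall u hu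
        have h3 := (hsc t ht)
        nlinarith [norm_nonneg (sph F x ρ' u)]) (sub_eq_zero.1 h0)
      have h2 : ((1 - t) + t * c) • sph F x ρ' u = 0 := by simpa using h1
      exact hnz.2 u hu ((smul_eq_zero.1 h2).resolve_left (hsc t ht).1.ne')
  have hGs : ∀ u ∈ Metric.sphere (0 : Euc n) 1, sph G (F x) 1 (sph F x ρ' u) = ρ' • u := by
    intro u hu
    simp only [sph, one_smul, add_sub_cancel]
    rw [hGF _ (add_smul_mem_closedBall hρ'0 hρ'r hu), hGF x hxB, add_sub_cancel_left]
  have hD : Htp (fun u : Euc n => ρ' • u) (fun u => sph G (F x) 1 (sph F x ρ' u)) := by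
    refine Htp.of (fun _ u => ρ' • u) (by fun_prop) ?_ (by simp) (fun u hu => (hGs u hu).symm)
    intro t ht u hu
    exact smul_ne_zero hρ'0.ne' (nz_id.2 u hu)
  have hE := (htp_smul _ nz_id ρ' hρ'0).trans (hD.trans hC)
  have hE' := hE.comp_right _ (reflc i).continuous.continuousOn fun u hu => reflc_mem_sphere i hu
  exact not_htp_reflc i ((hE.trans hB).trans hE'.symm)

end

section

variable {n : ℕ}

lemma htp_rankOne {l l' : Euc n →L[ℝ] ℝ} {w w' : Euc n}
    (h : ∀ t ∈ Set.Icc (0 : ℝ) 1, 1 + ((1 - t) • l + t • l') ((1 - t) • w + t • w') < 0) :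
    Htp (fun u => u + l u • w) (fun u => u + l' u • w') := by
  refine Htp.of (fun t u => u + ((1 - t) • l + t • l') u • ((1 - t) • w + t • w')) ?_ ?_ (by simp) (by simp)
  · apply Continuous.continuousOn
    simp only [add_apply, smul_apply]
    fun_prop
  · intro t ht u hu h0
    set L := (1 - t) • l + t • l'
    set W := (1 - t) • w + t • w'
    have h1 : L u * (1 + L W) = 0 := by
      have := congrArg L h0
      simp only [map_add, map_smul, map_zero, smul_eq_mul] at this
      linarith
    have h2 : L u = 0 := (mul_eq_zero.1 h1).resolve_right (h t ht).ne
    rw [h2, zero_smul, add_zero] at h0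
    exact nz_id.2 u hu h0

lemma htp_negTransvection (i j : Fin n) (w : Euc n) (hw : 1 + w i < 0) :
    Htp (fun u : Euc n => u + u i • w) (fun u : Euc n => reflc j u) := by
  have key : ∀ (a b : Fin n) (v v' : Euc n), 1 + v a < 0 → 1 + v b < 0 → 1 + v' a < 0 → 1 + v' b < 0 →
      (a = b ∨ v = v') →
      Htp (fun u : Euc n => u + u a • v) (fun u : Euc n => u + u b • v') := by
    intro a b v v' h1 h2 h3 h4 h5
    refine htp_rankOne (l := EuclideanSpace.proj a) (l' := EuclideanSpace.proj b) fun t ht => ?_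
    have hp : ∀ (a : Fin n) (u : Euc n), (EuclideanSpace.proj a : Euc n →L[ℝ] ℝ) u = u a := fun _ _ => rfl
    simp only [add_apply, smul_apply, hp, PiLp.add_apply, PiLp.smul_apply, smul_eq_mul]
    rcases h5 with rfl | rfl
    · have : (1 - t) * ((1 - t) * v a + t * v' a) + t * ((1 - t) * v a + t * v' a) =
        (1 - t) * v a + t * v' a := by ring
      rw [this]
      rcases ht.2.eq_or_lt with h | h
      · subst h; linarith
      · nlinarith [ht.1]
    · have : (1 - t) * ((1 - t) * v a + t * v a) + t * ((1 - t) * v b + t * v b) =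
        (1 - t) * v a + t * v b := by ring
      rw [this]
      rcases ht.2.eq_or_lt with h | h
      · subst h; linarith
      · nlinarith [ht.1]
  have e1 : ∀ a b : Fin n, (EuclideanSpace.single a (-2 : ℝ) : Euc n) b ≤ 0 := by
    intro a b
    by_cases h : b = a
    · subst h; simp
    · simp [h]
  have e2 : ∀ a : Fin n, (EuclideanSpace.single a (-2 : ℝ) : Euc n) a = -2 := by
    intro a; simp
  have A := key i i w (EuclideanSpace.single i (-2) + EuclideanSpace.single j (-2)) hw hw
    (by have := e1 j i; simp only [PiLp.add_apply, e2]; linarith)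
    (by have := e1 j i; simp only [PiLp.add_apply, e2]; linarith) (Or.inl rfl)
  have B := key i j (EuclideanSpace.single i (-2) + EuclideanSpace.single j (-2))
    (EuclideanSpace.single i (-2) + EuclideanSpace.single j (-2))
    (by have := e1 j i; simp only [PiLp.add_apply, e2]; linarith)
    (by have := e1 i j; simp only [PiLp.add_apply, e2]; linarith)
    (by have := e1 j i; simp only [PiLp.add_apply, e2]; linarith)
    (by have := e1 i j; simp only [PiLp.add_apply, e2]; linarith) (Or.inr rfl)
  have C := key j j (EuclideanSpace.single i (-2) + EuclideanSpace.single j (-2))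
    (EuclideanSpace.single j (-2))
    (by have := e1 i j; simp only [PiLp.add_apply, e2]; linarith)
    (by have := e1 i j; simp only [PiLp.add_apply, e2]; linarith)
    (by rw [e2]; norm_num) (by rw [e2]; norm_num) (Or.inl rfl)
  have D : (fun u : Euc n => u + u j • (EuclideanSpace.single j (-2) : Euc n)) = fun u => reflc j u := by
    funext u
    rw [reflc_apply]
    ext k
    by_cases hk : k = j
    · subst hk; simp; ring
    · simp [hk]
  rw [← D]
  exact (A.trans B).trans C

lemma nz_sph {F : Euc n → Euc n} {x : Euc n} {r : ℝ} (hF : ContinuousOn F (Metric.closedBall x r)) (hinj : Set.InjOn F (Metric.closedBall x r))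
    {ρ : ℝ} (hρ : 0 < ρ) (hρr : ρ ≤ r) : NZ (sph F x ρ) :=
  (htp_sph_sph hF hinj hρ hρr hρ hρr).choose

variable [NeZero n]

/-- A choice of sign for homotopy classes of maps from the sphere to the punctured space. -/
def sphereSign (n : ℕ) [NeZero n] : (Euc n → Euc n) → ℤ := (exists_orientation_character (0 : Fin n)).choose

lemma sphereSign_pm (f : Euc n → Euc n) : sphereSign n f = 1 ∨ sphereSign n f = -1 :=
  (exists_orientation_character (0 : Fin n)).choose_spec.1 f

lemma Htp.sphereSign_eq {f g : Euc n → Euc n} (h : Htp f g) : sphereSign n f = sphereSign n g :=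
  (exists_orientation_character (0 : Fin n)).choose_spec.2.1 f g h

lemma sphereSign_reflc {f : Euc n → Euc n} (hf : NZ f) (h : ¬ Htp f (fun u => f (reflc 0 u))) :
    sphereSign n (fun u => f (reflc 0 u)) = - sphereSign n f :=
  (exists_orientation_character (0 : Fin n)).choose_spec.2.2 f hf h

/-- The local orientation sign of a locally injective continuous map. -/
def osgn (F : Euc n → Euc n) (x : Euc n) : ℤ :=
  if ∃ r > 0, ∀ ρ, 0 < ρ → ρ ≤ r → sphereSign n (sph F x ρ) = 1 then 1 else -1

lemma osgn_pm (F : Euc n → Euc n) (x : Euc n) : osgn F x = 1 ∨ osgn F x = -1 := by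
  unfold osgn; split_ifs <;> simp

variable {F G : Euc n → Euc n} {x y : Euc n} {r : ℝ}

lemma osgn_eq (hF : ContinuousOn F (Metric.closedBall x r)) (hinj : Set.InjOn F (Metric.closedBall x r))
    {ρ : ℝ} (hρ : 0 < ρ) (hρr : ρ ≤ r) : osgn F x = sphereSign n (sph F x ρ) := by
  have h1 : ∀ ρ', 0 < ρ' → ρ' ≤ r → sphereSign n (sph F x ρ') = sphereSign n (sph F x ρ) :=
    fun ρ' h h' => (htp_sph_sph hF hinj h h' hρ hρr).sphereSign_eq
  unfold osgn
  split_ifs with h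
  · obtain ⟨r', hr', h⟩ := h
    rw [← h1 (min r' ρ) (lt_min hr' hρ) ((min_le_right _ _).trans hρr)]
    exact (h _ (lt_min hr' hρ) (min_le_left _ _)).symm
  · rcases sphereSign_pm (sph F x ρ) with h2 | h2
    · exact absurd ⟨r, hρ.trans_le hρr, fun ρ' a b => (h1 ρ' a b).trans h2⟩ h
    · exact h2.symm

lemma osgn_congr (hr : 0 < r) (hF : ContinuousOn F (Metric.closedBall x r))
    (hinj : Set.InjOn F (Metric.closedBall x r)) (h : Set.EqOn F G (Metric.closedBall x r)) :
    osgn F x = osgn G x := by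
  rw [osgn_eq hF hinj hr le_rfl, osgn_eq (hF.congr h.symm) (hinj.congr h) hr le_rfl]
  apply Htp.sphereSign_eq
  have h1 := nz_sph hF hinj hr le_rfl
  refine Htp.of (fun _ => sph F x r) (h1.1.comp continuousOn_snd fun p hp => hp.2) (fun t _ u hu => h1.2 u hu)
    (fun _ _ => rfl) ?_
  intro u hu
  simp only [sph]
  rw [h (add_smul_mem_closedBall hr le_rfl hu), h (Metric.mem_closedBall_self hr.le)]

lemma osgn_eq_of_convex {U : Set (Euc n)} (hUo : IsOpen U) (hU : Convex ℝ U) (hF : ContinuousOn F U)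
    (hinj : Set.InjOn F U) (hx : x ∈ U) (hy : y ∈ U) : osgn F x = osgn F y := by
  obtain ⟨r, hr, hrx, hry⟩ : ∃ r > 0, Metric.closedBall x r ⊆ U ∧ Metric.closedBall y r ⊆ U := by
    obtain ⟨r1, h1, h1'⟩ := Metric.nhds_basis_closedBall.mem_iff.1 (hUo.mem_nhds hx)
    obtain ⟨r2, h2, h2'⟩ := Metric.nhds_basis_closedBall.mem_iff.1 (hUo.mem_nhds hy)
    exact ⟨min r1 r2, lt_min h1 h2, (Metric.closedBall_subset_closedBall (min_le_left _ _)).trans h1',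
      (Metric.closedBall_subset_closedBall (min_le_right _ _)).trans h2'⟩
  rw [osgn_eq (hF.mono hrx) (hinj.mono hrx) hr le_rfl, osgn_eq (hF.mono hry) (hinj.mono hry) hr le_rfl]
  apply Htp.sphereSign_eq
  have hin : ∀ t ∈ Set.Icc (0 : ℝ) 1, ((1 - t) • x + t • y) ∈ U := fun t ht =>
    hU hx hy (by linarith [ht.2]) ht.1 (by ring)
  have hin2 : ∀ t ∈ Set.Icc (0 : ℝ) 1, ∀ u ∈ Metric.sphere (0 : Euc n) 1,
      ((1 - t) • x + t • y) + r • u ∈ U := by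
    intro t ht u hu
    have : ((1 - t) • x + t • y) + r • u = (1 - t) • (x + r • u) + t • (y + r • u) := by module
    rw [this]
    exact hU (hrx (add_smul_mem_closedBall hr le_rfl hu)) (hry (add_smul_mem_closedBall hr le_rfl hu))
      (by linarith [ht.2]) ht.1 (by ring)
  refine Htp.of (fun t => sph F ((1 - t) • x + t • y) r) ?_ ?_ (by simp) (by simp)
  · simp only [sph]
    exact (hF.comp (by fun_prop) fun p hp => hin2 p.1 hp.1 p.2 hp.2).sub
      (hF.comp (by fun_prop) fun p hp => hin p.1 hp.1)
  · intro t ht u hu h0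
    have h1 := hinj (hin2 t ht u hu) (hin t ht) (sub_eq_zero.1 h0)
    have h2 : r • u = 0 := by simpa using h1
    exact nz_id.2 u hu ((smul_eq_zero.1 h2).resolve_left hr.ne')

/-- Precomposing with an elementary negative transvection reverses the orientation sign. -/
lemma osgn_comp_negTransvection (i : Fin n) (w : Euc n) (hw : 1 + w i < 0) (hr : 0 < r)
    (hF : ContinuousOn F (Metric.closedBall (x + x i • w) r))
    (hinj : Set.InjOn F (Metric.closedBall (x + x i • w) r))
    {r' : ℝ} (hr' : 0 < r') (hF' : ContinuousOn (fun z : Euc n => F (z + z i • w)) (Metric.closedBall x r'))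
    (hinj' : Set.InjOn (fun z : Euc n => F (z + z i • w)) (Metric.closedBall x r')) :
    osgn (fun z : Euc n => F (z + z i • w)) x = - osgn F (x + x i • w) := by
  obtain ⟨ρ₀, h0, H⟩ := (htp_negTransvection i 0 w hw).sph_comp F (x + x i • w) r hr hF
    fun y hy h => hinj hy (Metric.mem_closedBall_self hr.le) h
  set ρ := min ρ₀ (min r r') with hρ
  have hρ0 : 0 < ρ := lt_min h0 (lt_min hr hr')
  have hρr : ρ ≤ r := (min_le_right _ _).trans (min_le_left _ _)
  have hρr' : ρ ≤ r' := (min_le_right _ _).trans (min_le_right _ _)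
  rw [osgn_eq hF' hinj' hρ0 hρr', osgn_eq hF hinj hρ0 hρr,
    ← sphereSign_reflc (nz_sph hF hinj hρ0 hρr) (not_htp_sph_reflc 0 hr hF hinj hρ0 hρr),
    ← (H ρ hρ0 (min_le_left _ _)).sphereSign_eq]
  congr 1
  funext u
  simp only [sph, PiLp.add_apply, PiLp.smul_apply, smul_eq_mul]
  congr 2
  module

end

section

variable {d : ℕ}

lemma IsConvexCone.zero_mem {C : Set (Fin d → ℝ)} (h : IsConvexCone C) : 0 ∈ C := h.1
lemma IsConvexCone.add_mem {C : Set (Fin d → ℝ)} (h : IsConvexCone C) {x y : Fin d → ℝ}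
    (hx : x ∈ C) (hy : y ∈ C) : x + y ∈ C := h.2.1 x hx y hy
lemma IsConvexCone.smul_mem {C : Set (Fin d → ℝ)} (h : IsConvexCone C) {x : Fin d → ℝ}
    (hx : x ∈ C) {t : ℝ} (ht : 0 ≤ t) : t • x ∈ C := h.2.2 x hx t ht

lemma isConvexCone_conicalHull (S : Finset (Fin d → ℝ)) : IsConvexCone (conicalHull S) := by
  refine ⟨⟨0, by simp, by simp⟩, ?_, ?_⟩
  · rintro x ⟨c, hc, rfl⟩ y ⟨e, he, rfl⟩
    exact ⟨c + e, fun v => add_nonneg (hc v) (he v), by simp [add_smul, Finset.sum_add_distrib]⟩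
  · rintro x ⟨c, hc, rfl⟩ t ht
    exact ⟨fun v => t * c v, fun v => mul_nonneg ht (hc v), by simp [Finset.smul_sum, mul_smul]⟩

lemma subset_conicalHull (S : Finset (Fin d → ℝ)) {v : Fin d → ℝ} (hv : v ∈ S) : v ∈ conicalHull S :=
  ⟨fun w => if w = v then 1 else 0, fun w => by beta_reduce; split_ifs <;> norm_num, by simp [ite_smul, hv]⟩

lemma conicalHull_mono {S T : Finset (Fin d → ℝ)} (h : S ⊆ T) : conicalHull S ⊆ conicalHull T := by
  rintro x ⟨c, hc, rfl⟩
  refine ⟨fun v => if v ∈ S then c v else 0, fun v => by beta_reduce; split_ifs; exacts [hc v, le_rfl], ?_⟩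
  simp only [ite_smul, zero_smul]
  rw [← Finset.sum_filter, Finset.filter_mem_eq_inter, Finset.inter_eq_right.2 h]

lemma conicalHull_subset {S : Finset (Fin d → ℝ)} {C : Set (Fin d → ℝ)} (hC : IsConvexCone C)
    (h : ∀ v ∈ S, v ∈ C) : conicalHull S ⊆ C := by
  rintro x ⟨c, hc, rfl⟩
  revert h
  induction S using Finset.induction_on with
  | empty => intro _; simpa using hC.zero_mem
  | insert a s ha ih =>
    intro h
    rw [Finset.sum_insert ha]
    exact hC.add_mem (hC.smul_mem (h a (Finset.mem_insert_self _ _)) (hc a))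
      (ih fun v hv => h v (Finset.mem_insert_of_mem hv))

/-- Carathéodory's theorem for cones. -/
lemma exists_linearIndependent_of_mem_conicalHull {S : Finset (Fin d → ℝ)} {x : Fin d → ℝ}
    (hx : x ∈ conicalHull S) : ∃ T ⊆ S, LinearIndependent ℝ (fun v : T => (v : Fin d → ℝ)) ∧
      x ∈ conicalHull T := by
  induction S using Finset.strongInduction with
  | H S ih =>
    by_cases hli : LinearIndependent ℝ (fun v : S => (v : Fin d → ℝ))
    · exact ⟨S, subset_rfl, hli, hx⟩
    · have hdep : ∃ g : (Fin d → ℝ) → ℝ, ∑ v ∈ S, g v • v = 0 ∧ ∃ v ∈ S, 0 < g v := by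
        have := not_linearIndepOn_finset_iff.1 (show ¬ LinearIndepOn ℝ id (S : Set (Fin d → ℝ)) from hli)
        obtain ⟨g, hg, v, hv, hgv⟩ := this
        rcases lt_or_gt_of_ne hgv with h | h
        · exact ⟨-g, by simpa using hg, v, hv, by simpa using h⟩
        · exact ⟨g, hg, v, hv, h⟩
      obtain ⟨g, hg, v₀, hv₀, hgv₀⟩ := hdep
      obtain ⟨c, hc, rfl⟩ := hx
      obtain ⟨u, hu, hmin⟩ := Finset.exists_min_image (S.filter fun v => 0 < g v) (fun v => c v / g v)
        ⟨v₀, by simp [hv₀, hgv₀]⟩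
      rw [Finset.mem_filter] at hu
      set t := c u / g u with ht
      have ht0 : 0 ≤ t := div_nonneg (hc u) hu.2.le
      have hnn : ∀ v ∈ S, 0 ≤ c v - t * g v := by
        intro v hv
        by_cases h : 0 < g v
        · have := hmin v (by simp [hv, h])
          rw [le_div_iff₀ h] at this
          linarith
        · have := mul_nonpos_of_nonneg_of_nonpos ht0 (not_lt.1 h)
          linarith [hc v]
      have hu0 : c u - t * g u = 0 := by rw [ht, div_mul_cancel₀ _ hu.2.ne', sub_self]
      have hmem : ∑ v ∈ S, c v • v ∈ conicalHull (S.erase u) := by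
        refine ⟨fun v => |c v - t * g v|, fun v => abs_nonneg _, ?_⟩
        have h1 : ∑ v ∈ S, c v • v = ∑ v ∈ S, |c v - t * g v| • v := by
          have : ∑ v ∈ S, |c v - t * g v| • v = ∑ v ∈ S, (c v • v - t • (g v • v)) := by
            apply Finset.sum_congr rfl
            intro v hv
            rw [abs_of_nonneg (hnn v hv), sub_smul, mul_smul]
          rw [this, Finset.sum_sub_distrib, ← Finset.smul_sum, hg, smul_zero, sub_zero]
        rw [h1, ← Finset.add_sum_erase _ _ hu.1, hu0]
        simp
      obtain ⟨T, hT, h⟩ := ih _ (Finset.erase_ssubset hu.1) hmem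
      exact ⟨T, hT.trans (Finset.erase_subset _ _), h⟩

lemma isClosed_conicalHull (S : Finset (Fin d → ℝ)) : IsClosed (conicalHull S) := by
  have : conicalHull S = ⋃ T ∈ S.powerset.filter
      (fun T : Finset (Fin d → ℝ) => LinearIndependent ℝ (fun v : T => (v : Fin d → ℝ))), conicalHull T := by
    ext x
    simp only [Finset.mem_filter, Finset.mem_powerset, Set.mem_iUnion, exists_prop]
    constructor
    · intro hx
      obtain ⟨T, hT, h1, h2⟩ := exists_linearIndependent_of_mem_conicalHull hx
      exact ⟨T, ⟨hT, h1⟩, h2⟩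
    · rintro ⟨T, ⟨hT, -⟩, h⟩
      exact conicalHull_mono hT h
  rw [this]
  refine (Finset.finite_toSet _).isClosed_biUnion fun T hT => ?_
  rw [Finset.mem_coe, Finset.mem_filter] at hT
  let L : (T → ℝ) →ₗ[ℝ] (Fin d → ℝ) := Fintype.linearCombination ℝ (fun v : T => (v : Fin d → ℝ))
  have hL : Function.Injective L := hT.2.fintypeLinearCombination_injective
  have hcl : Topology.IsClosedEmbedding L := LinearMap.isClosedEmbedding_of_injective (LinearMap.ker_eq_bot.2 hL)
  have : conicalHull T = L '' {c | ∀ v, 0 ≤ c v} := by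
    ext x
    constructor
    · rintro ⟨c, hc, rfl⟩
      refine ⟨fun v => c v, fun v => hc v, ?_⟩
      simp only [L, Fintype.linearCombination_apply]
      exact Finset.sum_coe_sort T (fun v => c v • v)
    · rintro ⟨c, hc, rfl⟩
      refine ⟨fun v => if h : v ∈ T then c ⟨v, h⟩ else 0, fun v => by beta_reduce; split_ifs; exacts [hc _, le_rfl], ?_⟩
      rw [← Finset.sum_coe_sort T]
      simp [L, Fintype.linearCombination_apply]
  rw [this]
  apply hcl.isClosedMap
  have : {c : T → ℝ | ∀ v, 0 ≤ c v} = ⋂ v, {c | 0 ≤ c v} := by ext; simp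
  rw [this]
  exact isClosed_iInter fun v => isClosed_le continuous_const (continuous_apply v)

/-- The (algebraic) relative interior of a cone. -/
def ri (C : Set (Fin d → ℝ)) : Set (Fin d → ℝ) := {x | x ∈ C ∧ ∀ y ∈ C, ∃ t : ℝ, 0 < t ∧ x - t • y ∈ C}

variable {C D F : Set (Fin d → ℝ)} {x y : Fin d → ℝ}

lemma ri_nonempty (S : Finset (Fin d → ℝ)) : ∑ v ∈ S, v ∈ ri (conicalHull S) := by
  refine ⟨⟨fun _ => 1, by simp, by simp⟩, ?_⟩
  rintro y ⟨c, hc, rfl⟩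
  have hM : 0 < 1 + ∑ v ∈ S, c v := by have := Finset.sum_nonneg fun v (_ : v ∈ S) => hc v; linarith
  refine ⟨(1 + ∑ v ∈ S, c v)⁻¹, inv_pos.2 hM, fun v => |1 - (1 + ∑ v ∈ S, c v)⁻¹ * c v|,
    fun v => abs_nonneg _, ?_⟩
  rw [Finset.smul_sum, ← Finset.sum_sub_distrib]
  apply Finset.sum_congr rfl
  intro v hv
  have h1 : c v ≤ ∑ v ∈ S, c v := Finset.single_le_sum (fun v _ => hc v) hv
  have : (1 + ∑ v ∈ S, c v)⁻¹ * c v ≤ 1 := by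
    rw [inv_mul_le_iff₀ hM]; linarith
  beta_reduce
  rw [abs_of_nonneg (by linarith)]
  module

lemma ri_add (hC : IsConvexCone C) (hx : x ∈ ri C) (hy : y ∈ C) : x + y ∈ ri C := by
  refine ⟨hC.add_mem hx.1 hy, fun z hz => ?_⟩
  obtain ⟨t, ht, h⟩ := hx.2 z hz
  refine ⟨t, ht, ?_⟩
  have := hC.add_mem h hy
  rwa [show x + y - t • z = x - t • z + y by module]

lemma ri_smul (hC : IsConvexCone C) (hx : x ∈ ri C) {s : ℝ} (hs : 0 < s) : s • x ∈ ri C := by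
  refine ⟨hC.smul_mem hx.1 hs.le, fun z hz => ?_⟩
  obtain ⟨t, ht, h⟩ := hx.2 z hz
  refine ⟨s * t, by positivity, ?_⟩
  have := hC.smul_mem h hs.le
  rwa [show s • x - (s * t) • z = s • (x - t • z) by module]

lemma convex_ri (hC : IsConvexCone C) : Convex ℝ (ri C) := by
  intro x hx y hy a b ha hb hab
  rcases ha.eq_or_lt with rfl | ha
  · simp at hab; subst hab; simpa using hy
  · exact ri_add hC (ri_smul hC hx ha) (hC.smul_mem hy.1 hb)

lemma IsFaceOf.eq_of_ri (hC : IsConvexCone C) (hF : IsFaceOf F C) (hx : x ∈ ri C) (hxF : x ∈ F) : F = C := by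
  refine hF.2.1.antisymm fun y hy => ?_
  obtain ⟨t, ht, h⟩ := hx.2 y hy
  have := (hF.2.2 _ h _ (hC.smul_mem hy ht.le) (by simpa using hxF)).2
  have h2 := hF.1.smul_mem this (inv_pos.2 ht).le
  rwa [smul_smul, inv_mul_cancel₀ ht.ne', one_smul] at h2

/-- The smallest face of a cone containing a given point. -/
def faceGen (C : Set (Fin d → ℝ)) (x : Fin d → ℝ) : Set (Fin d → ℝ) := {y | y ∈ C ∧ ∃ t : ℝ, 0 < t ∧ x - t • y ∈ C}

lemma isFaceOf_faceGen (hC : IsConvexCone C) (hx : x ∈ C) : IsFaceOf (faceGen C x) C := by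
  have hmono : ∀ y ∈ C, ∀ s t : ℝ, 0 ≤ s → s ≤ t → x - t • y ∈ C → x - s • y ∈ C := by
    intro y hy s t hs hst h
    have := hC.add_mem h (hC.smul_mem hy (sub_nonneg.2 hst))
    rwa [show x - t • y + (t - s) • y = x - s • y by module] at this
  refine ⟨⟨⟨hC.zero_mem, 1, one_pos, by simpa using hx⟩, ?_, ?_⟩, fun _ h => h.1, ?_⟩
  · rintro y ⟨hy, t, ht, h⟩ z ⟨hz, s, hs, h'⟩
    refine ⟨hC.add_mem hy hz, (min s t) / 2, by positivity, ?_⟩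
    have h1 := hmono y hy (min s t) t (by positivity) (min_le_right _ _) h
    have h2 := hmono z hz (min s t) s (by positivity) (min_le_left _ _) h'
    have := hC.smul_mem (hC.add_mem h1 h2) (t := 1 / 2) (by norm_num)
    rwa [show (1 / 2 : ℝ) • (x - min s t • y + (x - min s t • z)) = x - (min s t / 2) • (y + z) by module] at this
  · rintro y ⟨hy, t, ht, h⟩ s hs
    refine ⟨hC.smul_mem hy hs, t / (1 + s), by positivity, ?_⟩
    rw [smul_smul]
    refine hmono y hy _ t (by positivity) ?_ h
    rw [div_mul_eq_mul_div, div_le_iff₀ (by positivity)]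
    nlinarith
  · rintro y hy z hz ⟨-, t, ht, h⟩
    refine ⟨⟨hy, t, ht, ?_⟩, ⟨hz, t, ht, ?_⟩⟩
    · have := hC.add_mem h (hC.smul_mem hz ht.le)
      rwa [show x - t • (y + z) + t • z = x - t • y by module] at this
    · have := hC.add_mem h (hC.smul_mem hy ht.le)
      rwa [show x - t • (y + z) + t • y = x - t • z by module] at this

lemma mem_ri_faceGen (hC : IsConvexCone C) (hx : x ∈ C) : x ∈ ri (faceGen C x) := by
  have hf := isFaceOf_faceGen hC hx
  have hxf : x ∈ faceGen C x := ⟨hx, 1, one_pos, by simpa using hC.zero_mem⟩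
  refine ⟨hxf, ?_⟩
  rintro y ⟨hy, t, ht, h⟩
  refine ⟨t, ht, (hf.2.2 _ h _ (hC.smul_mem hy ht.le) ?_).1⟩
  simpa using hxf

end

section

variable {d : ℕ} {C D F G : Set (Fin d → ℝ)} {x y : Fin d → ℝ}

lemma exists_sub_of_mem_span (hC : IsConvexCone C) {w : Fin d → ℝ} (hw : w ∈ Submodule.span ℝ C) :
    ∃ a ∈ C, ∃ b ∈ C, w = a - b := by
  induction hw using Submodule.span_induction with
  | mem x h => exact ⟨x, h, 0, hC.zero_mem, by simp⟩
  | zero => exact ⟨0, hC.zero_mem, 0, hC.zero_mem, by simp⟩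
  | add x y _ _ hx hy =>
    obtain ⟨a, ha, b, hb, rfl⟩ := hx
    obtain ⟨a', ha', b', hb', rfl⟩ := hy
    exact ⟨a + a', hC.add_mem ha ha', b + b', hC.add_mem hb hb', by module⟩
  | smul t x _ hx =>
    obtain ⟨a, ha, b, hb, rfl⟩ := hx
    rcases le_total 0 t with ht | ht
    · exact ⟨t • a, hC.smul_mem ha ht, t • b, hC.smul_mem hb ht, by module⟩
    · exact ⟨(-t) • b, hC.smul_mem hb (by linarith), (-t) • a, hC.smul_mem ha (by linarith), by module⟩

lemma exists_basis_coords (C : Set (Fin d → ℝ)) : ∃ (k : ℕ) (v : Fin k → Fin d → ℝ)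
    (φ : (Fin d → ℝ) →ₗ[ℝ] (Fin k → ℝ)), (∀ i, v i ∈ C) ∧ (∀ w ∈ Submodule.span ℝ C, w = ∑ i, φ w i • v i) := by
  obtain ⟨b, hbC, hb, hli⟩ := exists_linearIndependent ℝ C
  have hfin : Finite b := hli.finite_of_isNoetherian
  obtain ⟨k, ⟨e⟩⟩ := Finite.exists_equiv_fin b
  have hli' : LinearIndependent ℝ (fun i : Fin k => ((e.symm i : b) : Fin d → ℝ)) := hli.comp _ e.symm.injective
  obtain ⟨φ, hφ⟩ := LinearMap.exists_leftInverse_of_injective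
    (Fintype.linearCombination ℝ (fun i : Fin k => ((e.symm i : b) : Fin d → ℝ)))
    (LinearMap.ker_eq_bot.2 hli'.fintypeLinearCombination_injective)
  refine ⟨k, fun i => (e.symm i : b), φ, fun i => hbC (e.symm i).2, fun w hw => ?_⟩
  rw [← hb] at hw
  have hr : Set.range (fun i : Fin k => ((e.symm i : b) : Fin d → ℝ)) = b := by
    ext x
    constructor
    · rintro ⟨i, rfl⟩; exact (e.symm i).2
    · intro hx; exact ⟨e ⟨x, hx⟩, by simp⟩
  rw [← hr, ← Fintype.range_linearCombination] at hw
  obtain ⟨c, rfl⟩ := hw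
  have : φ (Fintype.linearCombination ℝ (fun i : Fin k => ((e.symm i : b) : Fin d → ℝ)) c) = c :=
    LinearMap.congr_fun hφ c
  rw [this, Fintype.linearCombination_apply]

/-- The relative interior of a cone is open in its span. -/
lemma eventually_mem_ri (hC : IsConvexCone C) (hx : x ∈ ri C) :
    ∀ᶠ y in 𝓝 x, y ∈ Submodule.span ℝ C → y ∈ ri C := by
  suffices h : ∀ x ∈ ri C, ∀ᶠ y in 𝓝 x, y ∈ Submodule.span ℝ C → y ∈ C by
    have h1 := h _ (ri_smul hC hx (show (0 : ℝ) < 1 / 2 by norm_num))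
    have h2 : Filter.Tendsto (fun y : Fin d → ℝ => y - (1 / 2 : ℝ) • x) (𝓝 x) (𝓝 ((1 / 2 : ℝ) • x)) := by
      have : Continuous (fun y : Fin d → ℝ => y - (1 / 2 : ℝ) • x) := by fun_prop
      convert this.tendsto x using 2
      module
    filter_upwards [h2.eventually h1] with y hy hys
    have h3 := hy (Submodule.sub_mem _ hys (Submodule.smul_mem _ _ (Submodule.subset_span hx.1)))
    have := ri_add hC (ri_smul hC hx (show (0 : ℝ) < 1 / 2 by norm_num)) h3
    rwa [add_sub_cancel] at this
  intro x hx
  obtain ⟨k, v, φ, hv, hφ⟩ := exists_basis_coords C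
  have hsum : ∀ c : Fin k → ℝ, (∀ i, 0 ≤ c i) → ∑ i, c i • v i ∈ C := by
    intro c hc
    exact Finset.sum_induction _ (· ∈ C) (fun _ _ => hC.add_mem) hC.zero_mem
      fun i _ => hC.smul_mem (hv i) (hc i)
  obtain ⟨t, ht, h⟩ := hx.2 (∑ i, v i) (by simpa using hsum (fun _ => 1) (by simp))
  have hc : Continuous φ := LinearMap.continuous_of_finiteDimensional φ
  have h1 : ∀ᶠ y in 𝓝 x, ∀ i, -t < φ (y - x) i := by
    rw [Filter.eventually_all]
    intro i
    have : Continuous (fun y => φ (y - x) i) := by fun_prop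
    refine this.continuousAt.eventually_const_lt ?_
    simpa using ht
  filter_upwards [h1] with y hy hys
  have h2 := hφ (y - x) (Submodule.sub_mem _ hys (Submodule.subset_span hx.1))
  have h3 := hC.add_mem h (hsum (fun i => t + φ (y - x) i) fun i => by linarith [hy i])
  have h4 : x - t • ∑ i, v i + ∑ i, (t + φ (y - x) i) • v i = y := by
    simp only [add_smul, Finset.sum_add_distrib, ← Finset.smul_sum]
    rw [← h2]
    abel
  rwa [h4] at h3

lemma coneDim_mono (h : C ⊆ D) : coneDim C ≤ coneDim D :=
  Submodule.finrank_mono (Submodule.span_mono h)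

lemma IsFaceOf.eq_of_span (hC : IsConvexCone C) (hF : IsFaceOf F C) (hr : (ri F).Nonempty)
    (h : Submodule.span ℝ F = Submodule.span ℝ C) : F = C := by
  obtain ⟨x, hx⟩ := hr
  refine hF.2.1.antisymm fun y hy => ?_
  have h1 := eventually_mem_ri hF.1 hx
  have h2 : Filter.Tendsto (fun t : ℝ => x - t • y) (𝓝[>] 0) (𝓝 x) := by
    have : Continuous (fun t : ℝ => x - t • y) := by fun_prop
    have := this.tendsto 0
    simp only [zero_smul, sub_zero] at this
    exact this.mono_left nhdsWithin_le_nhds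
  obtain ⟨t, ht, ht0⟩ := ((h2.eventually h1).and self_mem_nhdsWithin).exists
  have ht0 : 0 < t := ht0
  have h3 := ht (by
    rw [h]
    exact Submodule.sub_mem _ (Submodule.subset_span (hF.2.1 hx.1)) (Submodule.smul_mem _ _ (Submodule.subset_span hy)))
  have := (hF.2.2 _ (hF.2.1 h3.1) _ (hC.smul_mem hy ht0.le) (by simpa using hx.1)).2
  have h2 := hF.1.smul_mem this (inv_pos.2 ht0).le
  rwa [smul_smul, inv_mul_cancel₀ ht0.ne', one_smul] at h2

namespace Fan
variable (Φ : Fan d)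
variable {Φ}

lemma cc (h : C ∈ Φ.cones) : IsConvexCone C := by
  obtain ⟨⟨S, -, rfl⟩, -⟩ := Φ.pointed C h
  exact isConvexCone_conicalHull S

lemma isClosed_cone (h : C ∈ Φ.cones) : IsClosed C := by
  obtain ⟨⟨S, -, rfl⟩, -⟩ := Φ.pointed C h
  exact isClosed_conicalHull S

lemma ri_nonempty (h : C ∈ Φ.cones) : (ri C).Nonempty := by
  obtain ⟨⟨S, -, rfl⟩, -⟩ := Φ.pointed C h
  exact ⟨_, _root_.ri_nonempty S⟩

lemma isPointed (h : C ∈ Φ.cones) : IsPointedSet C := (Φ.pointed C h).2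

lemma isFaceOf (hC : C ∈ Φ.cones) (hD : D ∈ Φ.cones) (h : C ⊆ D) : IsFaceOf C D := by
  have := (Φ.inter_face C hC D hD).2
  rwa [Set.inter_eq_left.2 h] at this

lemma inter_mem (hC : C ∈ Φ.cones) (hD : D ∈ Φ.cones) : C ∩ D ∈ Φ.cones :=
  Φ.faces_mem C hC _ (Φ.inter_face C hC D hD).1

lemma subset_of_ri (hC : C ∈ Φ.cones) (hD : D ∈ Φ.cones) (hx : x ∈ ri C) (hxD : x ∈ D) : C ⊆ D := by
  have := (Φ.inter_face C hC D hD).1.eq_of_ri (cc hC) hx ⟨hx.1, hxD⟩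
  exact Set.inter_eq_left.1 this

lemma eq_of_ri (hC : C ∈ Φ.cones) (hD : D ∈ Φ.cones) (hx : x ∈ ri C) (hxD : x ∈ ri D) : C = D :=
  (subset_of_ri hC hD hx hxD.1).antisymm (subset_of_ri hD hC hxD hx.1)

lemma exists_face_ri (hD : D ∈ Φ.cones) (hx : x ∈ D) : ∃ C ∈ Φ.cones, C ⊆ D ∧ x ∈ ri C :=
  have h := isFaceOf_faceGen (cc hD) hx
  ⟨faceGen D x, Φ.faces_mem D hD _ h, h.2.1, mem_ri_faceGen (cc hD) hx⟩

lemma zero_cone_mem (hD : D ∈ Φ.cones) : ({0} : Set (Fin d → ℝ)) ∈ Φ.cones := by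
  refine Φ.faces_mem D hD _ ⟨⟨by simp, by simp, by simp⟩, by simpa using (cc hD).zero_mem, ?_⟩
  intro x hx y hy h
  have h' : x + y = 0 := h
  have hxy : y = -x := by rw [eq_neg_iff_add_eq_zero, add_comm]; exact h'
  have h0 := isPointed hD x hx (hxy ▸ hy)
  subst h0
  exact ⟨rfl, by simpa using hxy⟩

lemma eq_of_span_le (hC : C ∈ Φ.cones) (hD : D ∈ Φ.cones) (h : C ⊆ D)
    (hs : coneDim D ≤ coneDim C) : C = D :=
  (isFaceOf hC hD h).eq_of_span (cc hD) (ri_nonempty hC)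
    (Submodule.eq_of_le_of_finrank_le (Submodule.span_mono h) hs)

lemma coneDim_lt (hC : C ∈ Φ.cones) (hD : D ∈ Φ.cones) (h : C ⊆ D) (hne : C ≠ D) :
    coneDim C < coneDim D := by
  by_contra hlt
  exact hne (eq_of_span_le hC hD h (not_lt.1 hlt))

lemma notMem_of_ri (hC : C ∈ Φ.cones) (hD : D ∈ Φ.cones) (h : C ⊆ D) (hne : C ≠ D) (hx : x ∈ ri D) :
    x ∉ C := fun hxC => hne (h.antisymm (subset_of_ri hD hC hx hxC))

/-- Points near `p` only lie in cones containing `p`. -/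
lemma eventually_mem_of_mem (Φ : Fan d) (p : Fin d → ℝ) : ∀ᶠ x in 𝓝 p, ∀ D ∈ Φ.cones, x ∈ D → p ∈ D := by
  rw [Filter.eventually_all_finite Φ.finite]
  intro D hD
  by_cases h : p ∈ D
  · simp [h]
  · filter_upwards [(isClosed_cone hD).isOpen_compl.mem_nhds h] with x hx hxD
    exact absurd hxD hx

lemma coneDim_le_dim (h : C ∈ Φ.cones) : coneDim C ≤ Φ.dim :=
  le_csSup ((Φ.finite.image _).bddAbove) ⟨C, h, rfl⟩

/-- A point in the relative interior of each cone. -/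
def bc (C : Set (Fin d → ℝ)) : Fin d → ℝ := if h : (ri C).Nonempty then h.choose else 0

lemma bc_mem (h : C ∈ Φ.cones) : bc C ∈ ri C := by
  rw [bc, dif_pos (ri_nonempty h)]
  exact (ri_nonempty h).choose_spec

lemma bc_notMem_span (hC : C ∈ Φ.cones) (hD : D ∈ Φ.cones) (h : C ⊆ D) (hne : C ≠ D) (hx : x ∈ ri D) :
    x ∉ Submodule.span ℝ C := by
  intro hs
  obtain ⟨a, ha, b, hb, hab⟩ := exists_sub_of_mem_span (cc hC) hs
  have : x + b = a := by rw [hab]; abel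
  exact notMem_of_ri hC hD h hne hx ((isFaceOf hC hD h).2.2 x hx.1 b (h hb) (this ▸ ha)).1

lemma mem_of_mem_span (hC : C ∈ Φ.cones) (hD : D ∈ Φ.cones) (h : C ⊆ D) (hx : x ∈ D)
    (hs : x ∈ Submodule.span ℝ C) : x ∈ C := by
  obtain ⟨a, ha, b, hb, hab⟩ := exists_sub_of_mem_span (cc hC) hs
  have : x + b = a := by rw [hab]; abel
  exact ((isFaceOf hC hD h).2.2 x hx b (h hb) (this ▸ ha)).1

end Fan

end

section

section generic
variable {E : Type*} [NormedAddCommGroup E] [NormedSpace ℝ E]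

lemma subsingleton_setOf_add_smul_mem {Q : Submodule ℝ E} {a u : E} (h : ¬ (a ∈ Q ∧ u ∈ Q)) :
    {t : ℝ | a + t • u ∈ Q}.Subsingleton := by
  intro s hs t ht
  by_contra hne
  have h1 : (s - t) • u ∈ Q := by
    have := Q.sub_mem hs ht
    rwa [show a + s • u - (a + t • u) = (s - t) • u by module] at this
  have hu : u ∈ Q := (Q.smul_mem_iff (sub_ne_zero.2 hne)).1 h1
  exact h ⟨(Q.add_mem_iff_left (Q.smul_mem s hu)).1 hs, hu⟩

lemma exists_mem_avoid (W : Submodule ℝ E) {P : Set (Submodule ℝ E)} (hP : P.Finite)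
    (h : ∀ Q ∈ P, ¬ W ≤ Q) : ∃ w ∈ W, ∀ Q ∈ P, w ∉ Q := by
  induction P, hP using Set.Finite.induction_on with
  | empty => exact ⟨0, W.zero_mem, by simp⟩
  | @insert Q S _ hfin ih =>
    obtain ⟨w, hw, hS⟩ := ih fun Q hQ => h Q (Set.mem_insert_of_mem _ hQ)
    obtain ⟨u, hu, huQ⟩ := SetLike.not_le_iff_exists.1 (h Q (Set.mem_insert _ _))
    have hbad : (⋃ R ∈ insert Q S, {t : ℝ | w + t • u ∈ R}).Finite := by
      refine (hfin.insert Q).biUnion fun R hR => (subsingleton_setOf_add_smul_mem ?_).finite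
      rcases hR with rfl | hR
      · exact fun h => huQ h.2
      · exact fun h => hS R hR h.1
    obtain ⟨t, ht⟩ := hbad.infinite_compl.nonempty
    refine ⟨w + t • u, W.add_mem hw (W.smul_mem _ hu), fun R hR hmem => ht ?_⟩
    simp only [Set.mem_iUnion]
    exact ⟨R, hR, hmem⟩

/-- Generic points of a subspace avoid finitely many subspaces not containing it. -/
lemma frequently_avoid (W : Submodule ℝ E) {P : Set (Submodule ℝ E)} (hP : P.Finite)
    (h : ∀ Q ∈ P, ¬ W ≤ Q) {x : E} (hx : x ∈ W) : ∃ᶠ y in 𝓝 x, y ∈ W ∧ ∀ Q ∈ P, y ∉ Q := by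
  obtain ⟨w, hw, hwP⟩ := exists_mem_avoid W hP h
  have hbad : (⋃ R ∈ P, {t : ℝ | x + t • w ∈ R}).Finite :=
    hP.biUnion fun R hR => (subsingleton_setOf_add_smul_mem fun h => hwP R hR h.2).finite
  have h1 : ∃ᶠ t in 𝓝 (0 : ℝ), t ∈ (⋃ R ∈ P, {t : ℝ | x + t • w ∈ R})ᶜ := by
    have := hbad.countable.dense_compl ℝ
    exact mem_closure_iff_frequently.1 (this 0)
  have h2 : Filter.Tendsto (fun t : ℝ => x + t • w) (𝓝 0) (𝓝 x) := by
    have : Continuous (fun t : ℝ => x + t • w) := by fun_prop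
    simpa using this.tendsto 0
  refine h2.frequently (h1.mono fun t ht => ⟨W.add_mem hx (W.smul_mem _ hw), fun R hR hmem => ht ?_⟩)
  simp only [Set.mem_iUnion]
  exact ⟨R, hR, hmem⟩

/-- A set whose membership is locally constant on a convex part of a subspace away from finitely many
subspaces of codimension two is there, up to closure, everything or nothing. -/
lemma frequently_mem_of_locally_constant (W : Submodule ℝ E) {P : Set (Submodule ℝ E)} (hP : P.Finite)
    (h : ∀ Q ∈ P, ∀ a, ¬ W ≤ Q ⊔ Submodule.span ℝ {a}) {U : Set E} (hU : Convex ℝ U) {A : Set E}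
    (hloc : ∀ x ∈ U, x ∈ W → (∀ Q ∈ P, x ∉ Q) →
      (∀ᶠ y in 𝓝 x, y ∈ W → y ∈ A) ∨ (∀ᶠ y in 𝓝 x, y ∈ W → y ∉ A))
    {a b : E} (haU : a ∈ U) (haW : a ∈ W) (haP : ∀ Q ∈ P, a ∉ Q) (haA : a ∈ A)
    (hbU : U ∈ 𝓝 b) (hbW : b ∈ W) : ∃ᶠ y in 𝓝 b, y ∈ W ∧ y ∈ A := by
  have h1 := frequently_avoid W (hP.image fun Q => Q ⊔ Submodule.span ℝ {a})
    (by rintro _ ⟨Q, hQ, rfl⟩; exact h Q hQ a) hbW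
  refine (h1.and_eventually hbU).mono ?_
  rintro y ⟨⟨hyW, hyP⟩, hyU⟩
  refine ⟨hyW, ?_⟩
  have hseg : ∀ x ∈ segment ℝ a y, x ∈ U ∧ x ∈ W ∧ ∀ Q ∈ P, x ∉ Q := by
    intro x hx
    refine ⟨hU.segment_subset haU hyU hx, ?_⟩
    obtain ⟨s, t, hs, ht, hst, rfl⟩ := hx
    refine ⟨W.add_mem (W.smul_mem _ haW) (W.smul_mem _ hyW), fun Q hQ hmem => ?_⟩
    rcases ht.eq_or_lt with rfl | ht
    · rw [add_zero] at hst; subst hst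
      exact haP Q hQ (by simpa using hmem)
    · apply hyP _ ⟨Q, hQ, rfl⟩
      have h2 : y = t⁻¹ • (s • a + t • y) + (-(t⁻¹ * s)) • a := by
        rw [smul_add, smul_smul, smul_smul, inv_mul_cancel₀ ht.ne']
        module
      rw [h2]
      exact Submodule.add_mem_sup (Q.smul_mem _ hmem)
        (Submodule.smul_mem _ _ (Submodule.mem_span_singleton_self a))
  have hcont : ContinuousOn (fun x => decide (x ∈ A)) (segment ℝ a y) := by
    intro x hx
    obtain ⟨h1, h2, h3⟩ := hseg x hx
    have hW : ∀ᶠ z in 𝓝[segment ℝ a y] x, z ∈ W :=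
      Filter.eventually_of_mem self_mem_nhdsWithin fun z hz => (hseg z hz).2.1
    have hc : ∃ c : Bool, ∀ᶠ z in 𝓝[segment ℝ a y] x, decide (z ∈ A) = c := by
      rcases hloc x h1 h2 h3 with h4 | h4
      · refine ⟨true, ?_⟩
        filter_upwards [hW, nhdsWithin_le_nhds h4] with z hz hz'
        simpa using hz' hz
      · refine ⟨false, ?_⟩
        filter_upwards [hW, nhdsWithin_le_nhds h4] with z hz hz'
        simpa using hz' hz
    obtain ⟨c, hc⟩ := hc
    have hcx : decide (x ∈ A) = c := hc.self_of_nhdsWithin hx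
    exact (continuousWithinAt_const (b := c)).congr_of_eventuallyEq hc hcx
  have := (convex_segment a y).isPreconnected.constant hcont (left_mem_segment ℝ a y) (right_mem_segment ℝ a y)
  simpa [haA] using this

lemma finrank_sup_span_singleton_le [FiniteDimensional ℝ E] (P : Submodule ℝ E) (a : E) :
    Module.finrank ℝ ↥(P ⊔ Submodule.span ℝ {a}) ≤ Module.finrank ℝ P + 1 := by
  have h1 := Submodule.finrank_add_le_finrank_add_finrank P (Submodule.span ℝ {a})
  have h2 := finrank_span_le_card (R := ℝ) ({a} : Set E)
  simp at h2
  omega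

lemma not_le_of_finrank_lt [FiniteDimensional ℝ E] {P W : Submodule ℝ E}
    (h : Module.finrank ℝ P < Module.finrank ℝ W) : ¬ W ≤ P :=
  fun hle => absurd (Submodule.finrank_mono hle) (not_le.2 h)

end generic

namespace Fan
variable {d : ℕ} {C D F G R R' : Set (Fin d → ℝ)} {x y : Fin d → ℝ} {Φ : Fan d}

/-- Every proper face is contained in a face of codimension one. -/
lemma exists_ridge (hC : C ∈ Φ.cones) (hD : D ∈ Φ.cones) (hCD : C ⊆ D) (hne : C ≠ D) :
    ∃ R ∈ Φ.cones, C ⊆ R ∧ R ⊆ D ∧ coneDim R + 1 = coneDim D := by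
  obtain ⟨R, ⟨hR, hCR, hRD, hRne⟩, hmax⟩ :=
    (Φ.finite.subset (t := {R | R ∈ Φ.cones ∧ C ⊆ R ∧ R ⊆ D ∧ R ≠ D}) fun _ h => h.1).exists_maximalFor
      coneDim _ ⟨C, hC, subset_rfl, hCD, hne⟩
  refine ⟨R, hR, hCR, hRD, ?_⟩
  have hlt := coneDim_lt hR hD hRD hRne
  by_contra hk
  obtain ⟨r, hr⟩ := ri_nonempty hR
  obtain ⟨b, hb⟩ := ri_nonempty hD
  have hev : ∀ᶠ x in 𝓝 r, x ∈ D → x ∉ ri D → x ∈ R := by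
    filter_upwards [eventually_mem_of_mem Φ r] with x hx hxD hxri
    obtain ⟨F, hF, hFD, hxF⟩ := exists_face_ri hD hxD
    have hRF := subset_of_ri hR hF hr (hx F hF hxF.1)
    have hFne : F ≠ D := fun h => hxri (h ▸ hxF)
    have := hmax ⟨hF, hCR.trans hRF, hFD, hFne⟩ (coneDim_mono hRF)
    rw [eq_of_span_le hR hF hRF this]
    exact hxF.1
  obtain ⟨η, hη, hball⟩ := Metric.eventually_nhds_iff_ball.1 hev
  have hbne : b ≠ 0 := by
    rintro rfl
    exact bc_notMem_span hR hD hRD hRne hb (Submodule.zero_mem _)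
  set δ := η / (2 * ‖b‖) with hδ
  have hb0 : 0 < ‖b‖ := norm_pos_iff.2 hbne
  have hδ0 : 0 < δ := by positivity
  have hδb : δ * ‖b‖ < η := by rw [hδ]; field_simp; norm_num
  have hrW : r ∈ Submodule.span ℝ D := Submodule.subset_span (hRD hr.1)
  have hbW : b ∈ Submodule.span ℝ D := Submodule.subset_span hb.1
  have hrb : r + δ • b ∈ ri D := by
    rw [add_comm]; exact ri_add (cc hD) (ri_smul (cc hD) hb hδ0) (hRD hr.1)
  have hrb' : r - δ • b ∉ D := by
    intro h
    have := (isFaceOf hR hD hRD).2.2 _ h _ ((cc hD).smul_mem hb.1 hδ0.le) (by simpa using hr.1)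
    exact bc_notMem_span hR hD hRD hRne (ri_smul (cc hD) hb hδ0) (Submodule.subset_span this.2)
  have key := frequently_mem_of_locally_constant (Submodule.span ℝ D) (P := {Submodule.span ℝ R})
    (Set.finite_singleton _) (by
      rintro _ rfl a
      apply not_le_of_finrank_lt
      have := finrank_sup_span_singleton_le (Submodule.span ℝ R) a
      unfold coneDim at *
      omega) (convex_ball r η) (A := D) (by
      intro x hx hxW hxR
      by_cases hxD : x ∈ D
      · left
        have : x ∈ ri D := by
          by_contra h
          exact hxR _ rfl (Submodule.subset_span (hball x hx hxD h))
        exact (eventually_mem_ri (cc hD) this).mono fun y hy hyW => (hy hyW).1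
      · right
        filter_upwards [(isClosed_cone hD).isOpen_compl.mem_nhds hxD] with y hy _ using hy)
    (a := r + δ • b) (b := r - δ • b)
    (by rw [mem_ball_iff_norm, add_sub_cancel_left, norm_smul, Real.norm_of_nonneg hδ0.le]; exact hδb)
    (Submodule.subset_span hrb.1)
    (by rintro _ rfl; exact bc_notMem_span hR hD hRD hRne hrb)
    hrb.1
    (Metric.isOpen_ball.mem_nhds (by
      rw [mem_ball_iff_norm, sub_sub_cancel_left, norm_neg, norm_smul, Real.norm_of_nonneg hδ0.le]; exact hδb))
    (Submodule.sub_mem _ hrW (Submodule.smul_mem _ _ hbW))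
  obtain ⟨y, ⟨-, h1⟩, h2⟩ := (key.and_eventually ((isClosed_cone hD).isOpen_compl.mem_nhds hrb')).exists
  exact h2 h1

/-- The span of a cone is generated by a facet and a vector outside of it. -/
lemma exists_sub_smul_mem_span (hdim : coneDim R + 1 = coneDim D) (hRD : R ⊆ D)
    {b : Fin d → ℝ} (hb : b ∈ D) (hbR : b ∉ Submodule.span ℝ R) (hx : x ∈ Submodule.span ℝ D) :
    ∃ t : ℝ, x - t • b ∈ Submodule.span ℝ R := by
  have hle : Submodule.span ℝ R ⊔ Submodule.span ℝ {b} ≤ Submodule.span ℝ D :=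
    sup_le (Submodule.span_mono hRD) (Submodule.span_mono (by simpa using hb))
  have hlt : Submodule.span ℝ R < Submodule.span ℝ R ⊔ Submodule.span ℝ {b} := by
    refine lt_of_le_of_ne le_sup_left fun h => hbR ?_
    rw [h]
    exact Submodule.mem_sup_right (Submodule.mem_span_singleton_self b)
  have h1 := Submodule.finrank_lt_finrank_of_lt hlt
  have h2 := Submodule.eq_of_le_of_finrank_le hle (by unfold coneDim at hdim; omega)
  rw [← h2] at hx
  obtain ⟨r, hr, z, hz, rfl⟩ := Submodule.mem_sup.1 hx
  obtain ⟨t, rfl⟩ := Submodule.mem_span_singleton.1 hz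
  exact ⟨t, by simpa using hr⟩

/-- A supporting functional of a face of codimension one. -/
lemma exists_functional (hR : R ∈ Φ.cones) (hD : D ∈ Φ.cones) (hRD : R ⊆ D) (hdim : coneDim R + 1 = coneDim D) :
    ∃ l : (Fin d → ℝ) →ₗ[ℝ] ℝ, (∀ x ∈ Submodule.span ℝ R, l x = 0) ∧ ∀ x ∈ D, x ∉ R → 0 < l x := by
  have hne : R ≠ D := by rintro rfl; omega
  obtain ⟨b, hb⟩ := ri_nonempty hD
  have hbR := bc_notMem_span hR hD hRD hne hb
  obtain ⟨l, hl, hlb⟩ := LinearMap.exists_extend_of_notMem (0 : Submodule.span ℝ R →ₗ[ℝ] ℝ) hbR 1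
  have hl0 : ∀ x ∈ Submodule.span ℝ R, l x = 0 := fun x hx => by simpa using LinearMap.congr_fun hl ⟨x, hx⟩
  refine ⟨l, hl0, fun x hx hxR => ?_⟩
  obtain ⟨t, ht⟩ := exists_sub_smul_mem_span hdim hRD hb.1 hbR (Submodule.subset_span hx)
  have hlx : l x = t := by
    have := hl0 _ ht
    simp only [map_sub, map_smul, hlb, smul_eq_mul, mul_one] at this
    linarith
  rw [hlx]
  by_contra hneg
  have h1 : x + (-t) • b ∈ D := (cc hD).add_mem hx ((cc hD).smul_mem hb.1 (by linarith))
  have h2 : x + (-t) • b ∈ R := mem_of_mem_span hR hD hRD h1 (by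
    rwa [show x + (-t) • b = x - t • b by module])
  exact hxR ((isFaceOf hR hD hRD).2.2 _ hx _ ((cc hD).smul_mem hb.1 (by linarith)) h2).1

/-- Two facets of a cone sharing a codimension two face lie on different sides. -/
lemma exists_combination_of_ridges (hG : G ∈ Φ.cones) (hR : R ∈ Φ.cones) (hR' : R' ∈ Φ.cones)
    (hD : D ∈ Φ.cones) (hGR : G ⊆ R) (hGR' : G ⊆ R') (hRD : R ⊆ D) (hR'D : R' ⊆ D)
    (hdG : coneDim G + 2 = coneDim D) (hdR : coneDim R + 1 = coneDim D)
    (hdR' : coneDim R' + 1 = coneDim D) (hne : R ≠ R') :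
    ∃ α β : ℝ, α < 0 ∧ bc R' - (α • bc R + β • bc D) ∈ Submodule.span ℝ G := by
  obtain ⟨l, hl, hlp⟩ := exists_functional hR hD hRD hdR
  obtain ⟨l', hl', hlp'⟩ := exists_functional hR' hD hR'D hdR'
  have hRD' : R ≠ D := by rintro rfl; omega
  have hneD : R' ≠ D := by rintro rfl; omega
  have hGRne : G ≠ R := by rintro rfl; omega
  have hb := bc_mem hR
  have hb' := bc_mem hR'
  have hbD := bc_mem hD
  have h1 : bc R ∉ R' := fun h => hne (eq_of_span_le hR hR' (subset_of_ri hR hR' hb h) (by omega))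
  have h2 : bc R' ∉ R := fun h => hne (eq_of_span_le hR' hR (subset_of_ri hR' hR hb' h) (by omega)).symm
  obtain ⟨β, hβ⟩ := exists_sub_smul_mem_span hdR hRD hbD.1 (bc_notMem_span hR hD hRD hRD' hbD)
    (Submodule.subset_span (hR'D hb'.1))
  obtain ⟨α, hα⟩ := exists_sub_smul_mem_span (by omega) hGR hb.1 (bc_notMem_span hG hR hGR hGRne hb) hβ
  refine ⟨α, β, ?_, by rwa [show bc R' - (α • bc R + β • bc D) = bc R' - β • bc D - α • bc R by module]⟩
  have e1 := hl _ (Submodule.span_mono hGR hα)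
  have e2 := hl' _ (Submodule.span_mono hGR' hα)
  have e3 := hl _ (Submodule.subset_span hb.1)
  have e4 := hl' _ (Submodule.subset_span hb'.1)
  simp only [map_sub, map_smul, smul_eq_mul, e3, e4] at e1 e2
  have p1 := hlp _ (hR'D hb'.1) h2
  have p2 := hlp' _ (hRD hb.1) h1
  have p3 := hlp _ hbD.1 (notMem_of_ri hR hD hRD hRD' hbD)
  have p4 := hlp' _ hbD.1 (notMem_of_ri hR' hD hR'D hneD hbD)
  have hβ0 : 0 < β := by
    by_contra h
    nlinarith
  by_contra h
  nlinarith [mul_pos hβ0 p4, mul_nonneg (not_lt.1 h) p2.le]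

/-- There are at most two facets of a cone through a codimension two face. -/
lemma eq_or_eq_of_ridges {R₁ R₂ R₃ : Set (Fin d → ℝ)} (hG : G ∈ Φ.cones) (hR₁ : R₁ ∈ Φ.cones) (hR₂ : R₂ ∈ Φ.cones)
    (hR₃ : R₃ ∈ Φ.cones) (hD : D ∈ Φ.cones) (hG₁ : G ⊆ R₁) (hG₂ : G ⊆ R₂) (hG₃ : G ⊆ R₃)
    (h₁ : R₁ ⊆ D) (h₂ : R₂ ⊆ D) (h₃ : R₃ ⊆ D)
    (hdG : coneDim G + 2 = coneDim D) (hd₁ : coneDim R₁ + 1 = coneDim D)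
    (hd₂ : coneDim R₂ + 1 = coneDim D) (hd₃ : coneDim R₃ + 1 = coneDim D) (hne : R₁ ≠ R₂) :
    R₃ = R₁ ∨ R₃ = R₂ := by
  by_contra hcon
  push Not at hcon
  obtain ⟨l₁, hl₁, hp₁⟩ := exists_functional hR₁ hD h₁ hd₁
  obtain ⟨l₂, hl₂, hp₂⟩ := exists_functional hR₂ hD h₂ hd₂
  obtain ⟨l₃, hl₃, hp₃⟩ := exists_functional hR₃ hD h₃ hd₃
  have hnot : ∀ {R R'}, R ∈ Φ.cones → R' ∈ Φ.cones → coneDim R + 1 = coneDim D → coneDim R' + 1 = coneDim D →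
      R ≠ R' → bc R ∉ R' := fun hR hR' hd hd' hne h =>
    hne (eq_of_span_le hR hR' (subset_of_ri hR hR' (bc_mem hR) h) (by omega))
  obtain ⟨α, β, hα, h⟩ := exists_combination_of_ridges hG hR₁ hR₃ hD hG₁ hG₃ h₁ h₃ hdG hd₁ hd₃ hcon.1.symm
  obtain ⟨α', β', hα', h'⟩ := exists_combination_of_ridges hG hR₁ hR₂ hD hG₁ hG₂ h₁ h₂ hdG hd₁ hd₂ hne
  have q : ∀ l : (Fin d → ℝ) →ₗ[ℝ] ℝ, (∀ x ∈ Submodule.span ℝ G, l x = 0) →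
      l (bc R₃) = α * l (bc R₁) + β * l (bc D) ∧ l (bc R₂) = α' * l (bc R₁) + β' * l (bc D) := by
    intro l hl
    have a := hl _ h
    have b := hl _ h'
    simp only [map_sub, map_add, map_smul, smul_eq_mul] at a b
    exact ⟨by linarith, by linarith⟩
  have q2 := q l₂ fun x hx => hl₂ x (Submodule.span_mono hG₂ hx)
  have q3 := q l₃ fun x hx => hl₃ x (Submodule.span_mono hG₃ hx)
  have z2 := hl₂ _ (Submodule.subset_span (bc_mem hR₂).1)
  have z3 := hl₃ _ (Submodule.subset_span (bc_mem hR₃).1)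
  have p21 := hp₂ _ (h₁ (bc_mem hR₁).1) (hnot hR₁ hR₂ hd₁ hd₂ hne)
  have p23 := hp₂ _ (h₃ (bc_mem hR₃).1) (hnot hR₃ hR₂ hd₃ hd₂ hcon.2)
  have p31 := hp₃ _ (h₁ (bc_mem hR₁).1) (hnot hR₁ hR₃ hd₁ hd₃ hcon.1.symm)
  have p32 := hp₃ _ (h₂ (bc_mem hR₂).1) (hnot hR₂ hR₃ hd₂ hd₃ hcon.2.symm)
  have d2 := hp₂ _ (bc_mem hD).1 (notMem_of_ri hR₂ hD h₂ (by rintro rfl; omega) (bc_mem hD))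
  have d3 := hp₃ _ (bc_mem hD).1 (notMem_of_ri hR₃ hD h₃ (by rintro rfl; omega) (bc_mem hD))
  rw [q2.1] at p23
  rw [q2.2] at z2
  rw [q3.2] at p32
  rw [q3.1] at z3
  have k1 : 0 < l₂ (bc D) * (α * β' - β * α') := by
    have h1 := mul_pos p23 (neg_pos.2 hα')
    have h2 : (α * l₂ (bc R₁) + β * l₂ (bc D)) * -α' = l₂ (bc D) * (α * β' - β * α') -
      α * (α' * l₂ (bc R₁) + β' * l₂ (bc D)) := by ring
    rw [h2, z2, mul_zero, sub_zero] at h1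
    exact h1
  have k2 : 0 < l₃ (bc D) * (β * α' - α * β') := by
    have h1 := mul_pos p32 (neg_pos.2 hα)
    have h2 : (α' * l₃ (bc R₁) + β' * l₃ (bc D)) * -α = l₃ (bc D) * (β * α' - α * β') -
      α' * (α * l₃ (bc R₁) + β * l₃ (bc D)) := by ring
    rw [h2, z3, mul_zero, sub_zero] at h1
    exact h1
  have k3 := (pos_iff_pos_of_mul_pos k1).1 d2
  have k4 := (pos_iff_pos_of_mul_pos k2).1 d3
  linarith
end Fan

end

section

namespace Fan
variable {d : ℕ} {C D F G R R' : Set (Fin d → ℝ)} {x y : Fin d → ℝ} {Φ : Fan d}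

/-- The cone generated by `R` and a line. -/
def addLine (R : Set (Fin d → ℝ)) (b : Fin d → ℝ) : Set (Fin d → ℝ) := {x | ∃ r ∈ R, ∃ α : ℝ, x = r + α • b}

lemma isClosed_addLine (hR : R ∈ Φ.cones) (b : Fin d → ℝ) : IsClosed (addLine R b) := by
  obtain ⟨⟨S, -, rfl⟩, -⟩ := Φ.pointed R hR
  have hc : IsConvexCone (conicalHull S) := isConvexCone_conicalHull S
  have hcone : IsConvexCone (addLine (conicalHull S) b) := by
    refine ⟨⟨0, hc.zero_mem, 0, by simp⟩, ?_, ?_⟩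
    · rintro _ ⟨r, hr, α, rfl⟩ _ ⟨s, hs, β, rfl⟩
      exact ⟨r + s, hc.add_mem hr hs, α + β, by module⟩
    · rintro _ ⟨r, hr, α, rfl⟩ t ht
      exact ⟨t • r, hc.smul_mem hr ht, t * α, by module⟩
  have : addLine (conicalHull S) b = conicalHull (insert b (insert (-b) S)) := by
    have hc' := isConvexCone_conicalHull (insert b (insert (-b) S))
    apply Set.Subset.antisymm
    · rintro _ ⟨r, hr, α, rfl⟩
      refine hc'.add_mem (conicalHull_mono (fun v hv => by simp [hv]) hr) ?_
      rcases le_total 0 α with h | h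
      · exact hc'.smul_mem (subset_conicalHull _ (by simp)) h
      · rw [show α • b = (-α) • (-b) by module]
        exact hc'.smul_mem (subset_conicalHull _ (by simp)) (by linarith)
    · refine conicalHull_subset hcone fun v hv => ?_
      simp only [Finset.mem_insert] at hv
      rcases hv with rfl | rfl | hv
      · exact ⟨0, hc.zero_mem, 1, by simp⟩
      · exact ⟨0, hc.zero_mem, -1, by simp⟩
      · exact ⟨v, subset_conicalHull _ hv, 0, by simp⟩
  rw [this]
  exact isClosed_conicalHull _

lemma exists_ridge_addLine (hD : D ∈ Φ.cones) (hpos : 0 < coneDim D) {b : Fin d → ℝ} (hb : b ∈ ri D)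
    (hx : x ∈ Submodule.span ℝ D) :
    ∃ R ∈ Φ.cones, R ⊆ D ∧ coneDim R + 1 = coneDim D ∧ x ∈ addLine R b := by
  have hb0 : b ≠ 0 := by
    rintro rfl
    have h0 : ∀ y ∈ D, y = 0 := by
      intro y hy
      obtain ⟨t, ht, h⟩ := hb.2 y hy
      have h1 := isPointed hD _ ((cc hD).smul_mem hy ht.le) (by simpa using h)
      exact (smul_eq_zero.1 h1).resolve_left ht.ne'
    have h1 : Submodule.span ℝ D = ⊥ := by
      rw [Submodule.span_eq_bot]; exact h0
    unfold coneDim at hpos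
    rw [h1] at hpos
    simp at hpos
  set T : Set ℝ := {t | x + t • b ∈ D} with hT
  have hTcl : IsClosed T := (isClosed_cone hD).preimage (by fun_prop : Continuous fun t : ℝ => x + t • b)
  have hTne : T.Nonempty := by
    have h1 := eventually_mem_ri (cc hD) hb
    have h2 : Filter.Tendsto (fun s : ℝ => b + s • x) (𝓝 0) (𝓝 b) := by
      have : Continuous (fun s : ℝ => b + s • x) := by fun_prop
      simpa using this.tendsto 0
    obtain ⟨s, hs, hs0⟩ := ((h2.eventually h1).filter_mono nhdsWithin_le_nhds |>.and
      (self_mem_nhdsWithin (s := Set.Ioi (0 : ℝ)))).exists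
    have hs0 : 0 < s := hs0
    have h3 := (hs (Submodule.add_mem _ (Submodule.subset_span hb.1) (Submodule.smul_mem _ _ hx))).1
    refine ⟨s⁻¹, ?_⟩
    have := (cc hD).smul_mem h3 (inv_pos.2 hs0).le
    rwa [smul_add, smul_smul, inv_mul_cancel₀ hs0.ne', one_smul, add_comm] at this
  have hTbdd : BddBelow T := by
    by_contra h
    have h1 : ∀ m : ℕ, (1 / ((m : ℝ) + 1)) • x - b ∈ D := by
      intro m
      have h2 : ∃ t ∈ T, t < -((m : ℝ) + 1) := by
        by_contra h3
        push Not at h3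
        exact h ⟨_, fun t ht => h3 t ht⟩
      obtain ⟨t, ht, htm⟩ := h2
      have h4 : x + (-((m : ℝ) + 1)) • b ∈ D := by
        have := (cc hD).add_mem ht ((cc hD).smul_mem hb.1 (show 0 ≤ -((m : ℝ) + 1) - t by linarith))
        rwa [show x + t • b + (-((m : ℝ) + 1) - t) • b = x + (-((m : ℝ) + 1)) • b by module] at this
      have hm : (0 : ℝ) < (m : ℝ) + 1 := by positivity
      have := (cc hD).smul_mem h4 (show 0 ≤ 1 / ((m : ℝ) + 1) by positivity)
      rwa [smul_add, smul_smul, mul_neg, one_div_mul_cancel hm.ne', neg_one_smul, ← sub_eq_add_neg] at this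
    have h2 : Filter.Tendsto (fun m : ℕ => (1 / ((m : ℝ) + 1)) • x - b) Filter.atTop (𝓝 ((0 : ℝ) • x - b)) :=
      (tendsto_one_div_add_atTop_nhds_zero_nat.smul_const x).sub_const b
    have h3 := (isClosed_cone hD).mem_of_tendsto h2 (Filter.Eventually.of_forall h1)
    exact hb0 (isPointed hD b hb.1 (by simpa using h3))
  have ht0 := hTcl.csInf_mem hTne hTbdd
  set t0 := sInf T
  have ht0' : x + t0 • b ∈ D := ht0
  have hnri : x + t0 • b ∉ ri D := by
    intro h
    obtain ⟨s, hs, hsD⟩ := h.2 b hb.1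
    have : t0 - s ∈ T := by
      change x + (t0 - s) • b ∈ D
      rwa [show x + (t0 - s) • b = x + t0 • b - s • b by module]
    linarith [csInf_le hTbdd this]
  obtain ⟨F, hF, hFD, hxF⟩ := exists_face_ri hD ht0'
  have hFne : F ≠ D := fun h => hnri (h ▸ hxF)
  obtain ⟨R, hR, hFR, hRD, hdim⟩ := exists_ridge hF hD hFD hFne
  exact ⟨R, hR, hRD, hdim, _, hFR hxF.1, -t0, by module⟩

/-- The facets of a cone are connected through codimension two faces. -/
theorem ridge_induction (hD : D ∈ Φ.cones) {P : Set (Fin d → ℝ) → Prop}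
    (hstep : ∀ R ∈ Φ.cones, ∀ R' ∈ Φ.cones, ∀ G ∈ Φ.cones, R ⊆ D → R' ⊆ D → G ⊆ R → G ⊆ R' →
      coneDim R + 1 = coneDim D → coneDim R' + 1 = coneDim D → coneDim G + 2 = coneDim D → P R → P R')
    {R₀ R₁ : Set (Fin d → ℝ)} (hR₀ : R₀ ∈ Φ.cones) (hR₁ : R₁ ∈ Φ.cones) (h₀ : R₀ ⊆ D) (h₁ : R₁ ⊆ D)
    (hd₀ : coneDim R₀ + 1 = coneDim D) (hd₁ : coneDim R₁ + 1 = coneDim D) (hP : P R₀) : P R₁ := by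
  have hb := bc_mem hD
  set b := bc D
  set W := Submodule.span ℝ D
  set Q : Set (Submodule ℝ (Fin d → ℝ)) :=
    (fun G => Submodule.span ℝ G ⊔ Submodule.span ℝ {b}) '' {G | G ∈ Φ.cones ∧ G ⊆ D ∧ coneDim G + 3 ≤ coneDim D}
    with hQdef
  have hQ : Q.Finite := (Φ.finite.subset fun G h => h.1).image _
  have hQdim : ∀ q ∈ Q, Module.finrank ℝ q + 2 ≤ coneDim D := by
    rintro _ ⟨G, ⟨-, -, hG⟩, rfl⟩
    have := finrank_sup_span_singleton_le (Submodule.span ℝ G) b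
    unfold coneDim at *
    change Module.finrank ℝ ↥(Submodule.span ℝ G ⊔ Submodule.span ℝ {b}) + 2 ≤ _
    omega
  have key : ∀ x, (∀ q ∈ Q, x ∉ q) → ∀ R ∈ Φ.cones, ∀ R' ∈ Φ.cones, R ⊆ D → R' ⊆ D →
      coneDim R + 1 = coneDim D → coneDim R' + 1 = coneDim D → x ∈ addLine R b → x ∈ addLine R' b →
      P R → P R' := by
    intro x hx R hR R' hR' hRD hR'D hd hd' h h' hPR
    by_cases hne : R = R'
    · exact hne ▸ hPR
    obtain ⟨r, hr, α, hxr⟩ := h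
    obtain ⟨r', hr', α', hxr'⟩ := h'
    have haux : ∀ {R r r' : _} {t : ℝ}, R ∈ Φ.cones → R ⊆ D → coneDim R + 1 = coneDim D → r ∈ R → r' ∈ D → 0 < t →
        r = r' + t • b → False := by
      intro R r r' t hR hRD hd hr hr' ht h
      refine notMem_of_ri hR hD hRD (by rintro rfl; omega) ?_ hr
      rw [h, add_comm]
      exact ri_add (cc hD) (ri_smul (cc hD) hb ht) hr'
    have hα : α = α' := by
      rcases lt_trichotomy α α' with h | h | h
      · exact (haux hR hRD hd hr (hR'D hr') (sub_pos.2 h) (by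
          rw [show r = x - α • b by rw [hxr]; abel, hxr']; module)).elim
      · exact h
      · exact (haux hR' hR'D hd' hr' (hRD hr) (sub_pos.2 h) (by
          rw [show r' = x - α' • b by rw [hxr']; abel, hxr]; module)).elim
    subst hα
    have hrr : r = r' := by
      have := hxr.symm.trans hxr'
      exact add_right_cancel this
    subst hrr
    have hG := inter_mem hR hR'
    have hGne : R ∩ R' ≠ R := fun h => hne (eq_of_span_le hR hR' (Set.inter_eq_left.1 h) (by omega))
    have hlt := coneDim_lt hG hR Set.inter_subset_left hGne
    by_cases hdG : coneDim (R ∩ R') + 2 = coneDim D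
    · exact hstep R hR R' hR' _ hG hRD hR'D Set.inter_subset_left Set.inter_subset_right hd hd' hdG hPR
    · refine (hx _ ⟨R ∩ R', ⟨hG, Set.inter_subset_left.trans hRD, by omega⟩, rfl⟩ ?_).elim
      rw [hxr]
      exact Submodule.add_mem_sup (Submodule.subset_span ⟨hr, hr'⟩)
        (Submodule.smul_mem _ _ (Submodule.mem_span_singleton_self b))
  set 𝒜 : Set (Set (Fin d → ℝ)) := {R | R ∈ Φ.cones ∧ R ⊆ D ∧ coneDim R + 1 = coneDim D ∧ P R}
  set A : Set (Fin d → ℝ) := {x | ∃ R ∈ 𝒜, x ∈ addLine R b}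
  have hnear : ∀ x : Fin d → ℝ, ∀ᶠ y in 𝓝 x, ∀ R ∈ Φ.cones, y ∈ addLine R b → x ∈ addLine R b := by
    intro x
    rw [Filter.eventually_all_finite Φ.finite]
    intro R hR
    by_cases h : x ∈ addLine R b
    · exact Filter.Eventually.of_forall fun _ _ => h
    · filter_upwards [(isClosed_addLine hR b).isOpen_compl.mem_nhds h] with y hy h' using (hy h').elim
  have hgen : ∀ {R}, R ∈ Φ.cones → coneDim R + 1 = coneDim D → ∃ a ∈ R, ∀ q ∈ Q, a ∉ q := by
    intro R hR hd
    have := frequently_avoid (Submodule.span ℝ R) hQ (fun q hq => not_le_of_finrank_lt (by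
      have := hQdim q hq
      unfold coneDim at *
      omega)) (Submodule.subset_span (bc_mem hR).1)
    obtain ⟨y, ⟨hy, hyQ⟩, hy'⟩ := (this.and_eventually (eventually_mem_ri (cc hR) (bc_mem hR))).exists
    exact ⟨y, (hy' hy).1, hyQ⟩
  obtain ⟨a, ha, haQ⟩ := hgen hR₀ hd₀
  obtain ⟨c, hc, hcQ⟩ := hgen hR₁ hd₁
  have hpos : 0 < coneDim D := by omega
  have hfr := frequently_mem_of_locally_constant W hQ (fun q hq v => not_le_of_finrank_lt (by
      have h1 := hQdim q hq
      have h2 := finrank_sup_span_singleton_le q v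
      change _ < coneDim D
      omega)) convex_univ (A := A) (by
    intro x _ hxW hxQ
    by_cases h : x ∈ A
    · left
      obtain ⟨R, ⟨hR, hRD, hd, hPR⟩, hxR⟩ := h
      filter_upwards [hnear x] with y hy hyW
      obtain ⟨R', hR', hR'D, hd', hyR'⟩ := exists_ridge_addLine hD hpos hb hyW
      exact ⟨R', ⟨hR', hR'D, hd', key x hxQ R hR R' hR' hRD hR'D hd hd' hxR (hy R' hR' hyR') hPR⟩, hyR'⟩
    · right
      filter_upwards [hnear x] with y hy _ hyA
      obtain ⟨R, hR, hyR⟩ := hyA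
      exact h ⟨R, hR, hy R hR.1 hyR⟩)
    (Set.mem_univ a) (Submodule.subset_span (h₀ ha)) haQ ⟨R₀, ⟨hR₀, h₀, hd₀, hP⟩, a, ha, 0, by simp⟩
    (b := c) Filter.univ_mem (Submodule.subset_span (h₁ hc))
  obtain ⟨y, ⟨-, R, hR, hyR⟩, hy⟩ := (hfr.and_eventually (hnear c)).exists
  exact key c hcQ R hR.1 R₁ hR₁ hR.2.1 h₁ hR.2.2.1 hd₁ (hy R hR.1 hyR) ⟨c, hc, 0, by simp⟩ hR.2.2.2
end Fan

end

section

namespace Fan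
variable {d : ℕ} {C D F G R R' : Set (Fin d → ℝ)} {x y : Fin d → ℝ} {Φ : Fan d}

lemma eps_mul_add_eps_mul (ε : IncidenceFunction Φ) (hG : G ∈ Φ.cones) (hR : R ∈ Φ.cones) (hR' : R' ∈ Φ.cones)
    (hD : D ∈ Φ.cones) (hGR : G ⊆ R) (hGR' : G ⊆ R') (hRD : R ⊆ D) (hR'D : R' ⊆ D)
    (hdG : coneDim G + 2 = coneDim D) (hdR : coneDim R + 1 = coneDim D)
    (hdR' : coneDim R' + 1 = coneDim D) (hne : R ≠ R') :
    ε.eps G R * ε.eps R D + ε.eps G R' * ε.eps R' D = 0 := by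
  have h := ε.cocycle G D hG hD (hGR.trans hRD) hdG
  rw [finsum_eq_finsetSum_of_support_subset (s := {R, R'})] at h
  · rwa [Finset.sum_pair hne] at h
  · intro S hS
    obtain ⟨-, h2, h3, -, h5⟩ := ε.supp _ _ (left_ne_zero_of_mul hS)
    obtain ⟨-, -, k3, -, k5⟩ := ε.supp _ _ (right_ne_zero_of_mul hS)
    have := eq_or_eq_of_ridges hG hR hR' h2 hD hGR hGR' h3 hRD hR'D k3 hdG hdR hdR' k5 hne
    simpa using this

/-- Complete flags of faces of a cone, with the vectors of interior points and the product of the incidence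
numbers along the flag. -/
inductive OFlag (ε : IncidenceFunction Φ) : (k : ℕ) → Set (Fin d → ℝ) → (Fin k → Fin d → ℝ) → ℤ → Prop
  | zero (v : Fin 0 → Fin d → ℝ) (h : ({0} : Set (Fin d → ℝ)) ∈ Φ.cones) : OFlag ε 0 {0} v 1
  | succ {k : ℕ} {R D : Set (Fin d → ℝ)} {v : Fin k → Fin d → ℝ} {s : ℤ} (hR : OFlag ε k R v s) (hD : D ∈ Φ.cones)
      (hRD : R ⊆ D) (hdim : coneDim R + 1 = coneDim D) :
      OFlag ε (k + 1) D (Fin.snoc v (bc D)) (s * ε.eps R D)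

lemma coneDim_zero : coneDim ({0} : Set (Fin d → ℝ)) = 0 := by
  unfold coneDim
  rw [Submodule.span_zero_singleton, finrank_bot]

lemma eq_zero_of_coneDim_eq_zero (hD : D ∈ Φ.cones) (h : coneDim D = 0) : D = {0} :=
  (eq_of_span_le (zero_cone_mem hD) hD (by simpa using (cc hD).zero_mem) (by rw [h]; exact Nat.zero_le _)).symm

namespace OFlag
variable {ε : IncidenceFunction Φ} {k : ℕ} {v v' : Fin k → Fin d → ℝ} {s s' : ℤ}

lemma mem_cones (h : OFlag ε k D v s) : D ∈ Φ.cones := by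
  cases h <;> assumption

lemma coneDim_eq (h : OFlag ε k D v s) : coneDim D = k := by
  induction h with
  | zero => exact coneDim_zero
  | succ hR hD hRD hdim ih => omega

lemma mem (h : OFlag ε k D v s) (i : Fin k) : v i ∈ D := by
  induction h with
  | zero => exact i.elim0
  | succ hR hD hRD hdim ih =>
    refine Fin.lastCases ?_ (fun j => ?_) i
    · rw [Fin.snoc_last]; exact (bc_mem hD).1
    · rw [Fin.snoc_castSucc]; exact hRD (ih j)

lemma linearIndependent (h : OFlag ε k D v s) : LinearIndependent ℝ v := by
  induction h with
  | zero => exact linearIndependent_empty_type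
  | succ hR hD hRD hdim ih =>
    rw [linearIndependent_finSnoc]
    refine ⟨ih, fun h => bc_notMem_span hR.mem_cones hD hRD (by rintro rfl; omega) (bc_mem hD) ?_⟩
    exact Submodule.span_mono (Set.range_subset_iff.2 hR.mem) h

lemma pm (h : OFlag ε k D v s) : s = 1 ∨ s = -1 := by
  induction h with
  | zero => simp
  | succ hR hD hRD hdim ih =>
    have := ε.pm _ _ hR.mem_cones hD hRD (by rintro rfl; omega) hdim
    rcases ih with rfl | rfl <;> rcases this with h | h <;> simp [h]

lemma exists_flag (ε : IncidenceFunction Φ) (hD : D ∈ Φ.cones) : ∃ v s, OFlag ε (coneDim D) D v s := by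
  obtain ⟨k, hk⟩ : ∃ k, coneDim D = k := ⟨_, rfl⟩
  induction k generalizing D with
  | zero =>
    rw [hk, eq_zero_of_coneDim_eq_zero hD hk]
    exact ⟨Fin.elim0, 1, zero _ (zero_cone_mem hD)⟩
  | succ k ih =>
    obtain ⟨R, hR, -, hRD, hdim⟩ := exists_ridge (zero_cone_mem hD) hD (by simpa using (cc hD).zero_mem)
      (by rintro rfl; rw [coneDim_zero] at hk; omega)
    obtain ⟨v, s, h⟩ := ih hR (by omega)
    rw [← hdim]
    exact ⟨_, _, succ h hD hRD hdim⟩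

/-- A function of vector tuples is negated by elementary changes with a negative coefficient. -/
def NegChange {k : ℕ} (W : Submodule ℝ (Fin d → ℝ)) (σ : (Fin k → Fin d → ℝ) → ℤ) : Prop :=
  ∀ (v : Fin k → Fin d → ℝ) (i : Fin k) (c : Fin k → ℝ), LinearIndependent ℝ v → (∀ j, v j ∈ W) → c i < 0 →
    σ (Function.update v i (∑ j, c j • v j)) = -σ v

/-- The sign of a flag times an alternating function of its vectors does not depend on the flag. -/
theorem mul_eq_mul (σ : (Fin k → Fin d → ℝ) → ℤ) (hσ : NegChange (Submodule.span ℝ D) σ)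
    (h : OFlag ε k D v s) (h' : OFlag ε k D v' s') : s * σ v = s' * σ v' := by
  induction k generalizing D s s' with
  | zero =>
    cases h
    cases h'
    rw [Subsingleton.elim v v']
  | succ k ih =>
    cases h with
    | @succ _ R₀ _ v₀ s₀ h₀ hD h₀D hd₀ =>
    cases h' with
    | @succ _ R₁ _ v₁ s₁ h₁ _ h₁D hd₁ =>
    have hkD : coneDim D = k + 1 := by rw [← hd₀, h₀.coneDim_eq]
    have hσ' : ∀ R ∈ Φ.cones, R ⊆ D → coneDim R + 1 = coneDim D →
        NegChange (Submodule.span ℝ R) fun v : Fin k → Fin d → ℝ => σ (Fin.snoc v (bc D)) := by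
      intro R hR hRD hd v i c hv hvR hc
      beta_reduce
      have hli : LinearIndependent ℝ (Fin.snoc v (bc D) : Fin (k + 1) → Fin d → ℝ) := by
        rw [linearIndependent_finSnoc]
        refine ⟨hv, fun h => bc_notMem_span hR hD hRD (by rintro rfl; omega) (bc_mem hD) ?_⟩
        exact Submodule.span_le.2 (Set.range_subset_iff.2 hvR) h
      have := hσ (Fin.snoc v (bc D)) i.castSucc (Fin.snoc c 0) hli (by
        intro j
        refine Fin.lastCases ?_ (fun j => ?_) j
        · rw [Fin.snoc_last]; exact Submodule.subset_span (bc_mem hD).1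
        · rw [Fin.snoc_castSucc]; exact Submodule.span_mono hRD (hvR j)) (by simpa using hc)
      rw [← this]
      congr 1
      simp [Fin.sum_univ_castSucc, ← Fin.snoc_update]
    have key : ∀ {v s}, OFlag ε k R₁ v s → s * ε.eps R₁ D * σ (Fin.snoc v (bc D)) =
        s₀ * ε.eps R₀ D * σ (Fin.snoc v₀ (bc D)) := by
      refine ridge_induction (P := fun R => ∀ {v s}, OFlag ε k R v s → s * ε.eps R D * σ (Fin.snoc v (bc D)) =
        s₀ * ε.eps R₀ D * σ (Fin.snoc v₀ (bc D))) hD ?_ h₀.mem_cones h₁.mem_cones h₀D h₁D hd₀ hd₁ ?_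
      · intro R hR R' hR' G hG hRD hR'D hGR hGR' hd hd' hdG hP w t hw
        by_cases hne : R = R'
        · subst hne; exact hP hw
        obtain ⟨m, rfl⟩ : ∃ m, k = m + 1 := ⟨k - 1, by omega⟩
        obtain ⟨g, u, hg⟩ := exists_flag ε hG
        obtain rfl : coneDim G = m := by omega
        have f1 := hP (succ hg hR hGR (by omega))
        have f2 := ih _ (hσ' R' hR' hR'D hd') hw (succ hg hR' hGR' (by omega))
        beta_reduce at f2
        obtain ⟨α, β, hα, hαβ⟩ := exists_combination_of_ridges hG hR hR' hD hGR hGR' hRD hR'D hdG hd hd' hne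
        have hspan : Submodule.span ℝ (Set.range g) = Submodule.span ℝ G := by
          apply Submodule.eq_of_le_of_finrank_le (Submodule.span_mono (Set.range_subset_iff.2 hg.mem))
          rw [finrank_span_eq_card hg.linearIndependent, Fintype.card_fin]
          exact le_rfl
        rw [← hspan, Submodule.mem_span_range_iff_exists_fun] at hαβ
        obtain ⟨c, hc⟩ := hαβ
        have hfl := succ (succ hg hR hGR (by omega)) hD hRD hd
        have f3 := hσ (Fin.snoc (Fin.snoc g (bc R)) (bc D)) (Fin.last _).castSucc
          (Fin.snoc (Fin.snoc c α) β) hfl.linearIndependent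
          (fun j => Submodule.subset_span (hfl.mem j)) (by simpa using hα)
        have f4 : Function.update (Fin.snoc (Fin.snoc g (bc R) : Fin (coneDim G + 1) → Fin d → ℝ) (bc D) :
            Fin (coneDim G + 1 + 1) → Fin d → ℝ) (Fin.last _).castSucc
            (∑ j, (Fin.snoc (Fin.snoc c α : Fin (coneDim G + 1) → ℝ) β : Fin (coneDim G + 1 + 1) → ℝ) j •
              (Fin.snoc (Fin.snoc g (bc R) : Fin (coneDim G + 1) → Fin d → ℝ) (bc D) :
            Fin (coneDim G + 1 + 1) → Fin d → ℝ) j) = Fin.snoc (Fin.snoc g (bc R')) (bc D) := by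
          rw [← Fin.snoc_update, Fin.update_snoc_last]
          congr 2
          simp only [Fin.sum_univ_castSucc, Fin.snoc_castSucc, Fin.snoc_last]
          rw [hc]
          module
        rw [f4] at f3
        rw [f3] at f2
        have f5 := eps_mul_add_eps_mul ε hG hR hR' hD hGR hGR' hRD hR'D hdG hd hd' hne
        rw [← f1]
        linear_combination (ε.eps R' D) * f2 - u * σ (Fin.snoc (Fin.snoc g (bc R)) (bc D)) * f5
      · intro w t hw
        have := ih _ (hσ' R₀ h₀.mem_cones h₀D hd₀) hw h₀
        beta_reduce at this
        linear_combination (ε.eps R₀ D) * this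
    exact (key h₁).symm
end OFlag
end Fan

end

section

/-- A chart of the support of a fan near `p`, with values in a closed half space. -/
structure HalfChart {d : ℕ} (Φ Φ' : Fan d) (m : ℕ) (p : Fin d → ℝ) where
  f : (Fin d → ℝ) → Euc (m + 1)
  g : Euc (m + 1) → Fin d → ℝ
  N : Set (Fin d → ℝ)
  O : Set (Euc (m + 1))
  isOpen_N : IsOpen N
  isOpen_O : IsOpen O
  mem_N : p ∈ N
  maps_f : ∀ x ∈ N, x ∈ ⋃₀ Φ.cones → f x ∈ O ∧ 0 ≤ f x 0
  maps_g : ∀ y ∈ O, 0 ≤ y 0 → g y ∈ N ∧ g y ∈ ⋃₀ Φ.cones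
  gf : ∀ x ∈ N, x ∈ ⋃₀ Φ.cones → g (f x) = x
  fg : ∀ y ∈ O, 0 ≤ y 0 → f (g y) = y
  cont_f : ContinuousOn f (N ∩ ⋃₀ Φ.cones)
  cont_g : ContinuousOn g (O ∩ {y | 0 ≤ y 0})
  boundary : ∀ x ∈ N, x ∈ ⋃₀ Φ.cones → (x ∈ ⋃₀ Φ'.cones ↔ f x 0 = 0)

/-- The Euclidean norm. -/
def nrm {d : ℕ} (x : Fin d → ℝ) : ℝ := √(∑ i, x i ^ 2)

lemma continuous_nrm {d : ℕ} : Continuous (nrm (d := d)) := by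
  unfold nrm
  fun_prop

lemma nrm_pos {d : ℕ} {x : Fin d → ℝ} (h : x ≠ 0) : 0 < nrm x := by
  obtain ⟨i, hi⟩ := Function.ne_iff.1 h
  apply Real.sqrt_pos.2
  exact Finset.sum_pos' (fun i _ => sq_nonneg _) ⟨i, Finset.mem_univ i, by
    have : x i ≠ 0 := hi
    positivity⟩

lemma nrm_smul {d : ℕ} (x : Fin d → ℝ) {t : ℝ} (ht : 0 ≤ t) : nrm (t • x) = t * nrm x := by
  unfold nrm
  simp only [Pi.smul_apply, smul_eq_mul, mul_pow, ← Finset.mul_sum]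
  rw [Real.sqrt_mul (sq_nonneg t), Real.sqrt_sq ht]

lemma mem_unitSphere_iff {d : ℕ} {x : Fin d → ℝ} : x ∈ unitSphere d ↔ nrm x = 1 := by
  unfold nrm unitSphere
  rw [Real.sqrt_eq_one]
  rfl

namespace Fan
variable {d : ℕ} {Φ Φ' : Fan d} {m : ℕ}

lemma smul_mem_support {x : Fin d → ℝ} (hx : x ∈ ⋃₀ Φ.cones) {t : ℝ} (ht : 0 ≤ t) : t • x ∈ ⋃₀ Φ.cones := by
  obtain ⟨D, hD, hxD⟩ := hx
  exact ⟨D, hD, (cc hD).smul_mem hxD ht⟩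

lemma smul_mem_support_iff {x : Fin d → ℝ} {t : ℝ} (ht : 0 < t) : t • x ∈ ⋃₀ Φ.cones ↔ x ∈ ⋃₀ Φ.cones := by
  refine ⟨fun h => ?_, fun h => smul_mem_support h ht.le⟩
  have := smul_mem_support h (inv_pos.2 ht).le
  rwa [smul_smul, inv_mul_cancel₀ ht.ne', one_smul] at this

theorem exists_halfChart (hm : 0 < m)
    (hmfd : IsManifoldWithBoundary m ↥(GammaSet Φ.cones)
      {x : ↥(GammaSet Φ.cones) | (x : Fin d → ℝ) ∈ ⋃₀ Φ'.cones})
    {p : Fin d → ℝ} (hp : p ∈ ⋃₀ Φ.cones) (hp0 : p ≠ 0) : Nonempty (HalfChart Φ Φ' m p) := by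
  have hmem : ∀ x : Fin d → ℝ, x ≠ 0 → x ∈ ⋃₀ Φ.cones → (nrm x)⁻¹ • x ∈ GammaSet Φ.cones := by
    intro x hx0 hx
    refine ⟨smul_mem_support hx (inv_pos.2 (nrm_pos hx0)).le, ?_⟩
    rw [mem_unitSphere_iff, nrm_smul _ (inv_pos.2 (nrm_pos hx0)).le, inv_mul_cancel₀ (nrm_pos hx0).ne']
  obtain ⟨U, V, hU, hV, hpU, φ, hφ⟩ := hmfd ⟨_, hmem p hp0 hp⟩
  obtain ⟨U', hU', rfl⟩ := isOpen_induced_iff.1 hU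
  obtain ⟨V', hV', rfl⟩ := isOpen_induced_iff.1 hV
  set N : Set (Fin d → ℝ) := {x | x ≠ 0 ∧ (nrm x)⁻¹ • x ∈ U'} with hN
  have hcn : ContinuousOn (fun x : Fin d → ℝ => (nrm x)⁻¹ • x) {x | x ≠ 0} :=
    ContinuousOn.smul (f := fun x => (nrm x)⁻¹) (g := fun x => x)
      (continuous_nrm.continuousOn.inv₀ fun x hx => (nrm_pos hx).ne') continuousOn_id
  set F : (Fin d → ℝ) → Fin m → ℝ := fun x => if hx : x ∈ N ∩ ⋃₀ Φ.cones then
    ((φ ⟨⟨(nrm x)⁻¹ • x, hmem x hx.1.1 hx.2⟩, hx.1.2⟩ : ↥(halfSpaceSet m)) : Fin m → ℝ) else 0 with hF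
  set H : Set (Fin m → ℝ) := {w | w ∈ V' ∧ w ∈ halfSpaceSet m} with hH
  set G : (Fin m → ℝ) → Fin d → ℝ := fun w => if hw : w ∈ H then
    ((φ.symm ⟨⟨w, hw.2⟩, hw.1⟩ : ↥(GammaSet Φ.cones)) : Fin d → ℝ) else 0 with hG
  have hFc : ContinuousOn F (N ∩ ⋃₀ Φ.cones) := by
    rw [continuousOn_iff_continuous_domRestrict]
    have : (N ∩ ⋃₀ Φ.cones).domRestrict F = fun x : ↥(N ∩ ⋃₀ Φ.cones) =>
        ((φ ⟨⟨(nrm x.1)⁻¹ • x.1, hmem x.1 x.2.1.1 x.2.2⟩, x.2.1.2⟩ : ↥(halfSpaceSet m)) : Fin m → ℝ) := by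
      funext x
      simp only [Set.domRestrict_apply, hF]
      rw [dif_pos x.2]
    rw [this]
    refine continuous_subtype_val.comp (continuous_subtype_val.comp (φ.continuous.comp
      (Continuous.subtype_mk (Continuous.subtype_mk ?_ _) _)))
    have := continuousOn_iff_continuous_domRestrict.1 (hcn.mono fun x (hx : x ∈ N ∩ ⋃₀ Φ.cones) => hx.1.1)
    exact this
  have hGc : ContinuousOn G H := by
    rw [continuousOn_iff_continuous_domRestrict]
    have : H.domRestrict G = fun w : ↥H => ((φ.symm ⟨⟨w.1, w.2.2⟩, w.2.1⟩ : ↥(GammaSet Φ.cones)) : Fin d → ℝ) := by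
      funext x
      simp only [Set.domRestrict_apply, hG]
      rw [dif_pos x.2]
    rw [this]
    exact continuous_subtype_val.comp (continuous_subtype_val.comp (φ.symm.continuous.comp
      (Continuous.subtype_mk (Continuous.subtype_mk continuous_subtype_val _) _)))
  have hFH : ∀ x ∈ N ∩ ⋃₀ Φ.cones, F x ∈ H := by
    intro x hx
    simp only [hF]
    rw [dif_pos hx]
    exact ⟨(φ _).2, (φ _).1.2⟩
  have hGX : ∀ w ∈ H, G w ∈ GammaSet Φ.cones ∧ G w ∈ U' := by
    intro w hw
    simp only [hG]
    rw [dif_pos hw]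
    exact ⟨(φ.symm _).1.2, (φ.symm _).2⟩
  have hGF : ∀ x ∈ N ∩ ⋃₀ Φ.cones, G (F x) = (nrm x)⁻¹ • x := by
    intro x hx
    have h1 := hFH x hx
    simp only [hG]
    rw [dif_pos h1]
    have h2 : (⟨⟨F x, h1.2⟩, h1.1⟩ : ↥(Subtype.val ⁻¹' V' : Set ↥(halfSpaceSet m))) =
        φ ⟨⟨(nrm x)⁻¹ • x, hmem x hx.1.1 hx.2⟩, hx.1.2⟩ := by
      apply Subtype.ext; apply Subtype.ext
      simp only [hF]
      rw [dif_pos hx]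
    rw [h2, φ.symm_apply_apply]
  have hGne : ∀ w ∈ H, nrm (G w) = 1 := fun w hw => mem_unitSphere_iff.1 (hGX w hw).1.2
  have hne0 : ∀ x : Fin d → ℝ, nrm x = 1 → x ≠ 0 := by
    rintro x hx rfl
    simp [nrm] at hx
  have hFG : ∀ w ∈ H, ∀ t : ℝ, 0 < t → t • G w ∈ N ∩ ⋃₀ Φ.cones ∧ F (t • G w) = w ∧ nrm (t • G w) = t := by
    intro w hw t ht
    have h1 := hGne w hw
    have h2 : nrm (t • G w) = t := by rw [nrm_smul _ ht.le, h1, mul_one]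
    have h3 : (nrm (t • G w))⁻¹ • t • G w = G w := by
      rw [h2, smul_smul, inv_mul_cancel₀ ht.ne', one_smul]
    have h4 : t • G w ∈ N ∩ ⋃₀ Φ.cones :=
      ⟨⟨smul_ne_zero ht.ne' (hne0 _ h1), by rw [h3]; exact (hGX w hw).2⟩, smul_mem_support (hGX w hw).1.1 ht.le⟩
    refine ⟨h4, ?_, h2⟩
    have h5 : F (t • G w) = ((φ (φ.symm ⟨⟨w, hw.2⟩, hw.1⟩) : ↥(halfSpaceSet m)) : Fin m → ℝ) := by
      simp only [hF]
      rw [dif_pos h4]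
      congr 3
      apply Subtype.ext; apply Subtype.ext
      change (nrm (t • G w))⁻¹ • t • G w = _
      rw [h3]
      simp only [hG]
      rw [dif_pos hw]
    rw [h5, φ.apply_symm_apply]
  have h0 : ∀ (w : Fin m → ℝ) (t : ℝ), (Fin.snoc w t : Fin (m + 1) → ℝ) 0 = w ⟨0, hm⟩ := fun w t =>
    Fin.snoc_castSucc (α := fun _ => ℝ) t w ⟨0, hm⟩
  have hinit : Continuous fun y : Euc (m + 1) => (fun i : Fin m => y i.castSucc) := by fun_prop
  refine ⟨{ f := fun x => WithLp.toLp 2 (Fin.snoc (F x) (nrm x) : Fin (m + 1) → ℝ)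
            g := fun y => y (Fin.last m) • G fun i => y i.castSucc
            N := N
            O := {y | (fun i : Fin m => y i.castSucc) ∈ V' ∧ 0 < y (Fin.last m)}
            isOpen_N := ?_
            isOpen_O := ?_
            mem_N := ⟨hp0, hpU⟩
            maps_f := ?_
            maps_g := ?_
            gf := ?_
            fg := ?_
            cont_f := ?_
            cont_g := ?_
            boundary := ?_ }⟩
  · exact hcn.isOpen_inter_preimage isOpen_ne hU'
  · exact (hV'.preimage hinit).inter (isOpen_lt continuous_const
      (by fun_prop : Continuous fun y : Euc (m + 1) => y (Fin.last m)))
  · intro x hxN hx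
    have h1 := hFH x ⟨hxN, hx⟩
    refine ⟨⟨?_, ?_⟩, ?_⟩
    · simpa using h1.1
    · simpa using nrm_pos hxN.1
    · change 0 ≤ (Fin.snoc (F x) (nrm x) : Fin (m + 1) → ℝ) 0
      rw [h0]
      exact h1.2 hm
  · intro y hy hy0
    exact (hFG _ ⟨hy.1, fun h => hy0⟩ _ hy.2).1
  · intro x hxN hx
    simp only [Fin.snoc_last, Fin.snoc_castSucc]
    rw [hGF x ⟨hxN, hx⟩, smul_smul, mul_inv_cancel₀ (nrm_pos hxN.1).ne', one_smul]
  · intro y hy hy0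
    obtain ⟨-, h2, h3⟩ := hFG _ ⟨hy.1, fun h => hy0⟩ _ hy.2
    rw [h2, h3]
    ext i
    refine Fin.lastCases ?_ (fun j => ?_) i <;> simp
  · refine (PiLp.continuous_toLp 2 _).comp_continuousOn ?_
    rw [continuousOn_pi]
    intro i
    refine Fin.lastCases ?_ (fun j => ?_) i
    · simpa using continuous_nrm.continuousOn
    · simpa using (continuousOn_pi.1 hFc j)
  · refine ContinuousOn.smul (f := fun y : Euc (m + 1) => y (Fin.last m)) (g := fun y => G fun i => y i.castSucc)
      (by fun_prop) ?_
    exact hGc.comp hinit.continuousOn fun y hy => ⟨hy.1.1, fun h => hy.2⟩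
  · intro x hxN hx
    have h1 := hφ ⟨⟨(nrm x)⁻¹ • x, hmem x hxN.1 hx⟩, hxN.2⟩
    have h2 : (x ∈ ⋃₀ Φ'.cones ↔ (nrm x)⁻¹ • x ∈ ⋃₀ Φ'.cones) :=
      (smul_mem_support_iff (inv_pos.2 (nrm_pos hxN.1))).symm
    rw [h2]
    refine h1.trans ?_
    have h3 : F x = ((φ ⟨⟨(nrm x)⁻¹ • x, hmem x hxN.1 hx⟩, hxN.2⟩ : ↥(halfSpaceSet m)) : Fin m → ℝ) := by
      simp only [hF]
      rw [dif_pos ⟨hxN, hx⟩]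
    rw [← h3]
    change _ ↔ (Fin.snoc (F x) (nrm x) : Fin (m + 1) → ℝ) 0 = 0
    rw [h0]
    exact ⟨fun ⟨_, h⟩ => h, fun h => ⟨hm, h⟩⟩
end Fan

end

section

section generic
variable {V : Type*} [NormedAddCommGroup V] [NormedSpace ℝ V]

lemma tendsto_add_smul (p b : V) : Filter.Tendsto (fun t : ℝ => p + t • b) (𝓝 0) (𝓝 p) := by
  have : Continuous (fun t : ℝ => p + t • b) := by fun_prop
  simpa using this.tendsto 0

lemma exists_pos_of_eventually {P : V → Prop} {p : V} (h : ∀ᶠ x in 𝓝 p, P x) (b : V) : ∃ t : ℝ, 0 < t ∧ P (p + t • b) := by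
  obtain ⟨t, ht, h0⟩ := (((tendsto_add_smul p b).eventually h).filter_mono nhdsWithin_le_nhds |>.and
      (self_mem_nhdsWithin (s := Set.Ioi (0 : ℝ)))).exists
  exact ⟨t, h0, ht⟩

variable [FiniteDimensional ℝ V]

lemma exists_linearMap_injOn {n : ℕ} (W : Submodule ℝ V) (h : Module.finrank ℝ W ≤ n) :
    ∃ T : V →ₗ[ℝ] Euc n, Set.InjOn T W := by
  set ι : W →ₗ[ℝ] Euc n := (WithLp.linearEquiv 2 ℝ (Fin n → ℝ)).symm.toLinearMap ∘ₗ
    Function.ExtendByZero.linearMap ℝ (Fin.castLE h) ∘ₗ (Module.finBasis ℝ W).equivFun.toLinearMap with hι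
  have hinj : Function.Injective ι := by
    intro x y hxy
    have h1 := (WithLp.linearEquiv 2 ℝ (Fin n → ℝ)).symm.injective hxy
    have h2 : Function.extend (Fin.castLE h) ((Module.finBasis ℝ W).equivFun x) 0 =
      Function.extend (Fin.castLE h) ((Module.finBasis ℝ W).equivFun y) 0 := h1
    exact (Module.finBasis ℝ W).equivFun.injective (Function.extend_injective (Fin.castLE_injective h) _ h2)
  obtain ⟨T, hT⟩ := LinearMap.exists_extend ι
  refine ⟨T, fun x hx y hy hxy => ?_⟩
  have h1 : ∀ z : W, T z = ι z := fun z => LinearMap.congr_fun hT z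
  have := hinj ((h1 ⟨x, hx⟩).symm.trans (hxy.trans (h1 ⟨y, hy⟩)))
  simpa using this

lemma false_of_injOn_of_finrank_lt {n : ℕ} {g : Euc n → V} {U : Set (Euc n)} {x : Euc n} (hU : IsOpen U) (hx : x ∈ U)
    (hg : ContinuousOn g U) (hinj : Set.InjOn g U) {W : Submodule ℝ V} (hW : ∀ y ∈ U, g y ∈ W)
    (hn : Module.finrank ℝ W < n) : False := by
  obtain ⟨T, hT⟩ := exists_linearMap_injOn W hn.le
  have h1 := image_mem_nhds_of_injOn (fun y => T (g y)) U x (hU.mem_nhds hx)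
    ((LinearMap.continuous_of_finiteDimensional T).comp_continuousOn hg)
    (fun a ha b hb hab => hinj ha hb (hT (hW a ha) (hW b hb) hab))
  have h2 : (W.map T : Set (Euc n)) ∈ 𝓝 (T (g x)) :=
    Filter.mem_of_superset h1 (by rintro _ ⟨y, hy, rfl⟩; exact ⟨_, hW y hy, rfl⟩)
  have h3 := Submodule.eq_top_of_nonempty_interior' (W.map T) ⟨_, mem_interior_iff_mem_nhds.2 h2⟩
  have h4 := Submodule.finrank_map_le T W
  rw [h3, finrank_top, finrank_euclideanSpace, Fintype.card_fin] at h4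
  omega

lemma eventually_mem_image_of_injOn {n : ℕ} {g : Euc n → V} {U : Set (Euc n)} {x : Euc n} (hU : IsOpen U) (hx : x ∈ U)
    (hg : ContinuousOn g U) (hinj : Set.InjOn g U) {W : Submodule ℝ V} (hW : ∀ y ∈ U, g y ∈ W)
    (hn : Module.finrank ℝ W ≤ n) : ∀ᶠ z in 𝓝 (g x), z ∈ W → z ∈ g '' U := by
  obtain ⟨T, hT⟩ := exists_linearMap_injOn W hn
  have h1 := image_mem_nhds_of_injOn (fun y => T (g y)) U x (hU.mem_nhds hx)
    ((LinearMap.continuous_of_finiteDimensional T).comp_continuousOn hg)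
    (fun a ha b hb hab => hinj ha hb (hT (hW a ha) (hW b hb) hab))
  have h2 := (LinearMap.continuous_of_finiteDimensional T).tendsto (g x) h1
  filter_upwards [h2] with z hz hzW
  obtain ⟨y, hy, hyz⟩ := hz
  exact ⟨y, hy, hT (hW y hy) hzW hyz⟩

end generic

/-- The support of `Φ` is, near the nonzero points, a manifold of dimension `m + 1 = dim Φ` with boundary the support
of the subfan `Φ'`. -/
structure IsManifoldFan {d : ℕ} (Φ Φ' : Fan d) (m : ℕ) : Prop where
  sub : Φ'.cones ⊆ Φ.cones
  pos : 0 < m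
  dim : Φ.dim = m + 1
  chart : ∀ p ∈ ⋃₀ Φ.cones, p ≠ 0 → Nonempty (HalfChart Φ Φ' m p)
  ne : ∃ p ∈ ⋃₀ Φ'.cones, p ≠ 0

namespace HalfChart
variable {d : ℕ} {Φ Φ' : Fan d} {m : ℕ} {p : Fin d → ℝ} (c : HalfChart Φ Φ' m p)

lemma exists_ball (hp : p ∈ ⋃₀ Φ.cones) {P : (Fin d → ℝ) → Prop} (hP : ∀ᶠ x in 𝓝 p, P x) :
    ∃ r > 0, ∀ y ∈ Metric.ball (c.f p) r, 0 ≤ y 0 → y ∈ c.O ∧ P (c.g y) := by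
  obtain ⟨h1, h2⟩ := c.maps_f p c.mem_N hp
  have h3 := c.cont_g _ ⟨h1, h2⟩
  rw [ContinuousWithinAt, c.gf p c.mem_N hp] at h3
  have h4 := h3.eventually hP
  rw [eventually_nhdsWithin_iff] at h4
  obtain ⟨r, hr, h⟩ := Metric.eventually_nhds_iff_ball.1 (h4.and (c.isOpen_O.mem_nhds h1))
  exact ⟨r, hr, fun y hy h0 => ⟨(h y hy).2, (h y hy).1 ⟨(h y hy).2, h0⟩⟩⟩

lemma exists_ball_of_pos (hp : p ∈ ⋃₀ Φ.cones) (h0 : 0 < c.f p 0) {P : (Fin d → ℝ) → Prop} (hP : ∀ᶠ x in 𝓝 p, P x) :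
    ∃ r > 0, ∀ y ∈ Metric.ball (c.f p) r, 0 < y 0 ∧ y ∈ c.O ∧ P (c.g y) := by
  obtain ⟨r, hr, h⟩ := c.exists_ball hp hP
  have h1 : ∀ᶠ y : Euc (m + 1) in 𝓝 (c.f p), 0 < y 0 :=
    (isOpen_lt continuous_const (by fun_prop : Continuous fun y : Euc (m + 1) => y 0)).mem_nhds h0
  obtain ⟨s, hs, h2⟩ := Metric.eventually_nhds_iff_ball.1 h1
  refine ⟨min r s, lt_min hr hs, fun y hy => ?_⟩
  have h3 := h2 y (Metric.ball_subset_ball (min_le_right _ _) hy)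
  exact ⟨h3, h y (Metric.ball_subset_ball (min_le_left _ _) hy) h3.le⟩

lemma eventually_f (hp : p ∈ ⋃₀ Φ.cones) {P : Euc (m + 1) → Prop} (hP : ∀ᶠ y in 𝓝 (c.f p), P y) :
    ∀ᶠ x in 𝓝 p, x ∈ c.N ∧ (x ∈ ⋃₀ Φ.cones → P (c.f x)) := by
  have h1 := (c.cont_f p ⟨c.mem_N, hp⟩).eventually hP
  rw [eventually_nhdsWithin_iff] at h1
  filter_upwards [h1, c.isOpen_N.mem_nhds c.mem_N] with x hx hxN
  exact ⟨hxN, fun h => hx ⟨hxN, h⟩⟩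

lemma injOn_g : Set.InjOn c.g (c.O ∩ {y | 0 ≤ y 0}) := fun x hx y hy h => by
  rw [← c.fg x hx.1 hx.2, h, c.fg y hy.1 hy.2]

lemma injOn_f : Set.InjOn c.f (c.N ∩ ⋃₀ Φ.cones) := fun x hx y hy h => by
  rw [← c.gf x hx.1 hx.2, h, c.gf y hy.1 hy.2]

lemma pos_iff {x : Fin d → ℝ} (hx : x ∈ c.N) (h : x ∈ ⋃₀ Φ.cones) : 0 < c.f x 0 ↔ x ∉ ⋃₀ Φ'.cones := by
  rw [c.boundary x hx h]
  exact ⟨fun h => h.ne', fun h' => lt_of_le_of_ne (c.maps_f x hx h).2 (Ne.symm h')⟩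
end HalfChart

namespace IsManifoldFan
open Fan
variable {d : ℕ} {Φ Φ' : Fan d} {m : ℕ} {C D R : Set (Fin d → ℝ)} {x : Fin d → ℝ}

lemma mem_support_iff (M : IsManifoldFan Φ Φ' m) (hC : C ∈ Φ.cones) (hx : x ∈ ri C) : x ∈ ⋃₀ Φ'.cones ↔ C ∈ Φ'.cones := by
  refine ⟨?_, fun h => ⟨C, h, hx.1⟩⟩
  rintro ⟨D, hD, hxD⟩
  exact Φ'.faces_mem D hD C (isFaceOf hC (M.sub hD) (subset_of_ri hC (M.sub hD) hx hxD))

lemma mem_of_subset (M : IsManifoldFan Φ Φ' m) (hC : C ∈ Φ.cones) (hD : D ∈ Φ'.cones) (h : C ⊆ D) : C ∈ Φ'.cones :=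
  Φ'.faces_mem D hD C (isFaceOf hC (M.sub hD) h)

lemma zero_mem (M : IsManifoldFan Φ Φ' m) : ({0} : Set (Fin d → ℝ)) ∈ Φ'.cones := by
  obtain ⟨p, ⟨D, hD, -⟩, -⟩ := M.ne
  exact zero_cone_mem hD

lemma ne_zero (hC : C ∈ Φ.cones) (hne : C ≠ {0}) (hx : x ∈ ri C) : x ≠ 0 := by
  rintro rfl
  exact hne ((subset_of_ri hC (zero_cone_mem hC) hx (by simp)).antisymm (by simpa using (cc hC).zero_mem))

lemma coneDim_le (M : IsManifoldFan Φ Φ' m) (hC : C ∈ Φ.cones) : coneDim C ≤ m + 1 := M.dim ▸ coneDim_le_dim hC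

/-- A cone outside of the boundary is contained in a cone of top dimension. -/
lemma exists_top (M : IsManifoldFan Φ Φ' m) (hC : C ∈ Φ.cones) (hC' : C ∉ Φ'.cones) :
    ∃ D ∈ Φ.cones, C ⊆ D ∧ coneDim D = m + 1 := by
  obtain ⟨D, ⟨hD, hCD⟩, hmax⟩ :=
    (Φ.finite.subset (t := {D | D ∈ Φ.cones ∧ C ⊆ D}) fun _ h => h.1).exists_maximal ⟨C, hC, subset_rfl⟩
  refine ⟨D, hD, hCD, ?_⟩
  by_contra hk
  have hlt : coneDim D < m + 1 := lt_of_le_of_ne (M.coneDim_le hD) hk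
  have hD' : D ∉ Φ'.cones := fun h => hC' (M.mem_of_subset hC h hCD)
  have hb := bc_mem hD
  have hsupp : bc D ∈ ⋃₀ Φ.cones := ⟨D, hD, hb.1⟩
  obtain ⟨c⟩ := M.chart _ hsupp (ne_zero hD (fun h => hD' (h ▸ M.zero_mem)) hb)
  have h0 : 0 < c.f (bc D) 0 := (c.pos_iff c.mem_N hsupp).2 fun h => hD' ((M.mem_support_iff hD hb).1 h)
  obtain ⟨r, hr, h⟩ := c.exists_ball_of_pos hsupp h0 (eventually_mem_of_mem Φ (bc D))
  have hsub : Metric.ball (c.f (bc D)) r ⊆ c.O ∩ {y | 0 ≤ y 0} := fun y hy => ⟨(h y hy).2.1, (h y hy).1.le⟩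
  refine false_of_injOn_of_finrank_lt Metric.isOpen_ball (Metric.mem_ball_self hr) (c.cont_g.mono hsub)
    (c.injOn_g.mono hsub) (W := Submodule.span ℝ D) (fun y hy => ?_) hlt
  obtain ⟨h1, h2, h3⟩ := h y hy
  obtain ⟨E, hE, hyE⟩ := (c.maps_g y h2 h1.le).2
  have hDE := subset_of_ri hD hE hb (h3 E hE hyE)
  exact Submodule.subset_span (hmax ⟨hE, hCD.trans hDE⟩ hDE hyE)

end IsManifoldFan

end

section

section comb
variable {d k : ℕ}

/-- The linear map sending the coordinate vectors to the given vectors. -/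
def comb (v : Fin k → Fin d → ℝ) : Euc k →ₗ[ℝ] (Fin d → ℝ) where
  toFun x := ∑ i, x i • v i
  map_add' x y := by simp [add_smul, Finset.sum_add_distrib]
  map_smul' t x := by simp [mul_smul, Finset.smul_sum]

lemma comb_apply (v : Fin k → Fin d → ℝ) (x : Euc k) : comb v x = ∑ i, x i • v i := rfl

lemma continuous_comb (v : Fin k → Fin d → ℝ) : Continuous (comb v) := LinearMap.continuous_of_finiteDimensional _

lemma comb_injective {v : Fin k → Fin d → ℝ} (hv : LinearIndependent ℝ v) : Function.Injective (comb v) := by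
  intro x y hxy
  have h : ∑ i, (x i - y i) • v i = 0 := by
    simp only [sub_smul, Finset.sum_sub_distrib]
    exact sub_eq_zero.2 hxy
  ext i
  exact sub_eq_zero.1 (Fintype.linearIndependent_iff.1 hv _ h i)

lemma comb_mem_span {v : Fin k → Fin d → ℝ} {W : Submodule ℝ (Fin d → ℝ)} (hv : ∀ i, v i ∈ W) (x : Euc k) :
    comb v x ∈ W := by
  rw [comb_apply]
  exact Submodule.sum_mem _ fun i _ => W.smul_mem _ (hv i)

lemma exists_comb_eq {v : Fin k → Fin d → ℝ} (hv : LinearIndependent ℝ v) {C : Set (Fin d → ℝ)}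
    (hvC : ∀ i, v i ∈ Submodule.span ℝ C) (hk : coneDim C = k) {q : Fin d → ℝ} (hq : q ∈ Submodule.span ℝ C) :
    ∃ x, comb v x = q := by
  have h1 : Submodule.span ℝ (Set.range v) = Submodule.span ℝ C := by
    refine Submodule.eq_of_le_of_finrank_eq (Submodule.span_le.2 (by rintro _ ⟨i, rfl⟩; exact hvC i)) ?_
    rw [finrank_span_eq_card hv, Fintype.card_fin]
    exact hk.symm
  rw [← h1] at hq
  obtain ⟨c, hc⟩ := (Submodule.mem_span_range_iff_exists_fun ℝ).1 hq
  exact ⟨WithLp.toLp 2 c, hc⟩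

/-- The piecewise linear map given by two systems of vectors which differ in the last vector. -/
def foldMap (v : Fin k → Fin d → ℝ) (a b : Fin d → ℝ) (x : Euc (k + 1)) : Fin d → ℝ :=
  ∑ i : Fin k, x i.castSucc • v i + max (x (Fin.last k)) 0 • a + max (-x (Fin.last k)) 0 • b

lemma continuous_foldMap (v : Fin k → Fin d → ℝ) (a b : Fin d → ℝ) : Continuous (foldMap v a b) := by
  unfold foldMap
  fun_prop

lemma foldMap_of_nonneg (v : Fin k → Fin d → ℝ) (a b : Fin d → ℝ) {x : Euc (k + 1)} (h : 0 ≤ x (Fin.last k)) :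
    foldMap v a b x = comb (Fin.snoc v a : Fin (k + 1) → Fin d → ℝ) x := by
  simp [foldMap, comb_apply, Fin.sum_univ_castSucc, h]

lemma foldMap_of_nonpos (v : Fin k → Fin d → ℝ) (a b : Fin d → ℝ) {x : Euc (k + 1)} (h : x (Fin.last k) ≤ 0) :
    foldMap v a b x = ∑ i : Fin k, x i.castSucc • v i + (-x (Fin.last k)) • b := by
  simp [foldMap, h]
end comb

/-- Two distinct cones with a common facet. -/
structure Fan.IsWall {d : ℕ} (Φ : Fan d) (R D₁ D₂ : Set (Fin d → ℝ)) : Prop where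
  mem : R ∈ Φ.cones
  mem₁ : D₁ ∈ Φ.cones
  mem₂ : D₂ ∈ Φ.cones
  sub₁ : R ⊆ D₁
  sub₂ : R ⊆ D₂
  dim₁ : coneDim R + 1 = coneDim D₁
  dim₂ : coneDim R + 1 = coneDim D₂
  ne : D₁ ≠ D₂

namespace Fan.IsWall
variable {d m : ℕ} {Φ : Fan d} {R D₁ D₂ : Set (Fin d → ℝ)} (w : Φ.IsWall R D₁ D₂)
include w

lemma symm : Φ.IsWall R D₂ D₁ := ⟨w.mem, w.mem₂, w.mem₁, w.sub₂, w.sub₁, w.dim₂, w.dim₁, w.ne.symm⟩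

lemma ne₁ : R ≠ D₁ := by rintro rfl; have := w.dim₁; omega

lemma ne₂ : R ≠ D₂ := w.symm.ne₁

lemma inter : D₁ ∩ D₂ = R := by
  have hI := inter_mem w.mem₁ w.mem₂
  have hRI : R ⊆ D₁ ∩ D₂ := Set.subset_inter w.sub₁ w.sub₂
  refine (eq_of_span_le w.mem hI hRI ?_).symm
  have h1 : D₁ ∩ D₂ ≠ D₁ := fun h =>
    w.ne (eq_of_span_le w.mem₁ w.mem₂ (Set.inter_eq_left.1 h) (by rw [← w.dim₁, ← w.dim₂]))
  have := coneDim_lt hI w.mem₁ Set.inter_subset_left h1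
  have := w.dim₁
  omega

lemma bc₁_notMem : bc D₁ ∉ Submodule.span ℝ R := bc_notMem_span w.mem w.mem₁ w.sub₁ w.ne₁ (bc_mem w.mem₁)

lemma eventually_foldMap {v : Fin m → Fin d → ℝ} (hvR : ∀ i, v i ∈ Submodule.span ℝ R) {x₀ : Euc (m + 1)}
    (h0 : x₀ (Fin.last m) = 0) (hri : foldMap v (bc D₁) (bc D₂) x₀ ∈ ri R) :
    ∀ᶠ x in 𝓝 x₀, (0 ≤ x (Fin.last m) → foldMap v (bc D₁) (bc D₂) x ∈ D₁) ∧
      (x (Fin.last m) ≤ 0 → foldMap v (bc D₁) (bc D₂) x ∈ D₂) := by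
  have hc : Continuous fun x : Euc (m + 1) => ∑ i : Fin m, x i.castSucc • v i := by fun_prop
  have h1 : ∑ i : Fin m, x₀ i.castSucc • v i ∈ ri R := by simpa [foldMap, h0] using hri
  filter_upwards [hc.continuousAt.eventually (eventually_mem_ri (cc w.mem) h1)] with x hx
  have h2 := (hx (Submodule.sum_mem _ fun i _ => Submodule.smul_mem _ _ (hvR i))).1
  constructor <;> intro h
  · simp only [foldMap, max_eq_right (neg_nonpos.2 h), max_eq_left h, zero_smul, add_zero]
    exact (cc w.mem₁).add_mem (w.sub₁ h2) ((cc w.mem₁).smul_mem (bc_mem w.mem₁).1 h)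
  · rw [foldMap_of_nonpos _ _ _ h]
    exact (cc w.mem₂).add_mem (w.sub₂ h2) ((cc w.mem₂).smul_mem (bc_mem w.mem₂).1 (neg_nonneg.2 h))

lemma injOn_foldMap {v : Fin m → Fin d → ℝ} (hv : LinearIndependent ℝ v) (hvR : ∀ i, v i ∈ Submodule.span ℝ R) :
    Set.InjOn (foldMap v (bc D₁) (bc D₂)) {x | (0 ≤ x (Fin.last m) → foldMap v (bc D₁) (bc D₂) x ∈ D₁) ∧
      (x (Fin.last m) ≤ 0 → foldMap v (bc D₁) (bc D₂) x ∈ D₂)} := by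
  have hs : ∀ x : Euc (m + 1), ∑ i : Fin m, x i.castSucc • v i ∈ Submodule.span ℝ R := fun x =>
    Submodule.sum_mem _ fun i _ => Submodule.smul_mem _ _ (hvR i)
  have key : ∀ (x : Euc (m + 1)) (t : ℝ) {b : Fin d → ℝ}, b ∉ Submodule.span ℝ R →
      ∑ i : Fin m, x i.castSucc • v i + t • b ∈ Submodule.span ℝ R → t = 0 := by
    intro x t b hb h
    by_contra ht
    have := (Submodule.add_mem_iff_right _ (hs x)).1 h
    exact hb ((Submodule.smul_mem_iff _ ht).1 this)
  have hb₁ := w.bc₁_notMem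
  have hb₂ := w.symm.bc₁_notMem
  have hli₁ : LinearIndependent ℝ (Fin.snoc v (bc D₁) : Fin (m + 1) → Fin d → ℝ) :=
    linearIndependent_finSnoc.2 ⟨hv, fun h => hb₁ (Submodule.span_le.2 (by rintro _ ⟨i, rfl⟩; exact hvR i) h)⟩
  have hli₂ : LinearIndependent ℝ (Fin.snoc v (-bc D₂) : Fin (m + 1) → Fin d → ℝ) :=
    linearIndependent_finSnoc.2 ⟨hv, fun h => hb₂ (by
      simpa using Submodule.span_le.2 (by rintro _ ⟨i, rfl⟩; exact hvR i) h)⟩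
  have hcomb : ∀ x : Euc (m + 1), x (Fin.last m) ≤ 0 → foldMap v (bc D₁) (bc D₂) x =
      comb (Fin.snoc v (-bc D₂) : Fin (m + 1) → Fin d → ℝ) x := by
    intro x hx
    rw [foldMap_of_nonpos _ _ _ hx]
    simp [comb_apply, Fin.sum_univ_castSucc]
  have hmix : ∀ x y : Euc (m + 1), 0 ≤ x (Fin.last m) → y (Fin.last m) ≤ 0 →
      foldMap v (bc D₁) (bc D₂) x ∈ D₁ → foldMap v (bc D₁) (bc D₂) y ∈ D₂ →
      foldMap v (bc D₁) (bc D₂) x = foldMap v (bc D₁) (bc D₂) y → x = y := by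
    intro x y hx hy hx1 hy2 hxy
    have hR : foldMap v (bc D₁) (bc D₂) x ∈ R := w.inter ▸ ⟨hx1, hxy ▸ hy2⟩
    have hx0 : x (Fin.last m) = 0 := by
      refine key x _ hb₁ (?_ : _ ∈ Submodule.span ℝ R)
      have : _ ∈ Submodule.span ℝ R := Submodule.subset_span hR
      simpa only [foldMap, max_eq_right (neg_nonpos.2 hx), max_eq_left hx, zero_smul, add_zero] using this
    refine comb_injective hli₂ ?_
    rw [← hcomb x hx0.le, ← hcomb y hy, hxy]
  intro x hx y hy hxy
  rcases le_total 0 (x (Fin.last m)) with h1 | h1 <;> rcases le_total 0 (y (Fin.last m)) with h2 | h2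
  · rw [foldMap_of_nonneg _ _ _ h1, foldMap_of_nonneg _ _ _ h2] at hxy
    exact comb_injective hli₁ hxy
  · exact hmix x y h1 h2 (hx.1 h1) (hy.2 h2) hxy
  · exact (hmix y x h2 h1 (hy.1 h2) (hx.2 h1) hxy.symm).symm
  · rw [hcomb x h1, hcomb y h2] at hxy
    exact comb_injective hli₂ hxy

/-- A neighbourhood of a point in the relative interior of the wall is covered by the two adjacent cones. -/
lemma eventually_exists {Φ' : Fan d} (hm : coneDim R = m) {p : Fin d → ℝ} (hp : p ∈ ri R) (c : HalfChart Φ Φ' m p) :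
    ∀ᶠ y in 𝓝 (c.f p), ∃ x ∈ D₁ ∪ D₂, x ∈ c.N ∧ c.f x = y := by
  obtain ⟨v, hv, hvR⟩ : ∃ v : Fin m → Fin d → ℝ, LinearIndependent ℝ v ∧ ∀ i, v i ∈ Submodule.span ℝ R := by
    have hm' : Module.finrank ℝ (Submodule.span ℝ R) = m := hm
    obtain ⟨b⟩ : Nonempty (Module.Basis (Fin m) ℝ (Submodule.span ℝ R)) := ⟨Module.finBasisOfFinrankEq ℝ _ hm'⟩
    exact ⟨fun i => b i, b.linearIndependent.map' _ (Submodule.ker_subtype _), fun i => (b i).2⟩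
  obtain ⟨z, hz⟩ := exists_comb_eq hv hvR hm (Submodule.subset_span hp.1)
  set x₀ : Euc (m + 1) := WithLp.toLp 2 (Fin.snoc (fun i => z i) 0 : Fin (m + 1) → ℝ) with hx₀
  have hl : x₀ (Fin.last m) = 0 := by simp [hx₀]
  have hfx : foldMap v (bc D₁) (bc D₂) x₀ = p := by
    rw [← hz, comb_apply]
    simp [foldMap, hx₀]
  have h1 := w.eventually_foldMap hvR hl (by rwa [hfx])
  have h2 : ∀ᶠ x in 𝓝 x₀, foldMap v (bc D₁) (bc D₂) x ∈ c.N :=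
    (continuous_foldMap _ _ _).continuousAt.eventually (c.isOpen_N.mem_nhds (by rw [hfx]; exact c.mem_N))
  set U := {x | ((0 ≤ x (Fin.last m) → foldMap v (bc D₁) (bc D₂) x ∈ D₁) ∧
      (x (Fin.last m) ≤ 0 → foldMap v (bc D₁) (bc D₂) x ∈ D₂)) ∧ foldMap v (bc D₁) (bc D₂) x ∈ c.N} with hU
  have hUn : U ∈ 𝓝 x₀ := h1.and h2
  have hUD : ∀ x ∈ U, foldMap v (bc D₁) (bc D₂) x ∈ D₁ ∪ D₂ := fun x hx =>
    (le_total 0 (x (Fin.last m))).imp hx.1.1 hx.1.2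
  have hUs : ∀ x ∈ U, foldMap v (bc D₁) (bc D₂) x ∈ c.N ∩ ⋃₀ Φ.cones := fun x hx =>
    ⟨hx.2, (hUD x hx).elim (fun h => ⟨_, w.mem₁, h⟩) (fun h => ⟨_, w.mem₂, h⟩)⟩
  have h3 := image_mem_nhds_of_injOn (fun x => c.f (foldMap v (bc D₁) (bc D₂) x)) U x₀ hUn
    (c.cont_f.comp (continuous_foldMap _ _ _).continuousOn hUs)
    (fun a ha b hb hab => w.injOn_foldMap hv hvR ha.1 hb.1 (c.injOn_f (hUs a ha) (hUs b hb) hab))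
  rw [hfx] at h3
  filter_upwards [h3]
  rintro _ ⟨x, hx, rfl⟩
  exact ⟨_, hUD x hx, hx.2, rfl⟩

end Fan.IsWall

lemma Fan.bc_ne_zero {d : ℕ} {Φ : Fan d} {R : Set (Fin d → ℝ)} (hR : R ∈ Φ.cones) (h : 0 < coneDim R) : bc R ≠ 0 :=
  IsManifoldFan.ne_zero hR (by rintro rfl; rw [coneDim_zero] at h; omega) (bc_mem hR)

namespace IsManifoldFan
open Fan
variable {d : ℕ} {Φ Φ' : Fan d} {m : ℕ} {C D R D₁ D₂ D₃ : Set (Fin d → ℝ)} {x : Fin d → ℝ} (M : IsManifoldFan Φ Φ' m)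
include M

lemma eq_or_eq_of_wall (hdim : coneDim R = m) (w : Φ.IsWall R D₁ D₂)
    (hD₃ : D₃ ∈ Φ.cones) (h₃ : R ⊆ D₃) (hd₃ : coneDim D₃ = m + 1) : D₃ = D₁ ∨ D₃ = D₂ := by
  have hp := bc_mem w.mem
  have hps : bc R ∈ ⋃₀ Φ.cones := ⟨R, w.mem, hp.1⟩
  obtain ⟨c⟩ := M.chart (bc R) hps (bc_ne_zero w.mem (hdim ▸ M.pos))
  obtain ⟨t, ht, h1, h2⟩ := exists_pos_of_eventually (c.eventually_f hps (w.eventually_exists hdim hp c)) (bc D₃)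
  have hri : bc R + t • bc D₃ ∈ ri D₃ := by
    rw [add_comm]
    exact ri_add (cc hD₃) (ri_smul (cc hD₃) (bc_mem hD₃) ht) (h₃ hp.1)
  have hs : bc R + t • bc D₃ ∈ ⋃₀ Φ.cones := ⟨D₃, hD₃, hri.1⟩
  obtain ⟨x, hx, hxN, hfx⟩ := h2 hs
  have hd1 := w.dim₁
  have hd2 := w.dim₂
  rcases hx with hx | hx
  · have := c.injOn_f ⟨hxN, ⟨_, w.mem₁, hx⟩⟩ ⟨h1, hs⟩ hfx
    subst this
    exact Or.inl (eq_of_span_le hD₃ w.mem₁ (subset_of_ri hD₃ w.mem₁ hri hx) (by omega))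
  · have := c.injOn_f ⟨hxN, ⟨_, w.mem₂, hx⟩⟩ ⟨h1, hs⟩ hfx
    subst this
    exact Or.inr (eq_of_span_le hD₃ w.mem₂ (subset_of_ri hD₃ w.mem₂ hri hx) (by omega))

/-- A wall is not contained in the boundary. -/
lemma notMem_of_wall (hdim : coneDim R = m) (w : Φ.IsWall R D₁ D₂) : R ∉ Φ'.cones := by
  intro hR'
  have hp := bc_mem w.mem
  have hps : bc R ∈ ⋃₀ Φ.cones := ⟨R, w.mem, hp.1⟩
  obtain ⟨c⟩ := M.chart (bc R) hps (bc_ne_zero w.mem (hdim ▸ M.pos))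
  have h0 : c.f (bc R) 0 = 0 := (c.boundary _ c.mem_N hps).1 ⟨R, hR', hp.1⟩
  obtain ⟨t, ht, x, hx, hxN, hfx⟩ := exists_pos_of_eventually (w.eventually_exists hdim hp c)
    (EuclideanSpace.single 0 (-1))
  have := (c.maps_f x hxN (hx.elim (fun h => ⟨_, w.mem₁, h⟩) (fun h => ⟨_, w.mem₂, h⟩))).2
  rw [hfx] at this
  simp [h0] at this
  linarith

/-- An interior cone of codimension one is contained in a second maximal cone. -/
lemma exists_wall (hR : R ∈ Φ.cones) (hR' : R ∉ Φ'.cones) (hdim : coneDim R = m) (hD : D ∈ Φ.cones) (hRD : R ⊆ D)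
    (hd : coneDim D = m + 1) : ∃ D', Φ.IsWall R D D' := by
  by_contra! hno
  have huniq : ∀ E ∈ Φ.cones, R ⊆ E → E ⊆ D := by
    intro E hE hRE
    obtain ⟨F, hF, hEF, hFd⟩ := M.exists_top hE fun h => hR' (M.mem_of_subset hR h hRE)
    by_cases hFD : F = D
    · rwa [← hFD]
    · exact absurd ⟨hR, hD, hF, hRD, hRE.trans hEF, by omega, by omega, Ne.symm hFD⟩ (hno F)
  have hp := bc_mem hR
  have hps : bc R ∈ ⋃₀ Φ.cones := ⟨R, hR, hp.1⟩
  obtain ⟨c⟩ := M.chart (bc R) hps (bc_ne_zero hR (hdim ▸ M.pos))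
  have h0 : 0 < c.f (bc R) 0 := (c.pos_iff c.mem_N hps).2 fun h => hR' ((M.mem_support_iff hR hp).1 h)
  obtain ⟨r, hr, h⟩ := c.exists_ball_of_pos hps h0 (eventually_mem_of_mem Φ (bc R))
  have hsub : Metric.ball (c.f (bc R)) r ⊆ c.O ∩ {y | 0 ≤ y 0} := fun y hy => ⟨(h y hy).2.1, (h y hy).1.le⟩
  have hgD : ∀ y ∈ Metric.ball (c.f (bc R)) r, c.g y ∈ D := by
    intro y hy
    obtain ⟨h1, h2, h3⟩ := h y hy
    obtain ⟨E, hE, hyE⟩ := (c.maps_g y h2 h1.le).2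
    exact huniq E hE (subset_of_ri hR hE hp (h3 E hE hyE)) hyE
  have h1 := eventually_mem_image_of_injOn Metric.isOpen_ball (Metric.mem_ball_self hr) (c.cont_g.mono hsub)
    (c.injOn_g.mono hsub) (W := Submodule.span ℝ D) (fun y hy => Submodule.subset_span (hgD y hy)) hd.le
  rw [c.gf _ c.mem_N hps] at h1
  obtain ⟨t, ht, h2⟩ := exists_pos_of_eventually h1 (-bc D)
  have hbD := (bc_mem hD).1
  obtain ⟨y, hy, hyg⟩ := h2 (Submodule.add_mem _ (Submodule.subset_span (hRD hp.1))
    (Submodule.smul_mem _ _ (Submodule.neg_mem _ (Submodule.subset_span hbD))))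
  have h3 := hgD y hy
  rw [hyg] at h3
  have hneRD : R ≠ D := by rintro rfl; omega
  have h4 := ((isFaceOf hR hD hRD).2.2 _ h3 _ ((cc hD).smul_mem hbD ht.le) (by simpa using hp.1)).2
  have h5 := (cc hR).smul_mem h4 (inv_pos.2 ht).le
  rw [smul_smul, inv_mul_cancel₀ ht.ne', one_smul] at h5
  exact notMem_of_ri hR hD hRD hneRD (bc_mem hD) h5

end IsManifoldFan

end

section

namespace IsManifoldFan
open Fan
variable {d : ℕ} {Φ Φ' : Fan d} {m : ℕ} {C D R D₁ D₂ E E' : Set (Fin d → ℝ)} {x : Fin d → ℝ} (M : IsManifoldFan Φ Φ' m)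
include M

/-- Links of interior cones of codimension at least two are connected. -/
theorem imp_of_comparable (hC : C ∈ Φ.cones) (hC' : C ∉ Φ'.cones) (hdim : coneDim C + 1 ≤ m) {Q : Set (Fin d → ℝ) → Prop}
    (hQ : ∀ E ∈ Φ.cones, ∀ E' ∈ Φ.cones, C ⊆ E → C ≠ E → E ⊆ E' → (Q E ↔ Q E'))
    (hE : E ∈ Φ.cones) (hCE : C ⊆ E) (hneE : C ≠ E) (hE' : E' ∈ Φ.cones) (hCE' : C ⊆ E') (hneE' : C ≠ E') (h : Q E) :
    Q E' := by
  by_contra hn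
  obtain ⟨D, hD, hED, hDdim⟩ := M.exists_top hE fun h => hC' (M.mem_of_subset hC h hCE)
  have hQD : Q D := (hQ E hE D hD hCE hneE hED).1 h
  have hCD := hCE.trans hED
  have hneD : C ≠ D := by rintro rfl; omega
  set S₁ := ⋃₀ {F | F ∈ Φ.cones ∧ C ⊆ F ∧ (F = C ∨ Q F)} with hS₁
  set S₂ := ⋃₀ {F | F ∈ Φ.cones ∧ C ⊆ F ∧ (F = C ∨ ¬ Q F)} with hS₂
  have hcl₁ : IsClosed S₁ := by
    rw [hS₁, Set.sUnion_eq_biUnion]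
    exact (Φ.finite.subset fun _ h => h.1).isClosed_biUnion fun F hF => isClosed_cone hF.1
  have hcl₂ : IsClosed S₂ := by
    rw [hS₂, Set.sUnion_eq_biUnion]
    exact (Φ.finite.subset fun _ h => h.1).isClosed_biUnion fun F hF => isClosed_cone hF.1
  have hinter : ∀ x ∈ S₁, x ∈ S₂ → x ∈ C := by
    rintro x ⟨F, ⟨hF, hCF, hFQ⟩, hxF⟩ ⟨G, ⟨hG, hCG, hGQ⟩, hxG⟩
    rcases hFQ with rfl | hFQ
    · exact hxF
    rcases hGQ with rfl | hGQ
    · exact hxG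
    have hI := inter_mem hF hG
    by_cases hne : C = F ∩ G
    · rw [hne]; exact ⟨hxF, hxG⟩
    · have h1 := hQ _ hI F hF (Set.subset_inter hCF hCG) hne Set.inter_subset_left
      have h2 := hQ _ hI G hG (Set.subset_inter hCF hCG) hne Set.inter_subset_right
      exact absurd (h2.1 (h1.2 hFQ)) hGQ
  have hCS₁ : C ⊆ S₁ := fun x hx => ⟨C, ⟨hC, subset_rfl, Or.inl rfl⟩, hx⟩
  have hCS₂ : C ⊆ S₂ := fun x hx => ⟨C, ⟨hC, subset_rfl, Or.inl rfl⟩, hx⟩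
  have hDS₁ : D ⊆ S₁ := fun x hx => ⟨D, ⟨hD, hCD, Or.inr hQD⟩, hx⟩
  have hES₂ : E' ⊆ S₂ := fun x hx => ⟨E', ⟨hE', hCE', Or.inr hn⟩, hx⟩
  have hS₁Φ : S₁ ⊆ ⋃₀ Φ.cones := Set.sUnion_subset_sUnion fun _ h => h.1
  have hp := bc_mem hC
  set p := bc C with hpdef
  have hps : p ∈ ⋃₀ Φ.cones := ⟨C, hC, hp.1⟩
  have hp0 : p ≠ 0 := ne_zero hC (fun h => hC' (h ▸ M.zero_mem)) hp
  obtain ⟨c⟩ := M.chart p hps hp0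
  have h0 : 0 < c.f p 0 := (c.pos_iff c.mem_N hps).2 fun h => hC' ((M.mem_support_iff hC hp).1 h)
  obtain ⟨π, hπ, hπid⟩ : ∃ π : (Fin d → ℝ) →ₗ[ℝ] (Fin d → ℝ), (∀ x, π x ∈ Submodule.span ℝ C) ∧
      ∀ x ∈ Submodule.span ℝ C, π x = x := by
    obtain ⟨T, hT⟩ := LinearMap.exists_extend (LinearMap.id : Submodule.span ℝ C →ₗ[ℝ] Submodule.span ℝ C)
    exact ⟨(Submodule.span ℝ C).subtype ∘ₗ T, fun x => (T x).2, fun x hx =>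
      congrArg Subtype.val (LinearMap.congr_fun hT ⟨x, hx⟩)⟩
  have hπc : Continuous π := LinearMap.continuous_of_finiteDimensional π
  have hv := bc_mem hD
  set v := bc D with hvdef
  have hvC : v ∉ Submodule.span ℝ C := bc_notMem_span hC hD hCD hneD hv
  set k : (Fin d → ℝ) → (Fin d → ℝ) := fun x => π x + ‖x - π x‖ • v with hk
  have hkc : Continuous k := by
    rw [hk]; fun_prop
  have hkC : ∀ x ∈ C, k x = x := fun x hx => by
    simp [hk, hπid x (Submodule.subset_span hx)]
  have hk_mem : ∀ x, k x ∈ Submodule.span ℝ C → k x = x := by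
    intro x hx
    have h1 := (Submodule.add_mem_iff_right _ (hπ x)).1 hx
    have h2 : ‖x - π x‖ = 0 := by
      by_contra h2
      exact hvC ((Submodule.smul_mem_iff _ h2).1 h1)
    have h3 : x = π x := sub_eq_zero.1 (norm_eq_zero.1 h2)
    simp [hk, ← h3]
  set r : (Fin d → ℝ) → (Fin d → ℝ) := fun x => if x ∈ S₁ then x else k x with hr
  have hr₁ : ∀ x ∈ S₁, r x = x := fun x hx => if_pos hx
  have hr₂ : ∀ x ∈ S₂, r x = k x := by
    intro x hx
    by_cases h1 : x ∈ S₁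
    · rw [hr₁ x h1, hkC x (hinter x h1 hx)]
    · exact if_neg h1
  have hrc : ContinuousOn r (S₁ ∪ S₂) :=
    (continuousOn_id.congr hr₁).union_of_isClosed (hkc.continuousOn.congr hr₂) hcl₁ hcl₂
  have hnear : ∀ᶠ x in 𝓝 p, x ∈ ⋃₀ Φ.cones → x ∈ S₁ ∪ S₂ := by
    filter_upwards [eventually_mem_of_mem Φ p] with x hx
    rintro ⟨F, hF, hxF⟩
    have hCF := subset_of_ri hC hF hp (hx F hF hxF)
    by_cases hQF : Q F
    · exact Or.inl ⟨F, ⟨hF, hCF, Or.inr hQF⟩, hxF⟩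
    · exact Or.inr ⟨F, ⟨hF, hCF, Or.inr hQF⟩, hxF⟩
  have hnear₂ : ∀ᶠ x in 𝓝 p, k x ∈ S₁ := by
    have h1 := (hπc.tendsto p).eventually (
      p := fun y => y ∈ Submodule.span ℝ C → y ∈ ri C) (by
        rw [hπid p (Submodule.subset_span hp.1)]; exact eventually_mem_ri (cc hC) hp)
    filter_upwards [h1] with x hx
    exact hDS₁ ((cc hD).add_mem (hCD (hx (hπ x)).1) ((cc hD).smul_mem hv.1 (norm_nonneg _)))
  have hrp : r p = p := hr₁ p (hCS₁ hp.1)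
  have hnear₃ : ∀ᶠ x in 𝓝 p, x ∈ S₁ ∪ S₂ → r x ∈ c.N := by
    have h1 := (hrc p (Or.inl (hCS₁ hp.1))).eventually (p := fun y => y ∈ c.N) (by
      rw [hrp]; exact c.isOpen_N.mem_nhds c.mem_N)
    rwa [eventually_nhdsWithin_iff] at h1
  obtain ⟨r₀, hr₀, hball⟩ := c.exists_ball_of_pos hps h0 (hnear.and (hnear₂.and hnear₃))
  have hsubball : Metric.closedBall (c.f p) (r₀ / 2) ⊆ Metric.ball (c.f p) r₀ :=
    Metric.closedBall_subset_ball (by linarith)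
  have hg : ∀ y ∈ Metric.closedBall (c.f p) (r₀ / 2), y ∈ c.O ∧ 0 ≤ y 0 ∧ c.g y ∈ S₁ ∪ S₂ ∧ r (c.g y) ∈ S₁ ∧
      r (c.g y) ∈ c.N := by
    intro y hy
    obtain ⟨h1, h2, h3, h4, h5⟩ := hball y (hsubball hy)
    have h6 := h3 (c.maps_g y h2 h1.le).2
    refine ⟨h2, h1.le, h6, ?_, h5 h6⟩
    by_cases h7 : c.g y ∈ S₁
    · rwa [hr₁ _ h7]
    · rw [hr₂ _ (h6.resolve_left h7)]
      exact h4
  set F : Euc (m + 1) → Euc (m + 1) := fun y => c.f (r (c.g y)) with hF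
  have hFc : ContinuousOn F (Metric.closedBall (c.f p) (r₀ / 2)) := by
    refine c.cont_f.comp (hrc.comp (c.cont_g.mono fun y hy => ⟨(hg y hy).1, (hg y hy).2.1⟩)
      fun y hy => (hg y hy).2.2.1) fun y hy => ⟨(hg y hy).2.2.2.2, hS₁Φ (hg y hy).2.2.2.1⟩
  have hFinj : ∀ z ∈ Metric.closedBall (c.f p) (r₀ / 2), ∀ x ∈ c.N, x ∈ ⋃₀ Φ.cones → F z = c.f x → r (c.g z) = x :=
    fun z hz x hxN hx h => c.injOn_f ⟨(hg z hz).2.2.2.2, hS₁Φ (hg z hz).2.2.2.1⟩ ⟨hxN, hx⟩ h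
  have hgf : ∀ z ∈ Metric.closedBall (c.f p) (r₀ / 2), ∀ x, c.g z = x → z = c.f x :=
    fun z hz x h => by rw [← h, c.fg z (hg z hz).1 (hg z hz).2.1]
  obtain ⟨η, hη0, hη⟩ : ∃ η > 0, ∀ z ∈ Metric.sphere (c.f p) (r₀ / 2), η ≤ ‖F z - c.f p‖ := by
    have h1 : IsCompact (F '' Metric.sphere (c.f p) (r₀ / 2)) :=
      (isCompact_sphere _ _).image_of_continuousOn (hFc.mono Metric.sphere_subset_closedBall)
    have h2 : c.f p ∉ F '' Metric.sphere (c.f p) (r₀ / 2) := by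
      rintro ⟨z, hz, hFz⟩
      have hz' := Metric.sphere_subset_closedBall hz
      have h3 := hFinj z hz' p c.mem_N hps hFz
      have h4 : c.g z = p := by
        rcases (hg z hz').2.2.1 with h5 | h5
        · rwa [hr₁ _ h5] at h3
        · rw [hr₂ _ h5] at h3
          have h6 : k (c.g z) ∈ Submodule.span ℝ C := by
            rw [h3]; exact Submodule.subset_span hp.1
          exact (hk_mem _ h6).symm.trans h3
      have h5 := hgf z hz' p h4
      rw [h5] at hz
      simp at hz
      linarith
    obtain ⟨η, hη, h3⟩ := Metric.isOpen_iff.1 h1.isClosed.isOpen_compl _ h2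
    refine ⟨η, hη, fun z hz => ?_⟩
    by_contra hlt
    exact h3 (by rw [Metric.mem_ball, dist_eq_norm]; exact not_le.1 hlt) ⟨z, hz, rfl⟩
  obtain ⟨w, hw, hwW⟩ : ∃ w ∈ D, w ∉ Submodule.span ℝ C ⊔ Submodule.span ℝ {v} := by
    by_contra! hall
    have h1 : Submodule.span ℝ D ≤ Submodule.span ℝ C ⊔ Submodule.span ℝ {v} := Submodule.span_le.2 hall
    have h2 := Submodule.finrank_mono h1
    have h3 := finrank_sup_span_singleton_le (Submodule.span ℝ C) v
    change coneDim D ≤ _ at h2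
    change _ ≤ coneDim C + 1 at h3
    omega
  have hfin := c.eventually_f hps (P := fun y => ‖y - c.f p‖ < r₀ / 2 ∧ ‖y - c.f p‖ < η) (by
    have : ∀ᶠ y in 𝓝 (c.f p), ‖y - c.f p‖ < min (r₀ / 2) η := by
      have hlt : 0 < min (r₀ / 2) η := lt_min (by linarith) hη0
      filter_upwards [Metric.ball_mem_nhds _ hlt] with y hy
      rwa [← dist_eq_norm]
    exact this.mono fun y hy => lt_min_iff.1 hy)
  obtain ⟨t, ht, hsN, hs⟩ := exists_pos_of_eventually hfin w
  obtain ⟨t', ht', huN, hu⟩ := exists_pos_of_eventually hfin (bc E')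
  set s := p + t • w with hsdef
  set u := p + t' • bc E' with hudef
  have hsD : s ∈ D := (cc hD).add_mem (hCD hp.1) ((cc hD).smul_mem hw ht.le)
  have hsW : s ∉ Submodule.span ℝ C ⊔ Submodule.span ℝ {v} := by
    intro h1
    have h2 := (Submodule.add_mem_iff_right _
      (Submodule.mem_sup_left (Submodule.subset_span hp.1))).1 h1
    exact hwW ((Submodule.smul_mem_iff _ ht.ne').1 h2)
  have hsS₂ : s ∉ S₂ := fun h1 =>
    hsW (Submodule.mem_sup_left (Submodule.subset_span (hinter s (hDS₁ hsD) h1)))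
  have huE : u ∈ E' := (cc hE').add_mem (hCE' hp.1) ((cc hE').smul_mem (bc_mem hE').1 ht'.le)
  have huC : u ∉ C := by
    intro h1
    have h2 := (Submodule.add_mem_iff_right _ (Submodule.subset_span hp.1)).1
      (Submodule.subset_span (R := ℝ) h1 : u ∈ Submodule.span ℝ C)
    exact bc_notMem_span hC hE' hCE' hneE' (bc_mem hE') ((Submodule.smul_mem_iff _ ht'.ne').1 h2)
  have hss : s ∈ ⋃₀ Φ.cones := ⟨D, hD, hsD⟩
  have hus : u ∈ ⋃₀ Φ.cones := ⟨E', hE', huE⟩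
  have hys := hs hss
  have hysball : c.f s ∈ Metric.closedBall (c.f p) (r₀ / 2) := by
    rw [Metric.mem_closedBall, dist_eq_norm]; exact hys.1.le
  refine false_of_fold F (c.f p) (c.f s) (c.f u) (r₀ / 2) η (by linarith) hFc hη hys.1 hys.2 (hu hus).2 ?_ ?_ ?_
  · have h1 : ContinuousWithinAt c.g (Metric.closedBall (c.f p) (r₀ / 2)) (c.f s) :=
      (c.cont_g.mono fun y hy => ⟨(hg y hy).1, (hg y hy).2.1⟩) _ hysball
    have h2 : Metric.closedBall (c.f p) (r₀ / 2) ∈ 𝓝 (c.f s) :=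
    Filter.mem_of_superset (Metric.isOpen_ball.mem_nhds (by rw [Metric.mem_ball, dist_eq_norm]; exact hys.1))
        Metric.ball_subset_closedBall
    have h3 := (h1.continuousAt h2).eventually (p := fun z => z ∉ S₂) (by
      rw [c.gf s hsN hss]; exact hcl₂.isOpen_compl.mem_nhds hsS₂)
    filter_upwards [h2, h3] with z hz hz2
    have h4 := (hg z hz).2.2.1.resolve_right hz2
    simp only [hF]
    rw [hr₁ _ h4, c.fg z (hg z hz).1 (hg z hz).2.1]
  · intro z hz hFz
    have h1 := hFinj z hz s hsN hss hFz
    rcases (hg z hz).2.2.1 with h2 | h2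
    · rw [hr₁ _ h2] at h1
      exact hgf z hz s h1
    · rw [hr₂ _ h2] at h1
      refine absurd ?_ hsW
      rw [← h1]
      exact Submodule.add_mem_sup (hπ _) (Submodule.smul_mem _ _ (Submodule.mem_span_singleton_self v))
  · intro z hz hFz
    have h1 := hFinj z hz u huN hus hFz
    have h2 := (hg z hz).2.2.2.1
    rw [h1] at h2
    exact huC (hinter u h2 (hES₂ huE))

/-- Maximal cones around an interior cone are connected through walls. -/
theorem imp_of_wall (hC : C ∈ Φ.cones) (hC' : C ∉ Φ'.cones) {P : Set (Fin d → ℝ) → Prop}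
    (hP : ∀ R D₁ D₂, Φ.IsWall R D₁ D₂ → C ⊆ R → coneDim R = m → P D₁ → P D₂)
    (h₁ : D₁ ∈ Φ.cones) (h₂ : D₂ ∈ Φ.cones) (hC₁ : C ⊆ D₁) (hC₂ : C ⊆ D₂) (hd₁ : coneDim D₁ = m + 1)
    (hd₂ : coneDim D₂ = m + 1) (h : P D₁) : P D₂ := by
  obtain ⟨k, hk⟩ : ∃ k, coneDim C + k = m + 1 := ⟨m + 1 - coneDim C, by have := M.coneDim_le hC; omega⟩
  induction k using Nat.strong_induction_on generalizing C D₁ D₂ with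
  | _ k ih =>
  rcases k with _ | _ | k
  · rw [← eq_of_span_le hC h₁ hC₁ (by omega)] at h
    rwa [← eq_of_span_le hC h₂ hC₂ (by omega)]
  · by_cases hne : D₁ = D₂
    · rwa [← hne]
    · exact hP C D₁ D₂ ⟨hC, h₁, h₂, hC₁, hC₂, by omega, by omega, hne⟩ subset_rfl (by omega) h
  · have hne : ∀ D : Set (Fin d → ℝ), coneDim D = m + 1 → C ≠ D := by rintro D hD rfl; omega
    have hstep : ∀ E ∈ Φ.cones, C ⊆ E → C ≠ E → ∀ D ∈ Φ.cones, ∀ D' ∈ Φ.cones, E ⊆ D → E ⊆ D' →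
        coneDim D = m + 1 → coneDim D' = m + 1 → P D → P D' := by
      intro E hE hCE hneE D hD D' hD' hED hED' hd hd' h
      have h1 := coneDim_lt hC hE hCE hneE
      have h2 := M.coneDim_le hE
      exact ih (m + 1 - coneDim E) (by omega) hE (fun h => hC' (M.mem_of_subset hC h hCE))
        (fun R D₁ D₂ w hR => hP R D₁ D₂ w (hCE.trans hR)) hD hD' hED hED' hd hd' h (by omega)
    have h1 := M.imp_of_comparable hC hC' (by omega)
      (Q := fun E => ∃ D ∈ Φ.cones, E ⊆ D ∧ coneDim D = m + 1 ∧ P D) (E := D₁) (E' := D₂) ?_ h₁ hC₁ (hne _ hd₁)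
      h₂ hC₂ (hne _ hd₂) ⟨D₁, h₁, subset_rfl, hd₁, h⟩
    · obtain ⟨D, hD, hDD, hd, hPD⟩ := h1
      rwa [← eq_of_span_le h₂ hD hDD (by omega)] at hPD
    · intro E hE E' hE' hCE hneE hEE'
      constructor
      · rintro ⟨D, hD, hED, hd, h⟩
        obtain ⟨D', hD', hED', hd'⟩ := M.exists_top hE' fun h => hC' (M.mem_of_subset hC h (hCE.trans hEE'))
        exact ⟨D', hD', hED', hd', hstep E hE hCE hneE D hD D' hD' hED (hEE'.trans hED') hd hd' h⟩
      · rintro ⟨D, hD, hED, hd, h⟩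
        exact ⟨D, hD, hEE'.trans hED, hd, h⟩

end IsManifoldFan

end

section

namespace IsManifoldFan
open Fan
variable {d : ℕ} {Φ Φ' : Fan d} {m : ℕ} {C D R D₁ D₂ E E' : Set (Fin d → ℝ)} {x : Fin d → ℝ} (M : IsManifoldFan Φ Φ' m)

lemma exists_halfBall {p : Fin d → ℝ} (c : HalfChart Φ Φ' m p) (hC : C ∈ Φ.cones) (hp : p ∈ ri C) :
    ∃ r > 0, ∀ y ∈ Metric.ball (c.f p) r, 0 < y 0 → y ∈ c.O ∧ c.g y ∈ c.N ∧
      ∃ E ∈ Φ.cones, C ⊆ E ∧ E ∉ Φ'.cones ∧ c.g y ∈ ri E := by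
  obtain ⟨r, hr, h⟩ := c.exists_ball ⟨C, hC, hp.1⟩ (eventually_mem_of_mem Φ p)
  refine ⟨r, hr, fun y hy h0 => ?_⟩
  obtain ⟨h1, h2⟩ := h y hy h0.le
  obtain ⟨h3, D, hD, hyD⟩ := c.maps_g y h1 h0.le
  obtain ⟨E, hE, -, hyE⟩ := exists_face_ri hD hyD
  refine ⟨h1, h3, E, hE, subset_of_ri hC hE hp (h2 E hE hyE.1), fun hE' => ?_, hyE⟩
  have h4 := (c.boundary _ h3 ⟨D, hD, hyD⟩).1 ⟨E, hE', hyE.1⟩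
  rw [c.fg y h1 h0.le] at h4
  exact h0.ne' h4

include M

lemma notMem_support (hE : E ∈ Φ.cones) (hE' : E ∉ Φ'.cones) (hx : x ∈ ri E) : x ∉ ⋃₀ Φ'.cones :=
  fun h => hE' ((M.mem_support_iff hE hx).1 h)

lemma exists_interior_of_ne_zero (hC : C ∈ Φ.cones) (hne : C ≠ {0}) : ∃ E ∈ Φ.cones, C ⊆ E ∧ E ∉ Φ'.cones := by
  by_cases hC' : C ∈ Φ'.cones
  · have hp := bc_mem hC
    have hps : bc C ∈ ⋃₀ Φ.cones := ⟨C, hC, hp.1⟩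
    obtain ⟨c⟩ := M.chart _ hps (ne_zero hC hne hp)
    obtain ⟨r, hr, h⟩ := exists_halfBall c hC hp
    obtain ⟨t, ht, h1⟩ := exists_pos_of_eventually (Metric.ball_mem_nhds (c.f (bc C)) hr) (EuclideanSpace.single 0 1)
    obtain ⟨-, -, E, hE, hCE, hE', -⟩ := h _ h1 (by
      have := (c.maps_f _ c.mem_N hps).2
      simp
      linarith)
    exact ⟨E, hE, hCE, hE'⟩
  · exact ⟨C, hC, subset_rfl, hC'⟩

lemma exists_interior (hC : C ∈ Φ.cones) : ∃ E ∈ Φ.cones, C ⊆ E ∧ E ∉ Φ'.cones := by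
  by_cases hne : C = {0}
  · obtain ⟨p, ⟨D, hD, hpD⟩, hp0⟩ := M.ne
    obtain ⟨E, hE, hDE, hE'⟩ := M.exists_interior_of_ne_zero (M.sub hD) (by rintro rfl; exact hp0 hpD)
    exact ⟨E, hE, by rw [hne]; simpa using (cc hE).zero_mem, hE'⟩
  · exact M.exists_interior_of_ne_zero hC hne

lemma exists_facet (hC : C ∈ Φ.cones) : ∃ D ∈ Φ.cones, C ⊆ D ∧ coneDim D = m + 1 := by
  obtain ⟨E, hE, hCE, hE'⟩ := M.exists_interior hC
  obtain ⟨D, hD, hED, hd⟩ := M.exists_top hE hE'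
  exact ⟨D, hD, hCE.trans hED, hd⟩

/-- A boundary cone is contained in a boundary cone of dimension `m`. -/
lemma exists_boundary_ridge (hC : C ∈ Φ'.cones) : ∃ R ∈ Φ'.cones, C ⊆ R ∧ coneDim R = m := by
  wlog hne : C ≠ {0} generalizing C
  · obtain ⟨p, ⟨D, hD, hpD⟩, hp0⟩ := M.ne
    obtain ⟨R, hR, hDR, hd⟩ := this hD (by rintro rfl; exact hp0 hpD)
    exact ⟨R, hR, by rw [not_not.1 hne]; simpa using (cc hR).zero_mem, hd⟩
  obtain ⟨R, ⟨hR, hCR⟩, hmax⟩ :=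
    (Φ'.finite.subset (t := {D | D ∈ Φ'.cones ∧ C ⊆ D}) fun _ h => h.1).exists_maximal ⟨C, hC, subset_rfl⟩
  refine ⟨R, hR, hCR, le_antisymm ?_ (not_lt.1 fun hlt => ?_)⟩
  · obtain ⟨E, hE, hRE, hE'⟩ := M.exists_interior (M.sub hR)
    have h1 := coneDim_lt (M.sub hR) hE hRE (by rintro rfl; exact hE' hR)
    have h2 := M.coneDim_le hE
    omega
  have hp := bc_mem hR
  have hps : bc R ∈ ⋃₀ Φ.cones := ⟨R, M.sub hR, hp.1⟩
  have hRne : R ≠ {0} := by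
    rintro rfl
    exact hne (hCR.antisymm (by simpa using (cc hC).zero_mem))
  obtain ⟨c⟩ := M.chart _ hps (ne_zero hR hRne hp)
  have h0 : c.f (bc R) 0 = 0 := (c.boundary _ c.mem_N hps).1 ⟨R, hR, hp.1⟩
  obtain ⟨r, hr, h⟩ := c.exists_ball hps (eventually_mem_of_mem Φ (bc R))
  let ι : Euc m → Euc (m + 1) := fun z => WithLp.toLp 2 (Fin.cons 0 (fun i => z i) : Fin (m + 1) → ℝ)
  have hι : Continuous ι := by
    refine (PiLp.continuous_toLp 2 _).comp (continuous_pi fun i => ?_)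
    refine Fin.cases ?_ (fun j => ?_) i
    · simpa using continuous_const
    · simp only [Fin.cons_succ]; fun_prop
  have hι0 : ∀ z, ι z 0 = 0 := fun z => rfl
  set z₀ : Euc m := WithLp.toLp 2 (fun i : Fin m => c.f (bc R) i.succ) with hz₀
  have hιz : ι z₀ = c.f (bc R) := by
    ext i
    refine Fin.cases ?_ (fun j => ?_) i
    · rw [h0]; rfl
    · rfl
  have hιinj : Function.Injective ι := by
    intro a b hab
    ext i
    exact congrArg (fun y : Euc (m + 1) => y i.succ) hab
  have hsub : Set.MapsTo ι (ι ⁻¹' Metric.ball (c.f (bc R)) r) (c.O ∩ {y | 0 ≤ y 0}) := fun z hz =>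
    ⟨(h _ hz (hι0 z).ge).1, (hι0 z).ge⟩
  refine false_of_injOn_of_finrank_lt (g := fun z => c.g (ι z)) (U := ι ⁻¹' Metric.ball (c.f (bc R)) r) (x := z₀)
    (Metric.isOpen_ball.preimage hι) (by rw [Set.mem_preimage, hιz]; exact Metric.mem_ball_self hr)
    (c.cont_g.comp hι.continuousOn hsub)
    (fun a ha b hb hab => hιinj (c.injOn_g (hsub ha) (hsub hb) hab)) (W := Submodule.span ℝ R) (fun z hz => ?_) hlt
  obtain ⟨h1, h2⟩ := h _ hz (hι0 z).ge
  obtain ⟨h3, h4⟩ := c.maps_g _ h1 (hι0 z).ge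
  obtain ⟨E, hE, hzE⟩ := (c.boundary _ h3 h4).2 (by rw [c.fg _ h1 (hι0 z).ge]; exact hι0 z)
  have hRE := subset_of_ri (M.sub hR) (M.sub hE) hp (h2 E (M.sub hE) hzE)
  exact Submodule.subset_span (hmax ⟨hE, hCR.trans hRE⟩ hRE hzE)

/-- The interior cones containing a nonzero boundary cone are connected. -/
theorem imp_of_comparable_interior (hC : C ∈ Φ.cones) (hne : C ≠ {0}) {Q : Set (Fin d → ℝ) → Prop}
    (hQ : ∀ E ∈ Φ.cones, ∀ E' ∈ Φ.cones, C ⊆ E → E ∉ Φ'.cones → E ⊆ E' → (Q E ↔ Q E'))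
    (hE : E ∈ Φ.cones) (hCE : C ⊆ E) (hEi : E ∉ Φ'.cones) (hE' : E' ∈ Φ.cones) (hCE' : C ⊆ E') (hEi' : E' ∉ Φ'.cones)
    (h : Q E) : Q E' := by
  have hp := bc_mem hC
  have hps : bc C ∈ ⋃₀ Φ.cones := ⟨C, hC, hp.1⟩
  obtain ⟨c⟩ := M.chart _ hps (ne_zero hC hne hp)
  obtain ⟨r, hr, hb⟩ := exists_halfBall c hC hp
  set H : Set (Euc (m + 1)) := Metric.ball (c.f (bc C)) r ∩ {y | 0 < y 0} with hH
  have hHc : IsPreconnected H := by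
    refine ((convex_ball _ _).inter ?_).isPreconnected
    intro x hx y hy a b ha hb hab
    simp only [Set.mem_ofPred_eq] at hx hy ⊢
    simp only [PiLp.add_apply, PiLp.smul_apply, smul_eq_mul]
    rcases ha.eq_or_lt with rfl | ha
    · have : b = 1 := by linarith
      subst this; simpa using hy
    · have := mul_pos ha hx
      have := mul_nonneg hb hy.le
      linarith
  set P : Euc (m + 1) → Prop := fun y => ∃ E ∈ Φ.cones, c.g y ∈ ri E ∧ Q E with hP
  have hPiff : ∀ y, ∀ E ∈ Φ.cones, c.g y ∈ ri E → (P y ↔ Q E) := by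
    intro y E hE hy
    constructor
    · rintro ⟨F, hF, hyF, hQF⟩
      rwa [eq_of_ri hE hF hy hyF]
    · exact fun h => ⟨E, hE, hy, h⟩
  have hcont : ContinuousOn (fun y => decide (P y)) H := by
    intro y hy
    refine (continuousWithinAt_const (b := decide (P y))).congr_of_eventuallyEq ?_ rfl
    obtain ⟨hyO, hyN, E, hE, hCE, hEi, hyE⟩ := hb y hy.1 hy.2
    have hsub : H ⊆ c.O ∩ {y | 0 ≤ y 0} := fun z hz => ⟨(hb z hz.1 hz.2).1, show (0 : ℝ) ≤ z 0 from le_of_lt hz.2⟩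
    filter_upwards [((c.cont_g.mono hsub) y hy).eventually (eventually_mem_of_mem Φ (c.g y)), self_mem_nhdsWithin]
      with z hz hzH
    obtain ⟨hzO, hzN, F, hF, hCF, hFi, hzF⟩ := hb z hzH.1 hzH.2
    rw [decide_eq_decide, hPiff z F hF hzF, hPiff y E hE hyE]
    exact (hQ E hE F hF hCE hEi (subset_of_ri hE hF hyE (hz F hF hzF.1))).symm
  have hconst := (hHc.image _ hcont).subsingleton
  have hex : ∀ E ∈ Φ.cones, C ⊆ E → E ∉ Φ'.cones → ∃ y ∈ H, P y ↔ Q E := by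
    intro E hE hCE hEi
    obtain ⟨t, ht, h1, h2⟩ := exists_pos_of_eventually (c.eventually_f hps (Metric.ball_mem_nhds _ hr)) (bc E)
    have hri : bc C + t • bc E ∈ ri E := by
      rw [add_comm]
      exact ri_add (cc hE) (ri_smul (cc hE) (bc_mem hE) ht) (hCE hp.1)
    have hs : bc C + t • bc E ∈ ⋃₀ Φ.cones := ⟨E, hE, hri.1⟩
    refine ⟨_, ⟨h2 hs, (c.pos_iff h1 hs).2 (M.notMem_support hE hEi hri)⟩, hPiff _ E hE ?_⟩
    rwa [c.gf _ h1 hs]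
  obtain ⟨y, hy, hyE⟩ := hex E hE hCE hEi
  obtain ⟨z, hz, hzE⟩ := hex E' hE' hCE' hEi'
  have := hconst ⟨y, hy, rfl⟩ ⟨z, hz, rfl⟩
  rw [decide_eq_decide] at this
  exact hzE.1 (this.1 (hyE.2 h))

/-- Maximal cones around a nonzero cone are connected through walls. -/
theorem imp_of_wall_of_ne_zero (hC : C ∈ Φ.cones) (hne : C ≠ {0}) {P : Set (Fin d → ℝ) → Prop}
    (hP : ∀ R D₁ D₂, Φ.IsWall R D₁ D₂ → C ⊆ R → coneDim R = m → P D₁ → P D₂)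
    (h₁ : D₁ ∈ Φ.cones) (h₂ : D₂ ∈ Φ.cones) (hC₁ : C ⊆ D₁) (hC₂ : C ⊆ D₂) (hd₁ : coneDim D₁ = m + 1)
    (hd₂ : coneDim D₂ = m + 1) (h : P D₁) : P D₂ := by
  have hnotMem : ∀ D ∈ Φ.cones, coneDim D = m + 1 → D ∉ Φ'.cones := by
    intro D hD hd hD'
    obtain ⟨R, hR, hDR, hdR⟩ := M.exists_boundary_ridge hD'
    have := coneDim_mono hDR
    omega
  have h1 := M.imp_of_comparable_interior hC hne
      (Q := fun E => ∃ D ∈ Φ.cones, E ⊆ D ∧ coneDim D = m + 1 ∧ P D) (E := D₁) (E' := D₂) ?_ h₁ hC₁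
      (hnotMem D₁ h₁ hd₁) h₂ hC₂ (hnotMem D₂ h₂ hd₂) ⟨D₁, h₁, subset_rfl, hd₁, h⟩
  · obtain ⟨D, hD, hDD, hd, hPD⟩ := h1
    rwa [← eq_of_span_le h₂ hD hDD (by omega)] at hPD
  · intro E hE E' hE' hCE hEi hEE'
    constructor
    · rintro ⟨D, hD, hED, hd, h⟩
      obtain ⟨D', hD', hED', hd'⟩ := M.exists_facet hE'
      exact ⟨D', hD', hED', hd', M.imp_of_wall hE hEi (fun R D₁ D₂ w hR => hP R D₁ D₂ w (hCE.trans hR)) hD hD'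
        hED (hEE'.trans hED') hd hd' h⟩
    · rintro ⟨D, hD, hED, hd, h⟩
      exact ⟨D, hD, hEE'.trans hED, hd, h⟩

/-- If the poset of nonzero cones is connected, then maximal cones are connected through walls. -/
theorem imp_of_wall_of_connected
    (hconn : ∀ Q : Set (Fin d → ℝ) → Prop, (∀ E ∈ Φ.cones, ∀ E' ∈ Φ.cones, E ≠ {0} → E ⊆ E' → (Q E ↔ Q E')) →
      ∀ E ∈ Φ.cones, ∀ E' ∈ Φ.cones, E ≠ {0} → E' ≠ {0} → Q E → Q E')
    {P : Set (Fin d → ℝ) → Prop} (hP : ∀ R D₁ D₂, Φ.IsWall R D₁ D₂ → coneDim R = m → P D₁ → P D₂)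
    (h₁ : D₁ ∈ Φ.cones) (h₂ : D₂ ∈ Φ.cones) (hd₁ : coneDim D₁ = m + 1) (hd₂ : coneDim D₂ = m + 1) (h : P D₁) :
    P D₂ := by
  have hne : ∀ D : Set (Fin d → ℝ), coneDim D = m + 1 → D ≠ {0} := by
    rintro D hD rfl
    rw [coneDim_zero] at hD
    omega
  have h1 := hconn (fun E => ∃ D ∈ Φ.cones, E ⊆ D ∧ coneDim D = m + 1 ∧ P D) ?_ D₁ h₁ D₂ h₂ (hne _ hd₁) (hne _ hd₂)
    ⟨D₁, h₁, subset_rfl, hd₁, h⟩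
  · obtain ⟨D, hD, hDD, hd, hPD⟩ := h1
    rwa [← eq_of_span_le h₂ hD hDD (by omega)] at hPD
  · intro E hE E' hE' hneE hEE'
    constructor
    · rintro ⟨D, hD, hED, hd, h⟩
      obtain ⟨D', hD', hED', hd'⟩ := M.exists_facet hE'
      exact ⟨D', hD', hED', hd', M.imp_of_wall_of_ne_zero hE hneE (fun R D₁ D₂ w _ => hP R D₁ D₂ w) hD hD'
        hED (hEE'.trans hED') hd hd' h⟩
    · rintro ⟨D, hD, hED, hd, h⟩
      exact ⟨D, hD, hEE'.trans hED, hd, h⟩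

end IsManifoldFan

end

section

namespace HalfChart
open Fan
variable {d : ℕ} {Φ Φ' : Fan d} {m : ℕ} {D R : Set (Fin d → ℝ)} {p : Fin d → ℝ} (c : HalfChart Φ Φ' m p)

/-- The coordinate domain of the relative interior of a cone in the domain of a chart. -/
def dom {k : ℕ} (D : Set (Fin d → ℝ)) (ρ : ℝ) (p : Fin d → ℝ) (v : Fin k → Fin d → ℝ) : Set (Euc k) :=
  {x | comb v x ∈ ri D ∩ Metric.ball p ρ}

lemma isOpen_dom {k : ℕ} (hD : D ∈ Φ.cones) {v : Fin k → Fin d → ℝ} (hv : ∀ i, v i ∈ Submodule.span ℝ D) (ρ : ℝ) :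
    IsOpen (dom D ρ p v) := by
  rw [isOpen_iff_eventually]
  intro x hx
  filter_upwards [(continuous_comb v).continuousAt.eventually (eventually_mem_ri (cc hD) hx.1),
    (continuous_comb v).continuousAt.eventually (Metric.isOpen_ball.mem_nhds hx.2)] with y hy hy2
  exact ⟨hy (comb_mem_span hv y), hy2⟩

lemma convex_dom {k : ℕ} (hD : D ∈ Φ.cones) (v : Fin k → Fin d → ℝ) (ρ : ℝ) : Convex ℝ (dom D ρ p v) :=
  ((convex_ri (cc hD)).inter (convex_ball _ _)).linear_preimage (comb v)

variable {ρ : ℝ} (hρ : Metric.ball p ρ ⊆ c.N)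
include hρ

lemma continuousOn_dom (hD : D ∈ Φ.cones) (v : Fin (m + 1) → Fin d → ℝ) :
    ContinuousOn (fun x => c.f (comb v x)) (dom D ρ p v) :=
  c.cont_f.comp (continuous_comb v).continuousOn fun _ hx => ⟨hρ hx.2, D, hD, hx.1.1⟩

lemma injOn_dom (hD : D ∈ Φ.cones) {v : Fin (m + 1) → Fin d → ℝ} (hv : LinearIndependent ℝ v) :
    Set.InjOn (fun x => c.f (comb v x)) (dom D ρ p v) := fun _ hx _ hy h =>
  comb_injective hv (c.injOn_f ⟨hρ hx.2, D, hD, hx.1.1⟩ ⟨hρ hy.2, D, hD, hy.1.1⟩ h)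

lemma osgn_update (hD : D ∈ Φ.cones) {v : Fin (m + 1) → Fin d → ℝ} (hv : LinearIndependent ℝ v)
    (hvD : ∀ i, v i ∈ Submodule.span ℝ D) (i : Fin (m + 1)) (a : Fin (m + 1) → ℝ) (ha : a i < 0)
    {x y : Euc (m + 1)} (hx : x ∈ dom D ρ p v) (hxy : comb (Function.update v i (∑ j, a j • v j)) y = comb v x) :
    osgn (fun z => c.f (comb (Function.update v i (∑ j, a j • v j)) z)) y = - osgn (fun z => c.f (comb v z)) x := by
  set v' := Function.update v i (∑ j, a j • v j) with hv'
  set w : Euc (m + 1) := WithLp.toLp 2 (a - Pi.single i 1) with hw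
  have hcomb : ∀ z, comb v' z = comb v (z + z i • w) := by
    intro z
    have h1 : ∀ j, z j • v' j = z j • v j + (if j = i then z i • (∑ j, a j • v j - v i) else 0) := by
      intro j
      by_cases h : j = i
      · subst h; simp [hv', smul_sub]
      · simp [hv', h]
    have h2 : comb v w = ∑ j, a j • v j - v i := by
      simp [comb_apply, hw, sub_smul, Finset.sum_sub_distrib]
    rw [map_add, map_smul, h2, comb_apply, comb_apply]
    simp_rw [h1]
    simp [Finset.sum_add_distrib]
  have hwi : 1 + w i < 0 := by simp [hw, ha]
  have hyx : y + y i • w = x := comb_injective hv (by rw [← hcomb, hxy])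
  have hspan : ∀ j, v' j ∈ Submodule.span ℝ D := by
    intro j
    by_cases h : j = i
    · subst h
      simp only [hv', Function.update_self]
      exact Submodule.sum_mem _ fun j _ => Submodule.smul_mem _ _ (hvD j)
    · simp only [hv', Function.update_of_ne h]
      exact hvD j
  have hinj' : Function.Injective (comb v') := by
    intro z z' h
    rw [hcomb, hcomb] at h
    have h1 := comb_injective hv h
    have h2 : z i = z' i := by
      have h3 := congrArg (fun u : Euc (m + 1) => u i) h1
      simp only [PiLp.add_apply, PiLp.smul_apply, smul_eq_mul] at h3
      have h4 : (z i - z' i) * (1 + w i) = 0 := by linear_combination h3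
      rcases mul_eq_zero.1 h4 with h5 | h5 <;> linarith
    rw [h2] at h1
    exact add_right_cancel h1
  have hy : y ∈ dom D ρ p v' := by
    change comb v' y ∈ ri D ∩ Metric.ball p ρ
    rw [hxy]; exact hx
  obtain ⟨r, hr, hrx⟩ := Metric.nhds_basis_closedBall.mem_iff.1 ((isOpen_dom (p := p) hD hvD ρ).mem_nhds hx)
  obtain ⟨r', hr', hry⟩ := Metric.nhds_basis_closedBall.mem_iff.1 ((isOpen_dom (p := p) hD hspan ρ).mem_nhds hy)
  have hfun : (fun z => c.f (comb v' z)) = fun z : Euc (m + 1) => (fun u => c.f (comb v u)) (z + z i • w) := by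
    funext z
    simp only [hcomb]
  have h1 := (c.continuousOn_dom hρ hD v').mono hry
  have h2 : Set.InjOn (fun z => c.f (comb v' z)) (Metric.closedBall y r') := fun z hz z' hz' h =>
    hinj' (c.injOn_f ⟨hρ (hry hz).2, D, hD, (hry hz).1.1⟩ ⟨hρ (hry hz').2, D, hD, (hry hz').1.1⟩ h)
  rw [hfun] at h1 h2
  have h3 := osgn_comp_negTransvection (F := fun u => c.f (comb v u)) (x := y) i w hwi hr
    (by rw [hyx]; exact (c.continuousOn_dom hρ hD v).mono hrx)
    (by rw [hyx]; exact (c.injOn_dom hρ hD hv).mono hrx) hr' h1 h2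
  rw [hfun, h3, hyx]

/-- The local orientation of a maximal cone in a chart, relative to the orientation given by flags. -/
lemma exists_sign (ε : IncidenceFunction Φ) (hD : D ∈ Φ.cones) (hpD : p ∈ D) (hd : coneDim D = m + 1) (hρ0 : 0 < ρ) :
    ∃ s : ℤ, (s = 1 ∨ s = -1) ∧ ∀ v t, OFlag ε (m + 1) D v t → ∀ x ∈ dom D ρ p v,
      t * osgn (fun z => c.f (comb v z)) x = s := by
  obtain ⟨τ, hτ, hq⟩ := exists_pos_of_eventually (Metric.ball_mem_nhds p hρ0) (bc D)
  set q := p + τ • bc D with hqdef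
  have hqri : q ∈ ri D := by
    rw [hqdef, add_comm]
    exact ri_add (cc hD) (ri_smul (cc hD) (bc_mem hD) hτ) hpD
  have hfl : ∃ v t, OFlag ε (m + 1) D v t := hd ▸ OFlag.exists_flag ε hD
  obtain ⟨v₀, t₀, h₀⟩ := hfl
  set σ : (Fin (m + 1) → Fin d → ℝ) → ℤ := fun v =>
    if h : ∃ x, comb v x = q then osgn (fun z => c.f (comb v z)) h.choose else 1 with hσ
  have hσ_eq : ∀ v, LinearIndependent ℝ v → ∀ x, comb v x = q → σ v = osgn (fun z => c.f (comb v z)) x := by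
    intro v hv x hx
    have h : ∃ x, comb v x = q := ⟨x, hx⟩
    simp only [hσ, dif_pos h]
    rw [comb_injective hv (h.choose_spec.trans hx.symm)]
  have hspan : ∀ v t, OFlag ε (m + 1) D v t → ∀ i, v i ∈ Submodule.span ℝ D := fun v t h i =>
    Submodule.subset_span (h.mem i)
  have hneg : OFlag.NegChange (Submodule.span ℝ D) σ := by
    intro v i a hv hvD ha
    obtain ⟨x, hx⟩ := exists_comb_eq hv hvD hd (Submodule.subset_span hqri.1)
    by_cases h : ∃ y, comb (Function.update v i (∑ j, a j • v j)) y = q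
    · rw [hσ_eq v hv x hx]
      simp only [hσ, dif_pos h]
      refine c.osgn_update hρ hD hv hvD i a ha ?_ (h.choose_spec.trans hx.symm)
      change comb v x ∈ ri D ∩ Metric.ball p ρ
      rw [hx]; exact ⟨hqri, hq⟩
    · have hli : LinearIndependent ℝ (Function.update v i (∑ j, a j • v j)) := by
        rw [Fintype.linearIndependent_iff]
        intro g hg
        have h1 : ∀ j, g j • Function.update v i (∑ j, a j • v j) j =
            g j • v j + (if j = i then g i • (∑ j, a j • v j - v i) else 0) := by
          intro j
          by_cases h : j = i
          · subst h; simp [smul_sub]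
          · simp [h]
        simp_rw [h1] at hg
        rw [Finset.sum_add_distrib] at hg
        simp only [Finset.sum_ite_eq', Finset.mem_univ, if_true] at hg
        have h2 : ∑ j, (g j + g i * (a j - if j = i then 1 else 0)) • v j = 0 := by
          rw [← hg, smul_sub, Finset.smul_sum]
          simp only [add_smul, Finset.sum_add_distrib, mul_sub, sub_smul, Finset.sum_sub_distrib, mul_smul]
          simp
        have h3 := Fintype.linearIndependent_iff.1 hv _ h2
        have h4 : g i = 0 := by
          have := h3 i
          simp at this
          have h5 : g i * a i = 0 := by linear_combination this
          exact (mul_eq_zero.1 h5).resolve_right ha.ne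
        intro j
        have := h3 j
        rw [h4] at this
        simpa using this
      have hspan' : ∀ j, Function.update v i (∑ j, a j • v j) j ∈ Submodule.span ℝ D := by
        intro j
        by_cases h : j = i
        · subst h
          simp only [Function.update_self]
          exact Submodule.sum_mem _ fun j _ => Submodule.smul_mem _ _ (hvD j)
        · simp only [Function.update_of_ne h]
          exact hvD j
      exact absurd (exists_comb_eq hli hspan' hd (Submodule.subset_span hqri.1)) h
  refine ⟨t₀ * σ v₀, ?_, fun v t h x hx => ?_⟩
  · have h1 : σ v₀ = 1 ∨ σ v₀ = -1 := by
      simp only [hσ]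
      split_ifs
      · exact osgn_pm _ _
      · exact Or.inl rfl
    rcases h₀.pm with h2 | h2 <;> rcases h1 with h3 | h3 <;> simp [h2, h3]
  · obtain ⟨y, hy⟩ := exists_comb_eq h.linearIndependent (hspan v t h) hd (Submodule.subset_span hqri.1)
    rw [← OFlag.mul_eq_mul σ hneg h h₀, hσ_eq v h.linearIndependent y hy]
    congr 1
    refine osgn_eq_of_convex (isOpen_dom hD (hspan v t h) ρ) (convex_dom hD v ρ) (c.continuousOn_dom hρ hD v)
      (c.injOn_dom hρ hD h.linearIndependent) hx ?_
    change comb v y ∈ ri D ∩ Metric.ball p ρ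
    rw [hy]; exact ⟨hqri, hq⟩

end HalfChart

end

section

namespace HalfChart
open Fan
variable {d : ℕ} {Φ Φ' : Fan d} {m : ℕ} {D D₁ D₂ R : Set (Fin d → ℝ)} {p : Fin d → ℝ} (c : HalfChart Φ Φ' m p)
variable {ρ : ℝ} (hρ : Metric.ball p ρ ⊆ c.N)
include hρ

/-- The local orientations of the two maximal cones at a wall are compatible with the incidence numbers. -/
lemma eps_mul_sign_add (ε : IncidenceFunction Φ) (w : Φ.IsWall R D₁ D₂) (hpR : p ∈ R) (hdim : coneDim R = m)
    (hρ0 : 0 < ρ) {s₁ s₂ : ℤ}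
    (h₁ : ∀ v t, OFlag ε (m + 1) D₁ v t → ∀ x ∈ dom D₁ ρ p v, t * osgn (fun z => c.f (comb v z)) x = s₁)
    (h₂ : ∀ v t, OFlag ε (m + 1) D₂ v t → ∀ x ∈ dom D₂ ρ p v, t * osgn (fun z => c.f (comb v z)) x = s₂) :
    ε.eps R D₁ * s₁ + ε.eps R D₂ * s₂ = 0 := by
  have hfl : ∃ v t, OFlag ε m R v t := hdim ▸ OFlag.exists_flag ε w.mem
  obtain ⟨v, s, hv⟩ := hfl
  have hf₁ := OFlag.succ hv w.mem₁ w.sub₁ w.dim₁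
  have hf₂ := OFlag.succ hv w.mem₂ w.sub₂ w.dim₂
  set v₁ : Fin (m + 1) → Fin d → ℝ := Fin.snoc v (bc D₁) with hv₁
  set v₂ : Fin (m + 1) → Fin d → ℝ := Fin.snoc v (bc D₂) with hv₂
  have hvR : ∀ i, v i ∈ Submodule.span ℝ R := fun i => Submodule.subset_span (hv.mem i)
  obtain ⟨τ, hτ, hq⟩ := exists_pos_of_eventually (Metric.ball_mem_nhds p hρ0) (bc R)
  have hqri : p + τ • bc R ∈ ri R := by
    rw [add_comm]
    exact ri_add (cc w.mem) (ri_smul (cc w.mem) (bc_mem w.mem) hτ) hpR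
  obtain ⟨z, hz⟩ := exists_comb_eq hv.linearIndependent hvR hdim (Submodule.subset_span hqri.1)
  set x₀ : Euc (m + 1) := WithLp.toLp 2 (Fin.snoc (fun i => z i) 0 : Fin (m + 1) → ℝ) with hx₀
  have hl : x₀ (Fin.last m) = 0 := by simp [hx₀]
  have hsum : ∑ i : Fin m, x₀ i.castSucc • v i = p + τ • bc R := by
    rw [← hz, comb_apply]
    simp [hx₀]
  have hfold : foldMap v (bc D₁) (bc D₂) x₀ = p + τ • bc R := by
    rw [← hsum]; simp [foldMap, hl]
  have hcs : Continuous fun x : Euc (m + 1) => ∑ i : Fin m, x i.castSucc • v i := by fun_prop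
  have hev : ∀ᶠ x in 𝓝 x₀, ((0 ≤ x (Fin.last m) → foldMap v (bc D₁) (bc D₂) x ∈ D₁) ∧
      (x (Fin.last m) ≤ 0 → foldMap v (bc D₁) (bc D₂) x ∈ D₂)) ∧
      foldMap v (bc D₁) (bc D₂) x ∈ Metric.ball p ρ ∧ comb v₂ x ∈ Metric.ball p ρ ∧
      ∑ i : Fin m, x i.castSucc • v i ∈ ri R := by
    filter_upwards [w.eventually_foldMap hvR hl (by rw [hfold]; exact hqri),
      (continuous_foldMap v (bc D₁) (bc D₂)).continuousAt.eventually
        (Metric.isOpen_ball.mem_nhds (show foldMap v (bc D₁) (bc D₂) x₀ ∈ Metric.ball p ρ by rw [hfold]; exact hq)),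
      (continuous_comb v₂).continuousAt.eventually (Metric.isOpen_ball.mem_nhds
        (show comb v₂ x₀ ∈ Metric.ball p ρ by
          rw [hv₂, comb_apply, Fin.sum_univ_castSucc]
          simp only [Fin.snoc_castSucc, Fin.snoc_last, hl, hsum, zero_smul, add_zero]
          exact hq)),
      hcs.continuousAt.eventually (eventually_mem_ri (cc w.mem) (by beta_reduce; rw [hsum]; exact hqri))] with x h1 h2 h3 h4
    exact ⟨h1, h2, h3, h4 (Submodule.sum_mem _ fun i _ => Submodule.smul_mem _ _ (hvR i))⟩
  obtain ⟨δ, hδ, hball⟩ := Metric.eventually_nhds_iff_ball.1 hev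
  set F : Euc (m + 1) → Euc (m + 1) := fun x => c.f (foldMap v (bc D₁) (bc D₂) x) with hF
  have hsupp : ∀ x ∈ Metric.ball x₀ δ, foldMap v (bc D₁) (bc D₂) x ∈ c.N ∩ ⋃₀ Φ.cones := by
    intro x hx
    obtain ⟨⟨h1, h2⟩, h3, -⟩ := hball x hx
    refine ⟨hρ h3, ?_⟩
    rcases le_total 0 (x (Fin.last m)) with h | h
    · exact ⟨D₁, w.mem₁, h1 h⟩
    · exact ⟨D₂, w.mem₂, h2 h⟩
  have hFc : ContinuousOn F (Metric.ball x₀ δ) :=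
    c.cont_f.comp (continuous_foldMap _ _ _).continuousOn hsupp
  have hFi : Set.InjOn F (Metric.ball x₀ δ) := fun x hx y hy h =>
    w.injOn_foldMap hv.linearIndependent hvR (hball x hx).1 (hball y hy).1 (c.injOn_f (hsupp x hx) (hsupp y hy) h)
  set e : Euc (m + 1) := EuclideanSpace.single (Fin.last m) 1 with he
  have hel : e (Fin.last m) = 1 := by simp [he]
  have hec : ∀ i : Fin m, e i.castSucc = 0 := fun i => by simp [he, (Fin.castSucc_lt_last i).ne]
  have hen : ‖e‖ = 1 := by simp [he]
  set xp : Euc (m + 1) := x₀ + (δ / 2) • e with hxp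
  set xm : Euc (m + 1) := x₀ - (δ / 2) • e with hxm
  have hpl : xp (Fin.last m) = δ / 2 := by simp [hxp, hl, hel]
  have hml : xm (Fin.last m) = -(δ / 2) := by simp [hxm, hl, hel]
  have hdp : dist xp x₀ = δ / 2 := by
    rw [dist_eq_norm, hxp, add_sub_cancel_left, norm_smul, hen, Real.norm_of_nonneg (by positivity), mul_one]
  have hdm : dist xm x₀ = δ / 2 := by
    rw [dist_comm, dist_eq_norm, hxm, sub_sub_cancel, norm_smul, hen, Real.norm_of_nonneg (by positivity), mul_one]
  have hpb : Metric.closedBall xp (δ / 4) ⊆ Metric.ball x₀ δ := Metric.closedBall_subset_ball' (by linarith)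
  have hmb : Metric.closedBall xm (δ / 4) ⊆ Metric.ball x₀ δ := Metric.closedBall_subset_ball' (by linarith)
  have hxpb : xp ∈ Metric.ball x₀ δ := hpb (Metric.mem_closedBall_self (by linarith))
  have hxmb : xm ∈ Metric.ball x₀ δ := hmb (Metric.mem_closedBall_self (by linarith))
  have hcoord : ∀ {x y : Euc (m + 1)}, x ∈ Metric.closedBall y (δ / 4) →
      |x (Fin.last m) - y (Fin.last m)| ≤ δ / 4 := by
    intro x y hx
    have h := PiLp.norm_apply_le (x - y) (Fin.last m)
    rw [← dist_eq_norm] at h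
    simpa using h.trans hx
  have hppos : ∀ x ∈ Metric.closedBall xp (δ / 4), 0 ≤ x (Fin.last m) := fun x hx => by
    have := (abs_le.1 (hcoord hx)).1
    rw [hpl] at this; linarith
  have hmneg : ∀ x ∈ Metric.closedBall xm (δ / 4), x (Fin.last m) ≤ 0 := fun x hx => by
    have := (abs_le.1 (hcoord hx)).2
    rw [hml] at this; linarith
  have hcomb : ∀ (b : Fin d → ℝ) (x : Euc (m + 1)), comb (Fin.snoc v b : Fin (m + 1) → Fin d → ℝ) x =
      ∑ i : Fin m, x i.castSucc • v i + x (Fin.last m) • b := fun b x => by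
    simp [comb_apply, Fin.sum_univ_castSucc]
  have hxp₁ : xp ∈ dom D₁ ρ p v₁ := by
    refine ⟨?_, ?_⟩
    · rw [hcomb, hpl, add_comm]
      exact ri_add (cc w.mem₁) (ri_smul (cc w.mem₁) (bc_mem w.mem₁) (by linarith)) (w.sub₁ (hball xp hxpb).2.2.2.1)
    · rw [hv₁, ← foldMap_of_nonneg v _ (bc D₂) (by rw [hpl]; linarith)]
      exact (hball xp hxpb).2.1
  have hxp₂ : xp ∈ dom D₂ ρ p v₂ := by
    refine ⟨?_, (hball xp hxpb).2.2.1⟩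
    rw [hcomb, hpl, add_comm]
    exact ri_add (cc w.mem₂) (ri_smul (cc w.mem₂) (bc_mem w.mem₂) (by linarith)) (w.sub₂ (hball xp hxpb).2.2.2.1)
  have e₁ : osgn F xp = osgn (fun x => c.f (comb v₁ x)) xp :=
    osgn_congr (by linarith) (hFc.mono hpb) (hFi.mono hpb) fun x hx => by
      simp only [hF, foldMap_of_nonneg v (bc D₁) (bc D₂) (hppos x hx), hv₁]
  have e₂ : osgn F xp = osgn F xm := osgn_eq_of_convex Metric.isOpen_ball (convex_ball _ _) hFc hFi hxpb hxmb
  set u : Euc (m + 1) := (-2 : ℝ) • e with hu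
  have hul : u (Fin.last m) = -2 := by simp [hu, hel]
  have heq : Set.EqOn F (fun x => (fun y => c.f (comb v₂ y)) (x + x (Fin.last m) • u)) (Metric.closedBall xm (δ / 4)) := by
    intro x hx
    simp only [hF]
    rw [foldMap_of_nonpos v (bc D₁) (bc D₂) (hmneg x hx), hv₂, hcomb]
    congr 2
    · refine Finset.sum_congr rfl fun i _ => ?_
      simp [hu, hec]
    · congr 1
      simp only [PiLp.add_apply, PiLp.smul_apply, smul_eq_mul, hul]
      ring
  have hxu : xm + xm (Fin.last m) • u = xp := by
    rw [hml, hxm, hxp, hu]; module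
  have e₃ : osgn F xm = osgn (fun x => (fun y => c.f (comb v₂ y)) (x + x (Fin.last m) • u)) xm :=
    osgn_congr (by linarith) (hFc.mono hmb) (hFi.mono hmb) heq
  have hspan₂ : ∀ i, v₂ i ∈ Submodule.span ℝ D₂ := fun i => Submodule.subset_span (hf₂.mem i)
  obtain ⟨r, hr, hrx⟩ := Metric.nhds_basis_closedBall.mem_iff.1
    ((isOpen_dom (p := p) w.mem₂ hspan₂ ρ).mem_nhds hxp₂)
  have e₄ := osgn_comp_negTransvection (F := fun y => c.f (comb v₂ y)) (x := xm) (Fin.last m) u (by rw [hul]; norm_num) hr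
    (by rw [hxu]; exact (c.continuousOn_dom hρ w.mem₂ v₂).mono hrx)
    (by rw [hxu]; exact (c.injOn_dom hρ w.mem₂ hf₂.linearIndependent).mono hrx)
    (r' := δ / 4) (by linarith) ((hFc.mono hmb).congr heq.symm) ((hFi.mono hmb).congr heq)
  rw [hxu] at e₄
  have k₁ := h₁ v₁ _ hf₁ xp hxp₁
  have k₂ := h₂ v₂ _ hf₂ xp hxp₂
  have k : osgn (fun y => c.f (comb v₁ y)) xp = - osgn (fun y => c.f (comb v₂ y)) xp := by
    rw [← e₁, e₂, e₃, e₄]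
  rw [← k₁, ← k₂, k]
  have hm₁ := ε.pm R D₁ w.mem w.mem₁ w.sub₁ w.ne₁ w.dim₁
  have hm₂ := ε.pm R D₂ w.mem w.mem₂ w.sub₂ w.ne₂ w.dim₂
  rcases hm₁ with h1 | h1 <;> rcases hm₂ with h2 | h2 <;> rw [h1, h2] <;> ring

end HalfChart

namespace IsManifoldFan
open Fan
variable {d : ℕ} {Φ Φ' : Fan d} {m : ℕ} {C : Set (Fin d → ℝ)}

/-- The star of a nonzero cone carries a cycle of maximal cones with coefficients `±1`. -/
lemma exists_orientation (M : IsManifoldFan Φ Φ' m) (ε : IncidenceFunction Φ) (hC : C ∈ Φ.cones) (hne : C ≠ {0}) :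
    ∃ z : Set (Fin d → ℝ) → ℤ, (∀ D ∈ Φ.cones, C ⊆ D → coneDim D = m + 1 → z D = 1 ∨ z D = -1) ∧
      ∀ R D₁ D₂, Φ.IsWall R D₁ D₂ → C ⊆ R → coneDim R = m → ε.eps R D₁ * z D₁ + ε.eps R D₂ * z D₂ = 0 := by
  have hp := (bc_mem hC).1
  have hps : bc C ∈ ⋃₀ Φ.cones := ⟨C, hC, hp⟩
  obtain ⟨c⟩ := M.chart (bc C) hps (bc_ne_zero hC
    (Nat.pos_of_ne_zero fun h => hne (eq_zero_of_coneDim_eq_zero hC h)))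
  obtain ⟨ρ, hρ0, hρ⟩ := Metric.isOpen_iff.1 c.isOpen_N _ c.mem_N
  have H : ∀ D, ∃ s : ℤ, D ∈ Φ.cones → C ⊆ D → coneDim D = m + 1 → (s = 1 ∨ s = -1) ∧
      ∀ v t, OFlag ε (m + 1) D v t → ∀ x ∈ HalfChart.dom D ρ (bc C) v, t * osgn (fun z => c.f (comb v z)) x = s := by
    intro D
    by_cases h : D ∈ Φ.cones ∧ C ⊆ D ∧ coneDim D = m + 1
    · obtain ⟨s, hs⟩ := c.exists_sign hρ ε h.1 (h.2.1 hp) h.2.2 hρ0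
      exact ⟨s, fun _ _ _ => hs⟩
    · exact ⟨0, fun h1 h2 h3 => absurd ⟨h1, h2, h3⟩ h⟩
  choose z hz using H
  refine ⟨z, fun D hD hCD hd => (hz D hD hCD hd).1, fun R D₁ D₂ w hCR hR => ?_⟩
  have h1 := w.dim₁
  have h2 := w.dim₂
  exact c.eps_mul_sign_add hρ ε w (hCR hp) hR hρ0 (hz D₁ w.mem₁ (hCR.trans w.sub₁) (by omega)).2
    (hz D₂ w.mem₂ (hCR.trans w.sub₂) (by omega)).2

end IsManifoldFan

end

section

section cohomology
open Fan
variable {K : Type} [Field K] {d : ℕ} {T : Set (Set (Fin d → ℝ))} {C : Set (Fin d → ℝ)}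

lemma Cdiff_apply (eps : Set (Fin d → ℝ) → Set (Fin d → ℝ) → ℤ) (hT : T.Finite) (i : ℤ) (x : Cterm K T C i)
    (D' : {D : Set (Fin d → ℝ) // D ∈ T ∧ C ⊆ D ∧ (coneDim D : ℤ) = i + 1 + 1}) :
    Cdiff K eps T C i x D' = ∑ᶠ D, (eps D.1 D'.1 : K) * x D := by
  have hfin : Finite {D : Set (Fin d → ℝ) // D ∈ T ∧ C ⊆ D ∧ (coneDim D : ℤ) = i + 1} :=
    (hT.subset fun _ h => h.1).to_subtype
  have := Fintype.ofFinite {D : Set (Fin d → ℝ) // D ∈ T ∧ C ⊆ D ∧ (coneDim D : ℤ) = i + 1}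
  rw [Cdiff, LinearMap.pi_apply, finsum_eq_sum_of_fintype, finsum_eq_sum_of_fintype, LinearMap.sum_apply]
  simp

lemma CtermCast_apply {i j : ℤ} (h : i = j) (x : Cterm K T C i)
    (D : {D : Set (Fin d → ℝ) // D ∈ T ∧ C ⊆ D ∧ (coneDim D : ℤ) = j + 1}) :
    CtermCast K T C h x D = x ⟨D.1, D.2.1, D.2.2.1, by rw [h]; exact D.2.2.2⟩ := by
  subst h; rfl

/-- The coboundaries in degree `i`. -/
def coboundaries (K : Type) [Field K] (eps : Set (Fin d → ℝ) → Set (Fin d → ℝ) → ℤ)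
    (T : Set (Set (Fin d → ℝ))) (C : Set (Fin d → ℝ)) (i : ℤ) : Submodule K (Cterm K T C i) :=
  (LinearMap.range (Cdiff K eps T C (i - 1))).map (CtermCast K T C (show i - 1 + 1 = i by ring)).toLinearMap

variable {eps : Set (Fin d → ℝ) → Set (Fin d → ℝ) → ℤ} {i : ℤ}

lemma exists_of_mem_coboundaries (hT : T.Finite) {x : Cterm K T C i} (hx : x ∈ coboundaries K eps T C i) :
    ∃ y : {D : Set (Fin d → ℝ) // D ∈ T ∧ C ⊆ D ∧ (coneDim D : ℤ) = i - 1 + 1} → K,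
      ∀ D, x D = ∑ᶠ R, (eps R.1 D.1 : K) * y R := by
  obtain ⟨_, ⟨y, rfl⟩, rfl⟩ := hx
  refine ⟨y, fun D => ?_⟩
  rw [LinearEquiv.coe_coe, CtermCast_apply, Cdiff_apply eps hT]

lemma coboundary_mem (hT : T.Finite) {R : Set (Fin d → ℝ)} (hR : R ∈ T) (hCR : C ⊆ R) (hd : (coneDim R : ℤ) = i) :
    (fun D => (eps R D.1 : K) : Cterm K T C i) ∈ coboundaries K eps T C i := by
  have hd' : (coneDim R : ℤ) = i - 1 + 1 := by omega
  refine ⟨_, ⟨Pi.single ⟨R, hR, hCR, hd'⟩ 1, rfl⟩, ?_⟩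
  funext D
  rw [LinearEquiv.coe_coe, CtermCast_apply, Cdiff_apply eps hT, finsum_eq_single _ ⟨R, hR, hCR, hd'⟩]
  · simp
  · intro S hS
    simp [Pi.single_eq_of_ne hS]

lemma ker_Cdiff_eq_top (h : ∀ D ∈ T, (coneDim D : ℤ) ≠ i + 1 + 1) : LinearMap.ker (Cdiff K eps T C i) = ⊤ := by
  rw [LinearMap.ker_eq_top]
  ext x D
  exact absurd D.2.2.2 (h D.1 D.2.1)

lemma subsingleton_Hcoh (h : coboundaries K eps T C i = ⊤) : Subsingleton (Hcoh K eps T C i) := by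
  unfold Hcoh
  rw [Submodule.Quotient.subsingleton_iff]
  change Submodule.comap _ (coboundaries K eps T C i) = ⊤
  rw [h, Submodule.comap_top]

lemma nonempty_Hcoh_equiv (htop : ∀ D ∈ T, (coneDim D : ℤ) ≠ i + 1 + 1) (φ : Cterm K T C i →ₗ[K] K)
    (hφ : Function.Surjective φ) (hker : LinearMap.ker φ = coboundaries K eps T C i) :
    Nonempty (Hcoh K eps T C i ≃ₗ[K] K) := by
  set N := LinearMap.ker (Cdiff K eps T C i) with hN
  have hsurj : Function.Surjective (φ ∘ₗ N.subtype) := by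
    intro k
    obtain ⟨x, rfl⟩ := hφ k
    exact ⟨⟨x, by rw [hN, ker_Cdiff_eq_top htop]; trivial⟩, rfl⟩
  have h : LinearMap.ker (φ ∘ₗ N.subtype) = Submodule.comap N.subtype (coboundaries K eps T C i) := by
    rw [LinearMap.ker_comp, hker]
  exact ⟨(Submodule.quotEquivOfEq _ _ h.symm).trans (LinearMap.quotKerEquivOfSurjective _ hsurj)⟩

/-- The basis cochain of a cone. -/
def cochain (K : Type) [Field K] (T : Set (Set (Fin d → ℝ))) (C : Set (Fin d → ℝ)) (i : ℤ) (D : Set (Fin d → ℝ)) :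
    Cterm K T C i := fun F => if F.1 = D then 1 else 0

lemma mem_of_cochain_mem (hT : T.Finite) {N : Submodule K (Cterm K T C i)}
    (h : ∀ D ∈ T, C ⊆ D → (coneDim D : ℤ) = i + 1 → cochain K T C i D ∈ N) (x : Cterm K T C i) : x ∈ N := by
  have hfin : Finite {D : Set (Fin d → ℝ) // D ∈ T ∧ C ⊆ D ∧ (coneDim D : ℤ) = i + 1} :=
    (hT.subset fun _ h => h.1).to_subtype
  have := Fintype.ofFinite {D : Set (Fin d → ℝ) // D ∈ T ∧ C ⊆ D ∧ (coneDim D : ℤ) = i + 1}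
  have hx : x = ∑ D, x D • cochain K T C i D.1 := by
    funext F
    simp [cochain, Subtype.coe_inj]
  rw [hx]
  exact Submodule.sum_mem _ fun D _ => N.smul_mem _ (h _ D.2.1 D.2.2.1 D.2.2.2)

end cohomology

namespace IsManifoldFan
open Fan
variable {K : Type} [Field K] {d : ℕ} {Φ Φ' : Fan d} {m : ℕ} {C R D D₁ D₂ : Set (Fin d → ℝ)}
  (M : IsManifoldFan Φ Φ' m) (ε : IncidenceFunction Φ)

lemma isUnit_eps (hR : R ∈ Φ.cones) (hD : D ∈ Φ.cones) (h : R ⊆ D) (hd : coneDim R + 1 = coneDim D) :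
    (ε.eps R D : K) * (ε.eps R D : K) = 1 := by
  rcases ε.pm R D hR hD h (by rintro rfl; omega) hd with h | h <;> simp [h]

include M

lemma coneDim_ne {i : ℤ} (hi : i = m) : ∀ D ∈ Φ.cones, (coneDim D : ℤ) ≠ i + 1 + 1 := by
  intro D hD
  have := M.coneDim_le hD
  omega

lemma coboundary_of_wall {i : ℤ} (hi : i = m) (w : Φ.IsWall R D₁ D₂) (hR : coneDim R = m) :
    (fun D => (ε.eps R D.1 : K) : Cterm K Φ.cones C i) =
      (ε.eps R D₁ : K) • cochain K Φ.cones C i D₁ + (ε.eps R D₂ : K) • cochain K Φ.cones C i D₂ := by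
  funext F
  simp only [cochain, Pi.add_apply, Pi.smul_apply, smul_eq_mul, mul_ite, mul_one, mul_zero]
  by_cases h1 : F.1 = D₁
  · rw [if_pos h1, if_neg (h1 ▸ w.ne), h1, add_zero]
  by_cases h2 : F.1 = D₂
  · rw [if_pos h2, if_neg h1, h2, zero_add]
  rw [if_neg h1, if_neg h2, add_zero]
  by_contra hne
  obtain ⟨-, k1, k2, -, k3⟩ := ε.supp R F.1 fun h => hne (by rw [h, Int.cast_zero])
  rcases M.eq_or_eq_of_wall hR w k1 k2 (by omega) with h | h
  exacts [h1 h, h2 h]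

lemma coboundary_of_boundary {i : ℤ} (hR' : R ∈ Φ'.cones) (hD : D ∈ Φ.cones) (hRD : R ⊆ D)
    (hR : coneDim R = m) (hd : coneDim D = m + 1) :
    (fun D => (ε.eps R D.1 : K) : Cterm K Φ.cones C i) = (ε.eps R D : K) • cochain K Φ.cones C i D := by
  funext F
  simp only [cochain, Pi.smul_apply, smul_eq_mul, mul_ite, mul_one, mul_zero]
  by_cases h1 : F.1 = D
  · rw [if_pos h1, h1]
  rw [if_neg h1]
  by_contra hne
  obtain ⟨k0, k1, k2, -, k3⟩ := ε.supp R F.1 fun h => hne (by rw [h, Int.cast_zero])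
  exact M.notMem_of_wall hR ⟨k0, k1, hD, k2, hRD, k3, by omega, h1⟩ hR'

variable (hconn : ∀ Q : Set (Fin d → ℝ) → Prop,
  (∀ E ∈ Φ.cones, ∀ E' ∈ Φ.cones, E ≠ {0} → E ⊆ E' → (Q E ↔ Q E')) →
      ∀ E ∈ Φ.cones, ∀ E' ∈ Φ.cones, E ≠ {0} → E' ≠ {0} → Q E → Q E')
include hconn

lemma imp_of_wall_star (hC : C ∈ Φ.cones) {P : Set (Fin d → ℝ) → Prop}
    (hP : ∀ R D₁ D₂, Φ.IsWall R D₁ D₂ → C ⊆ R → coneDim R = m → P D₁ → P D₂)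
    (h₁ : D₁ ∈ Φ.cones) (h₂ : D₂ ∈ Φ.cones) (hC₁ : C ⊆ D₁) (hC₂ : C ⊆ D₂) (hd₁ : coneDim D₁ = m + 1)
    (hd₂ : coneDim D₂ = m + 1) (h : P D₁) : P D₂ := by
  by_cases hne : C = {0}
  · subst hne
    exact M.imp_of_wall_of_connected hconn
      (fun R D₁ D₂ w hR => hP R D₁ D₂ w (Set.singleton_subset_iff.2 (cc w.mem).zero_mem) hR) h₁ h₂ hd₁ hd₂ h
  · exact M.imp_of_wall_of_ne_zero hC hne hP h₁ h₂ hC₁ hC₂ hd₁ hd₂ h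

theorem subsingleton_Hcoh (hC : C ∈ Φ'.cones) {i : ℤ} (hi : i = m) : Subsingleton (Hcoh K ε.eps Φ.cones C i) := by
  apply _root_.subsingleton_Hcoh
  rw [eq_top_iff]
  obtain ⟨R₀, hR₀, hCR₀, hd₀⟩ := M.exists_boundary_ridge hC
  obtain ⟨D₀, hD₀, hRD₀, hdD₀⟩ := M.exists_facet (M.sub hR₀)
  have h₀ : cochain K Φ.cones C i D₀ ∈ coboundaries K ε.eps Φ.cones C i := by
    have h := coboundary_mem (K := K) (eps := ε.eps) Φ.finite (M.sub hR₀) hCR₀ (i := i) (by omega)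
    rw [M.coboundary_of_boundary ε hR₀ hD₀ hRD₀ hd₀ hdD₀] at h
    have h2 := Submodule.smul_mem _ (ε.eps R₀ D₀ : K) h
    rwa [smul_smul, isUnit_eps ε (M.sub hR₀) hD₀ hRD₀ (by omega), one_smul] at h2
  refine fun x _ => mem_of_cochain_mem Φ.finite (fun D hD hCD hd => ?_) x
  refine M.imp_of_wall_star hconn (M.sub hC)
    (P := fun D => cochain K Φ.cones C i D ∈ coboundaries K ε.eps Φ.cones C i)
    (fun R D₁ D₂ w hCR hR h1 => ?_) hD₀ hD (hCR₀.trans hRD₀) hCD hdD₀ (by omega) h₀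
  have h := coboundary_mem (K := K) (eps := ε.eps) Φ.finite w.mem hCR (i := i) (by omega)
  rw [M.coboundary_of_wall ε hi w hR] at h
  have h2 := Submodule.smul_mem _ (ε.eps R D₂ : K) (Submodule.sub_mem _ h (Submodule.smul_mem _ (ε.eps R D₁ : K) h1))
  rwa [add_sub_cancel_left, smul_smul, isUnit_eps ε w.mem w.mem₂ w.sub₂ w.dim₂, one_smul] at h2

theorem nonempty_Hcoh_equiv (hC : C ∈ Φ.cones) (hC' : C ∉ Φ'.cones) {i : ℤ} (hi : i = m) :
    Nonempty (Hcoh K ε.eps Φ.cones C i ≃ₗ[K] K) := by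
  have hne : C ≠ {0} := by
    rintro rfl
    obtain ⟨p, ⟨D, hD, -⟩, -⟩ := M.ne
    exact hC' (zero_cone_mem hD)
  obtain ⟨z, hz, hw⟩ := M.exists_orientation ε hC hne
  have hfin : ∀ j : ℤ, Finite {D : Set (Fin d → ℝ) // D ∈ Φ.cones ∧ C ⊆ D ∧ (coneDim D : ℤ) = j} := fun j =>
    (Φ.finite.subset fun _ h => h.1).to_subtype
  have := Fintype.ofFinite {D : Set (Fin d → ℝ) // D ∈ Φ.cones ∧ C ⊆ D ∧ (coneDim D : ℤ) = i + 1}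
  have := Fintype.ofFinite {D : Set (Fin d → ℝ) // D ∈ Φ.cones ∧ C ⊆ D ∧ (coneDim D : ℤ) = i - 1 + 1}
  set φ : Cterm K Φ.cones C i →ₗ[K] K := ∑ D, (z D.1 : K) • LinearMap.proj D with hφ
  have hφ_apply : ∀ x, φ x = ∑ D, (z D.1 : K) * x D := fun x => by simp [hφ]
  have hφ_cochain : ∀ D ∈ Φ.cones, C ⊆ D → coneDim D = m + 1 → φ (cochain K Φ.cones C i D) = z D := by
    intro D hD hCD hd
    rw [hφ_apply, Finset.sum_eq_single ⟨D, hD, hCD, by omega⟩]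
    · simp [cochain]
    · intro F _ hF
      rw [cochain, if_neg fun h => hF (Subtype.ext h), mul_zero]
    · simp
  have hsq : ∀ D ∈ Φ.cones, C ⊆ D → coneDim D = m + 1 → (z D : K) * z D = 1 := by
    intro D hD hCD hd
    rcases hz D hD hCD hd with h | h <;> simp [h]
  obtain ⟨D₀, hD₀, hCD₀, hd₀⟩ := M.exists_facet hC
  refine _root_.nonempty_Hcoh_equiv (M.coneDim_ne hi) φ (fun k => ⟨(k * z D₀) • cochain K Φ.cones C i D₀, ?_⟩) ?_
  · rw [map_smul, hφ_cochain D₀ hD₀ hCD₀ hd₀, smul_eq_mul, mul_assoc, hsq D₀ hD₀ hCD₀ hd₀, mul_one]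
  have hle : coboundaries K ε.eps Φ.cones C i ≤ LinearMap.ker φ := by
    intro x hx
    obtain ⟨y, hy⟩ := exists_of_mem_coboundaries Φ.finite hx
    rw [LinearMap.mem_ker, hφ_apply]
    simp_rw [hy, finsum_eq_sum_of_fintype, Finset.mul_sum]
    rw [Finset.sum_comm]
    refine Finset.sum_eq_zero fun R _ => ?_
    have hRd : coneDim R.1 = m := by have := R.2.2.2; omega
    have hR' : R.1 ∉ Φ'.cones := fun h => hC' (M.mem_of_subset hC h R.2.2.1)
    obtain ⟨D, hD, hRD, hd⟩ := M.exists_facet R.2.1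
    obtain ⟨D', w⟩ := M.exists_wall R.2.1 hR' hRd hD hRD hd
    have h1 : φ (fun F => (ε.eps R.1 F.1 : K)) = 0 := by
      have h2 := w.dim₂
      rw [M.coboundary_of_wall ε hi w hRd, map_add, map_smul, map_smul, hφ_cochain D hD (R.2.2.1.trans hRD) hd,
        hφ_cochain D' w.mem₂ (R.2.2.1.trans w.sub₂) (by omega)]
      have h := congrArg (Int.cast : ℤ → K) (hw R.1 D D' w R.2.2.1 hRd)
      push_cast at h
      simpa using h
    rw [hφ_apply] at h1
    rw [← zero_mul (y R), ← h1, Finset.sum_mul]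
    exact Finset.sum_congr rfl fun _ _ => by ring
  refine le_antisymm (fun x hx => ?_) hle
  have hspan : ∀ D ∈ Φ.cones, C ⊆ D → (coneDim D : ℤ) = i + 1 → cochain K Φ.cones C i D ∈
      coboundaries K ε.eps Φ.cones C i ⊔ Submodule.span K {cochain K Φ.cones C i D₀} := by
    intro D hD hCD hd
    refine M.imp_of_wall_star hconn hC (P := fun D => cochain K Φ.cones C i D ∈
      coboundaries K ε.eps Φ.cones C i ⊔ Submodule.span K {cochain K Φ.cones C i D₀})
      (fun R D₁ D₂ w hCR hR h1 => ?_) hD₀ hD hCD₀ hCD hd₀ (by omega)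
      (Submodule.mem_sup_right (Submodule.mem_span_singleton_self _))
    have h := coboundary_mem (K := K) (eps := ε.eps) Φ.finite w.mem hCR (i := i) (by omega)
    rw [M.coboundary_of_wall ε hi w hR] at h
    have h2 := Submodule.smul_mem _ (ε.eps R D₂ : K)
      (Submodule.sub_mem _ (Submodule.mem_sup_left h) (Submodule.smul_mem _ (ε.eps R D₁ : K) h1))
    rwa [add_sub_cancel_left, smul_smul, isUnit_eps ε w.mem w.mem₂ w.sub₂ w.dim₂, one_smul] at h2
  obtain ⟨b, hb, c, hc, rfl⟩ := Submodule.mem_sup.1 (mem_of_cochain_mem Φ.finite hspan x)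
  obtain ⟨k, rfl⟩ := Submodule.mem_span_singleton.1 hc
  have h0 : φ b = 0 := hle hb
  rw [LinearMap.mem_ker, map_add, h0, zero_add, map_smul, hφ_cochain D₀ hD₀ hCD₀ hd₀, smul_eq_mul] at hx
  have hk : k = 0 := by
    rw [← mul_one k, ← hsq D₀ hD₀ hCD₀ hd₀, ← mul_assoc, hx, zero_mul]
  rw [hk, zero_smul, add_zero]
  exact hb

end IsManifoldFan

end

section

section toric
open Fan
variable (K : Type) [Field K] {d : ℕ} {Φ : Fan d} {C D E : Set (Fin d → ℝ)}

lemma Z2R_add (a b : Fin d → ℤ) : Z2R (a + b) = Z2R a + Z2R b := by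
  funext i; simp [Z2R]

lemma Z2R_zero : Z2R (0 : Fin d → ℤ) = 0 := by
  funext i; simp [Z2R]

lemma Z2R_eq_zero {a : Fin d → ℤ} : Z2R a = 0 ↔ a = 0 := by
  refine ⟨fun h => funext fun i => ?_, fun h => h ▸ Z2R_zero⟩
  have := congrFun h i
  simpa [Z2R] using this

/-- Restriction of polynomials to the lattice points of a cone. -/
def coneAevalPoly (Φ : Fan d) (D : Set (Fin d → ℝ)) : Φ.polyRing K →ₐ[K] AddMonoidAlgebra K (Fin d → ℤ) :=
  MvPolynomial.aeval (R := K) (σ := Φ.supp) fun a => if Z2R a.1 ∈ D then AddMonoidAlgebra.single a.1 1 else 0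

lemma coneAevalPoly_X (a : Φ.supp) :
    coneAevalPoly K Φ D (Φ.X K a) = if Z2R a.1 ∈ D then AddMonoidAlgebra.single a.1 1 else 0 :=
  MvPolynomial.aeval_X _ a

lemma coneAevalPoly_Xaux (hD : D ∈ Φ.cones) (a : Fin d → ℤ) :
    coneAevalPoly K Φ D (Φ.Xaux K a) = if Z2R a ∈ D then AddMonoidAlgebra.single a 1 else 0 := by
  unfold Fan.Xaux
  split_ifs with h1 h2 h2
  · rw [coneAevalPoly_X, if_pos h2]
  · rw [coneAevalPoly_X, if_neg h2]
  · exact absurd ⟨D, hD, h2⟩ h1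
  · exact map_zero _

lemma add_mem_iff (hC : C ∈ Φ.cones) (hD : D ∈ Φ.cones) {x y : Fin d → ℝ} (hx : x ∈ C) (hy : y ∈ C) :
    x + y ∈ D ↔ x ∈ D ∧ y ∈ D := by
  refine ⟨fun h => ?_, fun h => (cc hD).add_mem h.1 h.2⟩
  have h1 := (Φ.inter_face C hC D hD).1.2.2 x hx y hy ⟨(cc hC).add_mem hx hy, h⟩
  exact ⟨h1.1.2, h1.2.2⟩

lemma relIdeal_le_ker (hD : D ∈ Φ.cones) : ∀ z ∈ Φ.relIdeal K, coneAevalPoly K Φ D z = 0 := by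
  suffices h : Φ.relIdeal K ≤ RingHom.ker (coneAevalPoly K Φ D) from fun z hz => h hz
  refine Ideal.span_le.2 ?_
  rintro z ((⟨a, b, ⟨C, hC, ha, hb⟩, rfl⟩ | ⟨a, b, h, rfl⟩) | ⟨a, ha, rfl⟩)
  · change coneAevalPoly K Φ D _ = 0
    rw [map_sub, map_mul, coneAevalPoly_X, coneAevalPoly_X, coneAevalPoly_Xaux K hD, Z2R_add]
    simp only [add_mem_iff hC hD ha hb]
    by_cases h1 : Z2R a.1 ∈ D <;> by_cases h2 : Z2R b.1 ∈ D <;>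
      simp [h1, h2, AddMonoidAlgebra.single_mul_single]
  · change coneAevalPoly K Φ D _ = 0
    rw [map_mul, coneAevalPoly_X, coneAevalPoly_X]
    by_cases h1 : Z2R a.1 ∈ D
    · rw [if_neg fun h2 => h ⟨D, hD, h1, h2⟩, mul_zero]
    · rw [if_neg h1, zero_mul]
  · change coneAevalPoly K Φ D _ = 0
    rw [map_sub, map_one, coneAevalPoly_X, ha, Z2R_zero, if_pos (cc hD).zero_mem, ← AddMonoidAlgebra.one_def, sub_self]

/-- Restriction of the toric face ring to the lattice points of a cone. -/
def coneAeval (hD : D ∈ Φ.cones) : ToricFaceRing K Φ →ₐ[K] AddMonoidAlgebra K (Fin d → ℤ) :=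
  Ideal.Quotient.liftₐ (Φ.relIdeal K) (coneAevalPoly K Φ D) (relIdeal_le_ker K hD)

lemma coneAeval_xpow (hD : D ∈ Φ.cones) (a : Fin d → ℤ) :
    coneAeval K hD (xpow K Φ a) = if Z2R a ∈ D then AddMonoidAlgebra.single a 1 else 0 :=
  coneAevalPoly_Xaux K hD a

lemma xpow_eq_zero {a : Fin d → ℤ} (h : a ∉ Φ.supp) : xpow K Φ a = 0 := by
  unfold xpow Fan.Xaux
  rw [dif_neg h]
  exact map_zero (Ideal.Quotient.mk (Φ.relIdeal K))

lemma xpow_mul_xpow (hC : C ∈ Φ.cones) {a b : Fin d → ℤ} (ha : Z2R a ∈ C) (hb : Z2R b ∈ C) :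
    xpow K Φ a * xpow K Φ b = xpow K Φ (a + b) := by
  have h1 : a ∈ Φ.supp := ⟨C, hC, ha⟩
  have h2 : b ∈ Φ.supp := ⟨C, hC, hb⟩
  have h : Φ.X K ⟨a, h1⟩ * Φ.X K ⟨b, h2⟩ - Φ.Xaux K (a + b) ∈ Φ.relIdeal K :=
    Ideal.subset_span (Or.inl (Or.inl ⟨⟨a, h1⟩, ⟨b, h2⟩, ⟨C, hC, ha, hb⟩, rfl⟩))
  have h3 := (Ideal.Quotient.eq (I := Φ.relIdeal K)).2 h
  rw [map_mul] at h3
  unfold xpow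
  rw [← h3]
  simp only [Fan.Xaux, dif_pos h1, dif_pos h2]
  rfl

lemma xpow_mul_xpow_of_forall {a b : Fin d → ℤ} (h : ∀ C ∈ Φ.cones, Z2R a ∈ C → Z2R b ∉ C) :
    xpow K Φ a * xpow K Φ b = 0 := by
  by_cases h1 : a ∈ Φ.supp
  · by_cases h2 : b ∈ Φ.supp
    · have h3 : Φ.X K ⟨a, h1⟩ * Φ.X K ⟨b, h2⟩ ∈ Φ.relIdeal K :=
        Ideal.subset_span (Or.inl (Or.inr ⟨⟨a, h1⟩, ⟨b, h2⟩, fun ⟨C, hC, h3, h4⟩ => h C hC h3 h4, rfl⟩))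
      have h4 := Ideal.Quotient.eq_zero_iff_mem.2 h3
      rw [map_mul] at h4
      unfold xpow
      simp only [Fan.Xaux, dif_pos h1, dif_pos h2]
      exact h4
    · rw [xpow_eq_zero K h2, mul_zero]
  · rw [xpow_eq_zero K h1, zero_mul]

lemma xpow_zero (hC : C ∈ Φ.cones) : xpow K Φ 0 = 1 := by
  have h1 : (0 : Fin d → ℤ) ∈ Φ.supp := ⟨C, hC, by rw [Z2R_zero]; exact (cc hC).zero_mem⟩
  have h : Φ.X K ⟨0, h1⟩ - 1 ∈ Φ.relIdeal K := Ideal.subset_span (Or.inr ⟨⟨0, h1⟩, rfl, rfl⟩)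
  have h3 := (Ideal.Quotient.eq (I := Φ.relIdeal K)).2 h
  unfold xpow
  simp only [Fan.Xaux, dif_pos h1]
  exact h3

/-- The toric face ring is spanned by monomials. -/
lemma mem_span_xpow (hC : C ∈ Φ.cones) (f : ToricFaceRing K Φ) : f ∈ Submodule.span K (Set.range (xpow K Φ)) := by
  set S := Submodule.span K (Set.range (xpow K Φ)) with hS
  have hmul : ∀ f ∈ S, ∀ g ∈ S, f * g ∈ S := by
    intro f hf g hg
    induction hf, hg using Submodule.span_induction₂ with
    | mem_mem x y hx hy =>
      obtain ⟨a, rfl⟩ := hx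
      obtain ⟨b, rfl⟩ := hy
      by_cases h : ∃ C ∈ Φ.cones, Z2R a ∈ C ∧ Z2R b ∈ C
      · obtain ⟨C, hC, ha, hb⟩ := h
        rw [xpow_mul_xpow K hC ha hb]
        exact Submodule.subset_span ⟨_, rfl⟩
      · rw [xpow_mul_xpow_of_forall K fun C hC ha hb => h ⟨C, hC, ha, hb⟩]
        exact S.zero_mem
    | zero_left y _ => rw [zero_mul]; exact S.zero_mem
    | zero_right x _ => rw [mul_zero]; exact S.zero_mem
    | add_left x y z _ _ _ h1 h2 => rw [add_mul]; exact S.add_mem h1 h2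
    | add_right x y z _ _ _ h1 h2 => rw [mul_add]; exact S.add_mem h1 h2
    | smul_left r x y _ _ h => rw [smul_mul_assoc]; exact S.smul_mem _ h
    | smul_right r x y _ _ h => rw [mul_smul_comm]; exact S.smul_mem _ h
  have hone : (1 : ToricFaceRing K Φ) ∈ S := by
    rw [← xpow_zero K hC]
    exact Submodule.subset_span ⟨_, rfl⟩
  obtain ⟨p, rfl⟩ := Ideal.Quotient.mk_surjective (I := Φ.relIdeal K) f
  induction p using MvPolynomial.induction_on with
  | C k =>
    have : Ideal.Quotient.mk (Φ.relIdeal K) (MvPolynomial.C k) = (k • 1 : ToricFaceRing K Φ) := by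
      rw [Algebra.smul_def, mul_one]
      rfl
    exact this ▸ S.smul_mem k hone
  | add p q hp hq => exact (map_add (Ideal.Quotient.mk (Φ.relIdeal K)) p q) ▸ S.add_mem hp hq
  | mul_X p a hp =>
    have h : Ideal.Quotient.mk (Φ.relIdeal K) (MvPolynomial.X a) = xpow K Φ a.1 := by
      unfold xpow
      simp only [Fan.Xaux, dif_pos a.2]
      rfl
    rw [map_mul]
    refine hmul _ hp _ ?_
    rw [h]
    exact Submodule.subset_span ⟨_, rfl⟩

lemma ker_coneAeval_le (hD : D ∈ Φ.cones) (hE : E ∈ Φ.cones) (h : E ⊆ D) {f : ToricFaceRing K Φ}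
    (hf : coneAeval K hD f = 0) : coneAeval K hE f = 0 := by
  obtain ⟨c, rfl⟩ := Finsupp.mem_span_range_iff_exists_finsupp.1 (mem_span_xpow K hD f)
  have hc : ∀ a, Z2R a ∈ D → c a = 0 := by
    intro a ha
    have h1 := congrArg (fun g => AddMonoidAlgebra.coeff g a) hf
    simp only [Finsupp.sum, map_sum, map_smul, coneAeval_xpow] at h1
    by_contra hne
    rw [AddMonoidAlgebra.coeff_sum, Finsupp.finsetSum_apply, Finset.sum_eq_single a] at h1
    · simp [ha] at h1
      exact hne h1
    · intro b _ hb
      split_ifs <;> simp [hb]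
    · intro h2
      exact absurd (Finsupp.notMem_support_iff.1 h2) hne
  rw [Finsupp.sum, map_sum]
  refine Finset.sum_eq_zero fun a _ => ?_
  rw [map_smul, coneAeval_xpow]
  split_ifs with h1
  · rw [hc a (h h1), zero_smul]
  · rw [smul_zero]

end toric

end

section

section toric
open Fan
variable (K : Type) [Field K] {d : ℕ} {Φ Φ' : Fan d} {C D E : Set (Fin d → ℝ)} {m : ℕ}

lemma exists_nat_smul_eq_Z2R {v : Fin d → ℝ} (h : ∀ i, ∃ q : ℚ, v i = (q : ℝ)) :
    ∃ (n : ℕ) (a : Fin d → ℤ), 0 < n ∧ Z2R a = (n : ℝ) • v := by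
  choose q hq using h
  refine ⟨∏ i, (q i).den, fun i => (q i).num * ∏ j ∈ Finset.univ.erase i, ((q j).den : ℤ),
    Finset.prod_pos fun i _ => (q i).den_pos, funext fun i => ?_⟩
  have h1 : ((q i).den : ℝ) ≠ 0 := Nat.cast_ne_zero.2 (q i).den_ne_zero
  have h2 : (q i : ℝ) * (q i).den = (q i).num := by
    exact_mod_cast Rat.mul_den_eq_num (q i)
  rw [← Finset.mul_prod_erase _ _ (Finset.mem_univ i)]
  simp only [Z2R, Pi.smul_apply, smul_eq_mul, hq]
  push_cast
  rw [← h2]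
  ring

/-- A cone of a rational fan that is not contained in a convex cone has a lattice point outside it. -/
lemma exists_lattice_notMem (hD : D ∈ Φ.cones) (hE : IsConvexCone E) (h : ¬ D ⊆ E) :
    ∃ a : Fin d → ℤ, Z2R a ∈ D ∧ Z2R a ∉ E := by
  obtain ⟨S, hS, hDS⟩ := (Φ.pointed D hD).1
  have h1 : ∃ v ∈ S, v ∉ E := by
    by_contra! hall
    refine h fun x hx => ?_
    rw [hDS] at hx
    obtain ⟨c, hc, rfl⟩ := hx
    exact Finset.sum_induction _ (· ∈ E) (fun a b ha hb => hE.2.1 a ha b hb) hE.1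
      fun v hv => hE.2.2 v (hall v hv) _ (hc v)
  obtain ⟨v, hv, hvE⟩ := h1
  have hvD : v ∈ D := by
    rw [hDS]
    refine ⟨fun w => if w = v then 1 else 0, fun w => by beta_reduce; split_ifs <;> norm_num, ?_⟩
    simp [hv]
  obtain ⟨n, a, hn, ha⟩ := exists_nat_smul_eq_Z2R (hS v hv)
  have hn' : (0 : ℝ) < n := Nat.cast_pos.2 hn
  refine ⟨a, ha ▸ (cc hD).2.2 v hvD _ hn'.le, fun haE => hvE ?_⟩
  have := hE.2.2 _ haE (n : ℝ)⁻¹ (inv_pos.2 hn').le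
  rwa [ha, smul_smul, inv_mul_cancel₀ hn'.ne', one_smul] at this

lemma exists_lattice_ne_zero (hD : D ∈ Φ.cones) (h : D ≠ {0}) : ∃ a : Fin d → ℤ, a ≠ 0 ∧ Z2R a ∈ D := by
  obtain ⟨a, ha, ha0⟩ := exists_lattice_notMem hD (cc (zero_cone_mem hD))
    fun h1 => h (h1.antisymm (by simpa using (cc hD).zero_mem))
  exact ⟨a, fun h0 => ha0 (by simp [h0, Z2R_zero]), ha⟩

/-- The monomial prime ideal of a cone. -/
def coneSpec (hD : D ∈ Φ.cones) : PrimeSpectrum (ToricFaceRing K Φ) :=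
  ⟨RingHom.ker (coneAeval K hD), RingHom.ker_isPrime _⟩

lemma coneSpec_lt (hD : D ∈ Φ.cones) (hE : E ∈ Φ.cones) (h : E ⊆ D) (hne : ¬ D ⊆ E) : coneSpec K hD < coneSpec K hE := by
  refine lt_of_le_not_ge (fun f hf => ker_coneAeval_le K hD hE h hf) fun hle => ?_
  obtain ⟨a, haD, haE⟩ := exists_lattice_notMem hD (cc hE) hne
  have h1 : xpow K Φ a ∈ RingHom.ker (coneAeval K hE) := by
    rw [RingHom.mem_ker, coneAeval_xpow, if_neg haE]
  have h2 : xpow K Φ a ∈ RingHom.ker (coneAeval K hD) := hle h1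
  rw [RingHom.mem_ker, coneAeval_xpow, if_pos haD] at h2
  have h3 := congrArg (fun p => p.coeff a) h2
  simp at h3

lemma two_le_ringKrullDim (hD : D ∈ Φ.cones) (h : 2 ≤ coneDim D) : (2 : ℕ) ≤ ringKrullDim (ToricFaceRing K Φ) := by
  have h0 := zero_cone_mem hD
  obtain ⟨R, hR, h0R, hRD, hdim⟩ := exists_ridge h0 hD (by simpa using (cc hD).zero_mem)
    (by rintro rfl; rw [coneDim_zero] at h; omega)
  have hlt1 := coneSpec_lt K hD hR hRD fun h1 => by
    rw [h1.antisymm hRD] at hdim; omega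
  have hlt2 := coneSpec_lt K hR h0 h0R fun h1 => by
    rw [h1.antisymm h0R, coneDim_zero] at hdim; omega
  refine Order.le_krullDim_iff.2 ⟨LTSeries.mk 2 ![coneSpec K hD, coneSpec K hR, coneSpec K h0] ?_, rfl⟩
  rw [Fin.strictMono_iff_lt_succ]
  intro i
  fin_cases i
  · exact hlt1
  · exact hlt2

/-- A Cohen–Macaulay ring of dimension at least two has a regular sequence of length two. -/
lemma IsCMRingWrt.exists_pair {R : Type} [CommRing R] {I : Ideal R} (h : IsCMRingWrt R I) (h2 : (2 : ℕ) ≤ ringKrullDim R) :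
    ∃ x ∈ I, ∃ y ∈ I, x ∈ nonZeroDivisors R ∧ ∀ z, y * z ∈ Ideal.span {x} → z ∈ Ideal.span {x} := by
  obtain ⟨l, hl, hlen⟩ := h
  rw [← hlen] at h2
  have hlen' : 2 ≤ l.length := WithTop.coe_le_coe.1 (WithBot.coe_le_coe.1 h2)
  unfold IsRegSeqIn at hl
  obtain ⟨n, hn⟩ := Nat.exists_eq_add_of_le' hlen'
  rw [hn] at hl
  obtain ⟨x, xs, -, hxI, hx, y', ys, -, hyI', hy, -⟩ := hl
  obtain ⟨y, hyI, rfl⟩ := (Ideal.mem_map_iff_of_surjective _ Ideal.Quotient.mk_surjective).1 hyI'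
  refine ⟨x, hxI, y, hyI, hx, fun z hz => ?_⟩
  rw [← Ideal.Quotient.eq_zero_iff_mem, map_mul, mul_comm] at hz
  exact Ideal.Quotient.eq_zero_iff_mem.1 ((mem_nonZeroDivisors_iff_right.1 hy) _ hz)

/-- If two ideals with zero product jointly contain a regular sequence of length two, then they are
annihilated by complementary elements. -/
lemma exists_annihilators {R : Type} [CommRing R] {x y : R} {A B : Ideal R} (hAB : A * B = ⊥) (hx : x ∈ A ⊔ B)
    (hy : y ∈ A ⊔ B) (hreg : x ∈ nonZeroDivisors R) (hreg' : ∀ z, y * z ∈ Ideal.span {x} → z ∈ Ideal.span {x}) :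
    ∃ r : R, (∀ a ∈ A, (1 - r) * a = 0) ∧ ∀ b ∈ B, r * b = 0 := by
  have h0 : ∀ a ∈ A, ∀ b ∈ B, a * b = 0 := fun a ha b hb => by
    have := Ideal.mul_mem_mul ha hb
    rwa [hAB] at this
  obtain ⟨xa, hxa, xb, hxb, rfl⟩ := Submodule.mem_sup.1 hx
  obtain ⟨ya, hya, yb, hyb, rfl⟩ := Submodule.mem_sup.1 hy
  obtain ⟨r, hr⟩ := Ideal.mem_span_singleton'.1 (hreg' xa
    (Ideal.mem_span_singleton'.2 ⟨ya, by linear_combination h0 ya hya xb hxb - h0 xa hxa yb hyb⟩))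
  have hcancel : ∀ z, z * (xa + xb) = 0 → z = 0 := fun z hz => (mem_nonZeroDivisors_iff_right.1 hreg) z hz
  have hu : (1 - r) * xa = 0 := by
    refine hcancel _ ?_
    have := h0 xa hxa xb hxb
    linear_combination (1 - r) * this + r * this - xa * hr
  refine ⟨r, fun a ha => hcancel _ ?_, fun b hb => hcancel _ ?_⟩
  · linear_combination a * hu + (1 - r) * h0 a ha xb hxb
  · linear_combination b * hr + h0 xa hxa b hb

/-- The ideal generated by the nonconstant monomials lying in cones with property `Q`. -/
def colorIdeal (Φ : Fan d) (Q : Set (Fin d → ℝ) → Prop) : Ideal (ToricFaceRing K Φ) :=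
  Ideal.span (xpow K Φ '' {a | a ≠ 0 ∧ ∃ F ∈ Φ.cones, Z2R a ∈ F ∧ Q F})

lemma gradedMaxIdeal_le_colorIdeal (Q : Set (Fin d → ℝ) → Prop) :
    gradedMaxIdeal K Φ ≤ colorIdeal K Φ Q ⊔ colorIdeal K Φ fun F => ¬ Q F := by
  refine Ideal.span_le.2 ?_
  rintro _ ⟨a, ha, rfl⟩
  by_cases hs : a ∈ Φ.supp
  · obtain ⟨F, hF, haF⟩ := hs
    by_cases hQ : Q F
    · exact Ideal.mem_sup_left (Ideal.subset_span ⟨a, ⟨ha, F, hF, haF, hQ⟩, rfl⟩)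
    · exact Ideal.mem_sup_right (Ideal.subset_span ⟨a, ⟨ha, F, hF, haF, hQ⟩, rfl⟩)
  · rw [xpow_eq_zero K hs]
    exact Ideal.zero_mem _

lemma colorIdeal_mul {Q : Set (Fin d → ℝ) → Prop}
    (hQ : ∀ E ∈ Φ.cones, ∀ E' ∈ Φ.cones, E ≠ {0} → E ⊆ E' → (Q E ↔ Q E')) :
    colorIdeal K Φ Q * colorIdeal K Φ (fun F => ¬ Q F) = ⊥ := by
  have key : ∀ a : Fin d → ℤ, a ≠ 0 → ∀ F ∈ Φ.cones, ∀ G ∈ Φ.cones, Z2R a ∈ F → Z2R a ∈ G → (Q F ↔ Q G) := by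
    intro a ha F hF G hG haF haG
    have hne : F ∩ G ≠ {0} := fun h => ha (Z2R_eq_zero.1 (by
      have : Z2R a ∈ F ∩ G := ⟨haF, haG⟩
      simpa [h] using this))
    exact (hQ _ (inter_mem hF hG) F hF hne Set.inter_subset_left).symm.trans
      (hQ _ (inter_mem hF hG) G hG hne Set.inter_subset_right)
  rw [colorIdeal, colorIdeal, Ideal.span_mul_span', eq_bot_iff, Ideal.span_le]
  rintro _ ⟨_, ⟨a, ⟨ha, F, hF, haF, hQF⟩, rfl⟩, _, ⟨b, ⟨hb, G, hG, hbG, hQG⟩, rfl⟩, rfl⟩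
  refine xpow_mul_xpow_of_forall K fun H hH haH hbH => hQG ?_
  exact (key b hb H hH G hG hbH hbG).1 ((key a ha F hF H hH haF haH).1 hQF)

lemma coneAeval_eq_zero_of_colorIdeal (hE : E ∈ Φ.cones) (hne : E ≠ {0}) {Q : Set (Fin d → ℝ) → Prop} (hQ : Q E)
    {f : ToricFaceRing K Φ} (hf : ∀ a ∈ colorIdeal K Φ Q, f * a = 0) :
    coneAeval K (zero_cone_mem hE) f = 0 := by
  obtain ⟨a, ha0, ha⟩ := exists_lattice_ne_zero hE hne
  have h1 := congrArg (coneAeval K hE) (hf _ (Ideal.subset_span ⟨a, ⟨ha0, E, hE, ha, hQ⟩, rfl⟩))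
  rw [map_mul, map_zero, coneAeval_xpow, if_pos ha] at h1
  refine ker_coneAeval_le K hE _ (by simpa using (cc hE).zero_mem) ((mul_eq_zero.1 h1).resolve_right fun h2 => ?_)
  have h3 := congrArg (fun p => p.coeff a) h2
  simp at h3

/-- The nonzero cones of a Cohen–Macaulay fan of dimension at least two form a connected poset. -/
theorem connected_of_isCMRingWrt (hCM : IsCMRingWrt (ToricFaceRing K Φ) (gradedMaxIdeal K Φ)) (hD : D ∈ Φ.cones)
    (h2 : 2 ≤ coneDim D) (Q : Set (Fin d → ℝ) → Prop)
    (hQ : ∀ E ∈ Φ.cones, ∀ E' ∈ Φ.cones, E ≠ {0} → E ⊆ E' → (Q E ↔ Q E')) :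
    ∀ E ∈ Φ.cones, ∀ E' ∈ Φ.cones, E ≠ {0} → E' ≠ {0} → Q E → Q E' := by
  intro E hE E' hE' hne hne' hQE
  by_contra hQE'
  obtain ⟨x, hx, y, hy, hreg, hreg'⟩ := hCM.exists_pair (two_le_ringKrullDim K hD h2)
  obtain ⟨r, hrA, hrB⟩ := exists_annihilators (colorIdeal_mul K hQ) (gradedMaxIdeal_le_colorIdeal K Q hx)
    (gradedMaxIdeal_le_colorIdeal K Q hy) hreg hreg'
  have h1 := coneAeval_eq_zero_of_colorIdeal K hE hne hQE hrA
  have h3 := coneAeval_eq_zero_of_colorIdeal K hE' hne' (Q := fun F => ¬ Q F) hQE' hrB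
  rw [map_sub, map_one, h3, sub_zero] at h1
  exact one_ne_zero h1

end toric

section final
open Fan
variable {d : ℕ} {Φ Φ' : Fan d}

lemma Fan.exists_pos_dim {n : ℕ} (hmfd : IsManifoldWithBoundary n ↥(GammaSet Φ.cones)
      {x : ↥(GammaSet Φ.cones) | (x : Fin d → ℝ) ∈ ⋃₀ Φ'.cones})
    (hbdne : {x : ↥(GammaSet Φ.cones) | (x : Fin d → ℝ) ∈ ⋃₀ Φ'.cones}.Nonempty) : 0 < n := by
  obtain ⟨p, hp⟩ := hbdne
  obtain ⟨U, V, -, -, hpU, φ, hφ⟩ := hmfd p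
  exact ((hφ ⟨p, hpU⟩).1 hp).1

lemma isManifoldFan_of_isManifoldWithBoundary {m : ℕ} (hdim : Φ.dim = m + 1) (hsub : Φ'.cones ⊆ Φ.cones)
    (hmfd : IsManifoldWithBoundary m ↥(GammaSet Φ.cones)
      {x : ↥(GammaSet Φ.cones) | (x : Fin d → ℝ) ∈ ⋃₀ Φ'.cones})
    (hbdne : {x : ↥(GammaSet Φ.cones) | (x : Fin d → ℝ) ∈ ⋃₀ Φ'.cones}.Nonempty) : IsManifoldFan Φ Φ' m where
  sub := hsub
  pos := exists_pos_dim hmfd hbdne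
  dim := hdim
  chart _ hp hp0 := exists_halfChart (exists_pos_dim hmfd hbdne) hmfd hp hp0
  ne := by
    obtain ⟨p, hp⟩ := hbdne
    refine ⟨p, hp, fun h0 => ?_⟩
    have h1 : ∑ i, ((p : Fin d → ℝ) i) ^ 2 = 1 := p.2.2
    simp [h0] at h1

end final

end

/-- Suppose `K[Φ]` is Cohen--Macaulay, `X = |Γ_Φ|` is a manifold with
non-empty boundary `∂X = |Γ_{Φ'}|` for a subfan `Φ'`, `Φ'` is an Euler fan and `K[Φ']`
is Cohen--Macaulay. Then `H̃^{dim Φ − 1}(𝒞^•_{star_Φ(C)})` vanishes for `C ∈ Φ'` and is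
isomorphic to `K` for `C ∉ Φ'`. -/
theorem star_cohomology_of_manifold_with_boundary (K : Type) [Field K] {d : ℕ}
    (Φ Φ' : Fan d) (hsub : Φ'.cones ⊆ Φ.cones)
    (hCM : IsCMRingWrt (ToricFaceRing K Φ) (gradedMaxIdeal K Φ))
    (hmfd : IsManifoldWithBoundary (Fan.dim Φ - 1) ↥(GammaSet Φ.cones)
      {x : ↥(GammaSet Φ.cones) | (x : Fin d → ℝ) ∈ ⋃₀ Φ'.cones})
    (hbdne : {x : ↥(GammaSet Φ.cones) | (x : Fin d → ℝ) ∈ ⋃₀ Φ'.cones}.Nonempty)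
    (hEuler : IsEulerFan Φ')
    (hCM' : IsCMRingWrt (ToricFaceRing K Φ') (gradedMaxIdeal K Φ'))
    (ε : IncidenceFunction Φ) :
    ∀ C ∈ Φ.cones,
      (C ∈ Φ'.cones → Subsingleton (Hcoh K ε.eps Φ.cones C ((Fan.dim Φ : ℤ) - 1))) ∧
      (C ∉ Φ'.cones →
        Nonempty (Hcoh K ε.eps Φ.cones C ((Fan.dim Φ : ℤ) - 1) ≃ₗ[K] K)) := by
  obtain ⟨m, hm⟩ : ∃ m, Fan.dim Φ = m + 1 :=
    ⟨Fan.dim Φ - 1, by have := Fan.exists_pos_dim hmfd hbdne; omega⟩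
  have hi : (Fan.dim Φ : ℤ) - 1 = m := by rw [hm]; push_cast; ring
  have M : IsManifoldFan Φ Φ' m :=
    isManifoldFan_of_isManifoldWithBoundary hm hsub (by rwa [hm] at hmfd) hbdne
  intro C hC
  obtain ⟨D, hD, -, hdim⟩ := M.exists_facet hC
  have hconn := connected_of_isCMRingWrt K hCM hD (by have := M.pos; omega)
  exact ⟨fun hC' => M.subsingleton_Hcoh ε hconn hC' hi, fun hC' => M.nonempty_Hcoh_equiv ε hconn hC hC' hi⟩
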